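/- arXiv:2602.09966 — 3 statements merged into one kernel-verified Lean document; each statement's English description precedes it below -/
import Mathlib

section
/- Let X : f = 0 be a nodal surface in P³ of degree d ≥ 5, i.e., f is reduced, its singular locus is finite, and every singular point is an ordinary node (A₁ singularity). Then mdr(f) ≥ 2d − ⌊d/2⌋ − 3 > d − 1; in other words, every Jacobian syzygy of f of degree less than 2d − ⌊d/2⌋ − 3 is a Koszul type relation. Consequently, in any minimal system of homogeneous generators of AR(f), exactly six generators have degree d − 1 (namely Koszul type relations), and every other generator has degree at least 2d − ⌊d/2⌋ − 3; equivalently, the graded Betti numbers d_1 ≤ … ≤ d_p of X satisfy d_i = d − 1 for i = 1, …, 6 and d_i ≥ 2d − ⌊d/2⌋ − 3 for i > 6. -/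
open MvPolynomial

noncomputable section

abbrev S4 : Type := MvPolynomial (Fin 4) ℂ

/-- `g` is homogeneous of integer degree `δ`: either `g = 0` or `δ ≥ 0` and `g` homogeneous. -/
def HomogZ (g : S4) (δ : ℤ) : Prop :=
  g = 0 ∨ (0 ≤ δ ∧ g.IsHomogeneous δ.toNat)

/-- The map `S^4 → S` given by the partial derivatives of `f`; its image is the Jacobian ideal. -/
def jacMap (f : S4) : (Fin 4 → S4) →ₗ[S4] S4 where
  toFun v := ∑ i, v i * pderiv i f
  map_add' a b := by simp [add_mul, Finset.sum_add_distrib]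
  map_smul' c a := by simp [Finset.mul_sum, mul_assoc]

/-- The Jacobian ideal of `f`. -/
def jacIdeal (f : S4) : Ideal S4 := Ideal.span (Set.range fun i => pderiv i f)

/-- Hilbert function of the Jacobian algebra `M(f) = S/J_f`: the dimension of its
degree `n` homogeneous component. -/
def hilb (f : S4) (n : ℕ) : ℕ :=
  Module.finrank ℂ
    ((homogeneousSubmodule (Fin 4) ℂ n) ⧸
      (Submodule.comap (homogeneousSubmodule (Fin 4) ℂ n).subtype
        (Submodule.restrictScalars ℂ (jacIdeal f))))

/-- The singular locus of the surface `X : f = 0` in `P³`. -/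
def singLocus (f : S4) : Set (Projectivization ℂ (Fin 4 → ℂ)) :=
  {P | ∀ i, eval P.rep (pderiv i f) = 0}

/-- A graded free resolution of `M(f)` of the shape (res2A). -/
structure JacRes (f : S4) {p q r : ℕ}
    (dd : Fin p → ℕ) (cc : Fin q → ℕ) (bb : Fin r → ℕ) where
  M1 : Matrix (Fin 4) (Fin p) S4
  M2 : Matrix (Fin p) (Fin q) S4
  M3 : Matrix (Fin q) (Fin r) S4
  hM1 : ∀ i a, (M1 i a).IsHomogeneous (dd a)
  hM2 : ∀ a b, HomogZ (M2 a b) ((cc b : ℤ) - (dd a : ℤ))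
  hM3 : ∀ b c, HomogZ (M3 b c) ((bb c : ℤ) - (cc b : ℤ))
  inj : Function.Injective M3.mulVecLin
  ex2 : LinearMap.range M3.mulVecLin = LinearMap.ker M2.mulVecLin
  ex1 : LinearMap.range M2.mulVecLin = LinearMap.ker M1.mulVecLin
  ex0 : LinearMap.range M1.mulVecLin = LinearMap.ker (jacMap f)

/-- Minimality of a resolution: all matrix entries lie in the irrelevant maximal ideal. -/
def JacRes.Minimal {f : S4} {p q r : ℕ} {dd : Fin p → ℕ} {cc : Fin q → ℕ} {bb : Fin r → ℕ}
    (R : JacRes f dd cc bb) : Prop :=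
  (∀ i a, constantCoeff (R.M1 i a) = 0) ∧ (∀ a b, constantCoeff (R.M2 a b) = 0) ∧
    (∀ b c, constantCoeff (R.M3 b c) = 0)

/-- `ρ ∈ S⁴` is a Jacobian syzygy of `f`. -/
def isSyzygy (f : S4) (ρ : Fin 4 → S4) : Prop := ∑ i, ρ i * pderiv i f = 0

/-- The Koszul syzygy `θ_{ij}`: component `f_j` in position `i`, `−f_i` in position `j`,
`0` elsewhere. -/
def koszul (f : S4) (i j : Fin 4) : Fin 4 → S4 :=
  fun l => if l = i then pderiv j f else if l = j then -(pderiv i f) else 0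

/-- `KR(f)`: the submodule of Koszul type relations, generated by the six `θ_{ij}`. -/
def KR (f : S4) : Submodule S4 (Fin 4 → S4) :=
  Submodule.span S4 {ρ | ∃ i j : Fin 4, i < j ∧ ρ = koszul f i j}

/-- The Hessian matrix of `f` evaluated at `v`. -/
def hessian (f : S4) (v : Fin 4 → ℂ) : Matrix (Fin 4) (Fin 4) ℂ :=
  Matrix.of fun i j => eval v (pderiv i (pderiv j f))

namespace NS
section koszul
variable {Q : Type*} [CommRing Q]

/-- first Koszul homology vanishes -/
def Kz (G0 G1 G2 : Q) : Prop :=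
  ∀ z0 z1 z2 : Q, G0 * z0 + G1 * z1 + G2 * z2 = 0 →
    ∃ v0 v1 v2, z0 = G1 * v2 - G2 * v1 ∧ z1 = G2 * v0 - G0 * v2 ∧ z2 = G0 * v1 - G1 * v0

theorem Kz.of_reg (G0 G1 G2 C1 C2 C3 : Q)
    (a0 a1 a2 : Q) (h1 : C1 = a0 * G0 + a1 * G1 + a2 * G2)
    (b0 b1 b2 : Q) (h2 : C2 = b0 * G0 + b1 * G1 + b2 * G2)
    (c0 c1 c2 : Q) (h3 : C3 = c0 * G0 + c1 * G1 + c2 * G2)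
    (r1 : ∀ a, C1 * a = 0 → a = 0)
    (r2 : ∀ a, (∃ s, C2 * a = s * C1) → ∃ s, a = s * C1)
    (r3 : ∀ a, (∃ s t, C3 * a = s * C1 + t * C2) → ∃ s t, a = s * C1 + t * C2) :
    Kz G0 G1 G2 := by
  have s0 : ∀ y : Q, (∃ s t, G0 * y = s * C1 + t * C2) → (∃ s t, G1 * y = s * C1 + t * C2) →
      (∃ s t, G2 * y = s * C1 + t * C2) → ∃ s t, y = s * C1 + t * C2 := by
    rintro y ⟨s, t, h⟩ ⟨s', t', h'⟩ ⟨s'', t'', h''⟩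
    apply r3
    exact ⟨c0 * s + c1 * s' + c2 * s'', c0 * t + c1 * t' + c2 * t'', by
      rw [h3]; linear_combination c0 * h + c1 * h' + c2 * h''⟩
  have s1 : ∀ z0 z1 z2 : Q, (∃ s, G0 * z1 - G1 * z0 = s * C1) → (∃ s, G0 * z2 - G2 * z0 = s * C1) →
      (∃ s, G1 * z2 - G2 * z1 = s * C1) → ∃ y, (∃ s, z0 - G0 * y = s * C1) ∧
      (∃ s, z1 - G1 * y = s * C1) ∧ (∃ s, z2 - G2 * y = s * C1) := by
    rintro z0 z1 z2 ⟨s01, h01⟩ ⟨s02, h02⟩ ⟨s12, h12⟩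
    obtain ⟨s, t, hy⟩ := s0 (b0 * z0 + b1 * z1 + b2 * z2)
      ⟨b1 * s01 + b2 * s02, z0, by rw [h2]; linear_combination b1 * h01 + b2 * h02⟩
      ⟨- b0 * s01 + b2 * s12, z1, by rw [h2]; linear_combination - b0 * h01 + b2 * h12⟩
      ⟨- b0 * s02 - b1 * s12, z2, by rw [h2]; linear_combination - b0 * h02 - b1 * h12⟩
    refine ⟨t, r2 _ ⟨G0 * s - b1 * s01 - b2 * s02, ?_⟩, r2 _ ⟨G1 * s + b0 * s01 - b2 * s12, ?_⟩,
      r2 _ ⟨G2 * s + b0 * s02 + b1 * s12, ?_⟩⟩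
    · linear_combination (exp := 1) z0 * h2 - b1 * h01 - b2 * h02 + G0 * hy
    · linear_combination (exp := 1) z1 * h2 + b0 * h01 - b2 * h12 + G1 * hy
    · linear_combination (exp := 1) z2 * h2 + b0 * h02 + b1 * h12 + G2 * hy
  intro z0 z1 z2 h
  -- v = a × z type vector
  obtain ⟨u, ⟨t0, e0⟩, ⟨t1, e1⟩, ⟨t2, e2⟩⟩ := s1 (a2 * z1 - a1 * z2) (a0 * z2 - a2 * z0)
    (a1 * z0 - a0 * z1)
    ⟨z2, by rw [h1]; linear_combination -a2 * h⟩
    ⟨-z1, by rw [h1]; linear_combination a1 * h⟩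
    ⟨z0, by rw [h1]; linear_combination -a0 * h⟩
  refine ⟨t0, t1, t2, ?_, ?_, ?_⟩
  · rw [← sub_eq_zero]; apply r1; linear_combination z0 * h1 + a0 * h + G1 * e2 - G2 * e1
  · rw [← sub_eq_zero]; apply r1; linear_combination z1 * h1 + a1 * h + G2 * e0 - G0 * e2
  · rw [← sub_eq_zero]; apply r1; linear_combination z2 * h1 + a2 * h + G0 * e1 - G1 * e0

theorem Kz.colon {G0 G1 G2 : Q} (h : Kz G0 G1 G2) {a s t : Q} (e : G2 * a = s * G0 + t * G1) :
    ∃ s t, a = s * G0 + t * G1 := by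
  obtain ⟨v0, v1, v2, -, -, e2⟩ := h (-s) (-t) a (by linear_combination e)
  exact ⟨v1, -v0, by rw [e2]; ring⟩

theorem colonB {F0 F1 F2 : Q} {m : ℕ}
    (k1 : Kz (F0 ^ (m+2)) (F1 ^ (m+2)) F2)
    (k2 : Kz (F0 ^ (m+2)) (F1 ^ (m+2)) (F2 ^ (m+1)))
    (k3 : Kz (F0 ^ (m+2)) F2 F1)
    (k4 : Kz (F0 ^ (m+2)) F2 (F1 ^ (m+1)))
    (k5 : Kz F1 F2 F0) {w : Q}
    (h0 : ∃ a b c, F0 * w = a * F0 ^ (m+2) + b * F1 ^ (m+2) + c * F2 ^ (m+2))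
    (h1 : ∃ a b c, F1 * w = a * F0 ^ (m+2) + b * F1 ^ (m+2) + c * F2 ^ (m+2))
    (h2 : ∃ a b c, F2 * w = a * F0 ^ (m+2) + b * F1 ^ (m+2) + c * F2 ^ (m+2)) :
    ∃ a b c e, w = a * F0 ^ (m+2) + b * F1 ^ (m+2) + c * F2 ^ (m+2) + e * (F0 * F1 * F2) ^ (m+1) := by
  obtain ⟨a, b, c, h⟩ := h2
  obtain ⟨s, t, e⟩ := k1.colon (a := w - c * F2 ^ (m+1)) (s := a) (t := b) (by linear_combination h)
  obtain ⟨a1, b1, c1, h1⟩ := h1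
  obtain ⟨s1, t1, e1⟩ := k2.colon (a := F1 * c - c1 * F2) (s := a1 - F1 * s) (t := b1 - F1 * t)
    (by linear_combination h1 - F1 * e)
  obtain ⟨s2, t2, e2⟩ := k3.colon (a := c - t1 * F1 ^ (m+1)) (s := s1) (t := c1)
    (by linear_combination e1)
  obtain ⟨a3, b3, c3, h3⟩ := h0
  -- w = s F0^ + t F1^ + c F2^(m+1),  c = t1 F1^(m+1) + s2 F0^ + t2 F2
  obtain ⟨s4, t4, e4⟩ := k2.colon (a := F0 * c - c3 * F2) (s := a3 - F0 * s) (t := b3 - F0 * t)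
    (by linear_combination h3 - F0 * e)
  obtain ⟨s5, t5, e5⟩ := k4.colon (a := F0 * t1 - t4 * F1) (s := s4 - F0 * s2) (t := c3 - F0 * t2)
    (by linear_combination e4 - F0 * e2)
  obtain ⟨s6, t6, e6⟩ := k5.colon (a := t1 - s5 * F0 ^ (m+1)) (s := t4) (t := t5)
    (by linear_combination e5)
  refine ⟨s + s2 * F2 ^ (m+1), t + s6 * F2^(m+1), t2 + t6 * F1 ^ (m+1), s5, ?_⟩
  rw [mul_pow, mul_pow]
  linear_combination e + F2^(m+1) * e2 + F1^(m+1) * F2^(m+1) * e6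

end koszul
end NS

namespace NS
section polyt

theorem mem_span3 {R : Type*} [CommRing R] {a b c x : R} :
    x ∈ Ideal.span {a, b, c} ↔ ∃ s t u, x = s * a + t * b + u * c := by
  rw [Ideal.span, Submodule.mem_span_triple]
  simp only [smul_eq_mul, eq_comm]

theorem mem_span4 {R : Type*} [CommRing R] {a b c e x : R} :
    x ∈ Ideal.span {a, b, c, e} ↔ ∃ s t u v, x = s * a + t * b + u * c + v * e := by
  rw [show ({a, b, c, e} : Set R) = insert e {a,b,c} by ext; simp; tauto,
    Ideal.mem_span_insert]
  simp only [mem_span3]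
  constructor
  · rintro ⟨v, _, ⟨s,t,u,rfl⟩, rfl⟩; exact ⟨s,t,u,v, by ring⟩
  · rintro ⟨s,t,u,v, rfl⟩; exact ⟨v, _, ⟨s,t,u,rfl⟩, by ring⟩

theorem mono_reg {σ K : Type*} [CommRing K] (A : Set σ) (n : σ → ℕ) (j : σ) (hj : j ∉ A) (N : ℕ)
    (a : MvPolynomial σ K)
    (h : X j ^ N * a ∈ Ideal.span ((fun i => (X i : MvPolynomial σ K) ^ n i) '' A)) :
    a ∈ Ideal.span ((fun i => (X i : MvPolynomial σ K) ^ n i) '' A) := by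
  classical
  have e : ((fun i => (X i : MvPolynomial σ K) ^ n i) '' A) =
      (fun s => monomial s (1:K)) '' ((fun i => Finsupp.single i (n i)) '' A) := by
    rw [Set.image_image]; simp [X_pow_eq_monomial]
  rw [e, mem_ideal_span_monomial_image] at h ⊢
  intro m hm
  obtain ⟨_, ⟨i, hi, rfl⟩, hle⟩ := h (Finsupp.single j N + m) (by
    rw [mem_support_iff] at *
    rwa [X_pow_eq_monomial, coeff_monomial_mul, one_mul])
  refine ⟨_, ⟨i, hi, rfl⟩, ?_⟩
  have hij : j ≠ i := fun h => hj (h ▸ hi)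
  rw [Finsupp.single_le_iff] at *
  simpa [Finsupp.single_apply, hij] using hle

variable {K : Type*} [CommRing K]

def Rad (G0 G1 G2 : MvPolynomial (Fin 4) K) : Prop :=
  ∀ j : Fin 4, (X j : MvPolynomial (Fin 4) K) ∈ (Ideal.span {G0, G1, G2, X 3}).radical

theorem Rad.mono {F0 F1 F2 G0 G1 G2 : MvPolynomial (Fin 4) K} (h : Rad F0 F1 F2)
    (h0 : F0 ∈ (Ideal.span {G0, G1, G2, X 3}).radical)
    (h1 : F1 ∈ (Ideal.span {G0, G1, G2, X 3}).radical)
    (h2 : F2 ∈ (Ideal.span {G0, G1, G2, X 3}).radical) : Rad G0 G1 G2 := by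
  intro j
  have : (Ideal.span {F0, F1, F2, X 3}).radical ≤ (Ideal.span {G0, G1, G2, X 3}).radical := by
    rw [Ideal.radical_le_radical_iff, Ideal.span_le]
    rintro x (rfl | rfl | rfl | rfl)
    · exact h0
    · exact h1
    · exact h2
    · exact Ideal.le_radical (Ideal.subset_span (by simp))
  exact this (h j)

/-- pass mod t -/
noncomputable abbrev mt (K : Type*) [CommRing K] :
    MvPolynomial (Fin 4) K →+* MvPolynomial (Fin 4) K ⧸ Ideal.span {(X 3 : MvPolynomial (Fin 4) K)} :=
  Ideal.Quotient.mk _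

theorem mt_eq_zero {a : MvPolynomial (Fin 4) K} : mt K a = 0 ↔ ∃ b, a = X 3 * b := by
  rw [Ideal.Quotient.eq_zero_iff_mem, Ideal.mem_span_singleton]; rfl

theorem mt_surj (y) : ∃ a, mt K a = y := Ideal.Quotient.mk_surjective y

theorem mt_X3 : mt K (X 3) = 0 := mt_eq_zero.2 ⟨1, by simp⟩

theorem Rad.kz {G0 G1 G2 : MvPolynomial (Fin 4) K} (h : Rad G0 G1 G2) :
    Kz (mt K G0) (mt K G1) (mt K G2) := by
  obtain ⟨N, hN⟩ : ∃ N, ∀ j : Fin 4, (X j : MvPolynomial (Fin 4) K) ^ N ∈ Ideal.span {G0, G1, G2, X 3} := by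
    choose n hn using h
    refine ⟨n 0 + n 1 + n 2 + n 3, fun j => Ideal.pow_mem_of_pow_mem _ (hn j) ?_⟩
    fin_cases j <;> simp <;> omega
  obtain ⟨a0, a1, a2, a3, ha⟩ := mem_span4.1 (hN 0)
  obtain ⟨b0, b1, b2, b3, hb⟩ := mem_span4.1 (hN 1)
  obtain ⟨c0, c1, c2, c3, hc⟩ := mem_span4.1 (hN 2)
  let n : Fin 4 → ℕ := ![N, N, N, 1]
  have key1 : ∀ a, (X 3 : MvPolynomial (Fin 4) K) ∣ X 0 ^ N * a → X 3 ∣ a := by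
    intro a ha
    have := mono_reg {3} n 0 (by simp) N a
    simpa [n, Ideal.mem_span_singleton, ha] using this
  refine Kz.of_reg _ _ _ (mt K (X 0 ^ N)) (mt K (X 1 ^ N)) (mt K (X 2 ^ N))
    (mt K a0) (mt K a1) (mt K a2) (by rw [ha]; simp [mt_X3])
    (mt K b0) (mt K b1) (mt K b2) (by rw [hb]; simp [mt_X3])
    (mt K c0) (mt K c1) (mt K c2) (by rw [hc]; simp [mt_X3]) ?_ ?_ ?_
  · intro a; obtain ⟨a, rfl⟩ := mt_surj a
    rw [← map_mul, mt_eq_zero, mt_eq_zero]; exact key1 a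
  · intro a; obtain ⟨a, rfl⟩ := mt_surj a
    rintro ⟨s, hs⟩; obtain ⟨s, rfl⟩ := mt_surj s
    rw [← map_mul, ← map_mul, ← sub_eq_zero, ← map_sub, mt_eq_zero] at hs
    obtain ⟨b, hb⟩ := hs
    have := mono_reg (K := K) {3, 0} n 1 (by simp) N a (by
      simp only [Set.image_insert_eq, Set.image_singleton, Ideal.mem_span_pair]
      exact ⟨b, s, by simp [n]; linear_combination -hb⟩)
    simp only [Set.image_insert_eq, Set.image_singleton, Ideal.mem_span_pair] at this
    obtain ⟨u, v, rfl⟩ := this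
    exact ⟨mt K v, by simp [n, mt_X3]⟩
  · intro a; obtain ⟨a, rfl⟩ := mt_surj a
    rintro ⟨s, t, hs⟩; obtain ⟨s, rfl⟩ := mt_surj s; obtain ⟨t, rfl⟩ := mt_surj t
    rw [← map_mul, ← map_mul, ← map_mul, ← map_add, ← sub_eq_zero, ← map_sub, mt_eq_zero] at hs
    obtain ⟨b, hb⟩ := hs
    have := mono_reg (K := K) {3, 0, 1} n 2 (by simp) N a (by
      simp only [Set.image_insert_eq, Set.image_singleton, mem_span3]
      exact ⟨b, s, t, by simp [n]; linear_combination hb⟩)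
    simp only [Set.image_insert_eq, Set.image_singleton, mem_span3] at this
    obtain ⟨u, v, w, rfl⟩ := this
    exact ⟨mt K v, mt K w, by simp [n, mt_X3]⟩

/-- (A) -/
theorem Rad.colon_t {G0 G1 G2 : MvPolynomial (Fin 4) K} (h : Rad G0 G1 G2) {w : MvPolynomial (Fin 4) K}
    (hw : X 3 * w ∈ Ideal.span {G0, G1, G2}) : w ∈ Ideal.span {G0, G1, G2} := by
  obtain ⟨s, t, u, e⟩ := mem_span3.1 hw
  have hz : mt K G0 * mt K s + mt K G1 * mt K t + mt K G2 * mt K u = 0 := by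
    simp only [← map_mul, ← map_add]
    exact mt_eq_zero.2 ⟨w, by linear_combination -e⟩
  obtain ⟨v0, v1, v2, e0, e1, e2⟩ := h.kz _ _ _ hz
  obtain ⟨v0, rfl⟩ := mt_surj v0
  obtain ⟨v1, rfl⟩ := mt_surj v1
  obtain ⟨v2, rfl⟩ := mt_surj v2
  simp only [← map_mul, ← map_sub] at e0 e1 e2
  rw [← sub_eq_zero, ← map_sub, mt_eq_zero] at e0 e1 e2
  obtain ⟨b0, e0⟩ := e0
  obtain ⟨b1, e1⟩ := e1
  obtain ⟨b2, e2⟩ := e2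
  refine mem_span3.2 ⟨b0, b1, b2, ?_⟩
  have : (X 3 : MvPolynomial (Fin 4) K) * (w - (b0 * G0 + b1 * G1 + b2 * G2)) = 0 := by
    linear_combination e + G0 * e0 + G1 * e1 + G2 * e2
  have h2 := (isRegular_X (R := K) (n := (3 : Fin 4))).left.eq_iff (a := w) (b := b0 * G0 + b1 * G1 + b2 * G2)
  exact h2.1 (by linear_combination this)

theorem Rad.colon_t_pow {G0 G1 G2 : MvPolynomial (Fin 4) K} (h : Rad G0 G1 G2) (M : ℕ) {w : MvPolynomial (Fin 4) K}
    (hw : X 3 ^ M * w ∈ Ideal.span {G0, G1, G2}) : w ∈ Ideal.span {G0, G1, G2} := by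
  induction M with
  | zero => simpa using hw
  | succ M ih => exact ih (h.colon_t (by rwa [pow_succ', mul_assoc] at hw))

theorem hc_mul {n : ℕ} {G : MvPolynomial (Fin 4) K} (hG : G.IsHomogeneous n) (a : MvPolynomial (Fin 4) K)
    (D : ℕ) : ∃ b, homogeneousComponent D (a * G) = b * G ∧ b.IsHomogeneous (D - n) ∧ (D < n → b = 0) := by
  have h1 : homogeneousComponent D (a * G) =
      ∑ i ∈ Finset.range (a.totalDegree + 1), if i + n = D then homogeneousComponent i a * G else 0 := by
    conv_lhs => rw [← sum_homogeneousComponent a, Finset.sum_mul, map_sum]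
    refine Finset.sum_congr rfl fun i _ => ?_
    rw [homogeneousComponent_of_mem ((homogeneousComponent_isHomogeneous i a).mul hG)]
    simp [eq_comm]
  by_cases hD : D < n
  · refine ⟨0, ?_, isHomogeneous_zero _ _ _, fun _ => rfl⟩
    rw [h1, zero_mul]
    exact Finset.sum_eq_zero fun i _ => if_neg (by omega)
  · refine ⟨homogeneousComponent (D - n) a, ?_, homogeneousComponent_isHomogeneous _ _,
      fun h => absurd h hD⟩
    rw [h1, Finset.sum_congr rfl (g := fun i => if i = D - n then homogeneousComponent i a * G else 0)
      (fun i _ => by congr 1; simp; omega), Finset.sum_ite_eq']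
    split_ifs with h
    · rfl
    · rw [homogeneousComponent_eq_zero, zero_mul]
      simp at h; omega

theorem Rad.pow {F0 F1 F2 : MvPolynomial (Fin 4) K} (h : Rad F0 F1 F2) (a b c : ℕ) :
    Rad (F0 ^ a) (F1 ^ b) (F2 ^ c) :=
  h.mono ⟨a, Ideal.subset_span (by simp)⟩ ⟨b, Ideal.subset_span (by simp)⟩
    ⟨c, Ideal.subset_span (by simp)⟩

theorem Rad.perm1 {F0 F1 F2 : MvPolynomial (Fin 4) K} (h : Rad F0 F1 F2) : Rad F0 F2 F1 :=
  h.mono ⟨1, Ideal.subset_span (by simp)⟩ ⟨1, Ideal.subset_span (by simp)⟩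
    ⟨1, Ideal.subset_span (by simp)⟩

theorem Rad.perm2 {F0 F1 F2 : MvPolynomial (Fin 4) K} (h : Rad F0 F1 F2) : Rad F1 F2 F0 :=
  h.mono ⟨1, Ideal.subset_span (by simp)⟩ ⟨1, Ideal.subset_span (by simp)⟩
    ⟨1, Ideal.subset_span (by simp)⟩

theorem mt_mem {G0 G1 G2 x : MvPolynomial (Fin 4) K} (h : x ∈ Ideal.span {G0, G1, G2}) :
    ∃ a b c, mt K x = a * mt K G0 + b * mt K G1 + c * mt K G2 := by
  obtain ⟨s, t, u, rfl⟩ := mem_span3.1 h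
  exact ⟨mt K s, mt K t, mt K u, by simp⟩

/-- (B) -/
theorem Rad.colonF {F0 F1 F2 : MvPolynomial (Fin 4) K} (h : Rad F0 F1 F2) {e : ℕ}
    (hF0 : F0.IsHomogeneous e) (hF1 : F1.IsHomogeneous e) (hF2 : F2.IsHomogeneous e) (m : ℕ) (D : ℕ) :
    D < 3 * e * (m + 1) → ∀ w : MvPolynomial (Fin 4) K, w.IsHomogeneous D →
    F0 * w ∈ Ideal.span {F0 ^ (m+2), F1 ^ (m+2), F2 ^ (m+2)} →
    F1 * w ∈ Ideal.span {F0 ^ (m+2), F1 ^ (m+2), F2 ^ (m+2)} →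
    F2 * w ∈ Ideal.span {F0 ^ (m+2), F1 ^ (m+2), F2 ^ (m+2)} →
    w ∈ Ideal.span {F0 ^ (m+2), F1 ^ (m+2), F2 ^ (m+2)} := by
  have p1 := h.perm1
  have p2 := h.perm2
  have k1 := (h.pow (m+2) (m+2) 1).kz
  have k2 := (h.pow (m+2) (m+2) (m+1)).kz
  have k3 := (p1.pow (m+2) 1 1).kz
  have k4 := (p1.pow (m+2) 1 (m+1)).kz
  have k5 := (p2.pow 1 1 1).kz
  simp only [pow_one, map_pow] at k1 k2 k3 k4 k5
  induction D with
  | zero => ?_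
  | succ D ih => ?_
  all_goals
    intro hD w hw h0 h1 h2
    obtain ⟨a, b, c, u, hh⟩ := colonB k1 k2 k3 k4 k5 (by simpa using mt_mem h0) (by simpa using mt_mem h1)
      (by simpa using mt_mem h2)
    obtain ⟨a, rfl⟩ := mt_surj a
    obtain ⟨b, rfl⟩ := mt_surj b
    obtain ⟨c, rfl⟩ := mt_surj c
    obtain ⟨u, rfl⟩ := mt_surj u
    simp only [← map_pow, ← map_mul, ← map_add] at hh
    rw [← sub_eq_zero, ← map_sub, mt_eq_zero] at hh
    obtain ⟨w', hh⟩ := hh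
    rw [sub_eq_iff_eq_add] at hh
    have hU : ((F0 * F1 * F2) ^ (m+1)).IsHomogeneous (3 * e * (m+1)) := by
      convert ((hF0.mul hF1).mul hF2).pow (m+1) using 1; ring
    rw [mul_comm (X 3)] at hh
  · obtain ⟨a', ea, -, -⟩ := hc_mul (hF0.pow (m+2)) a 0
    obtain ⟨b', eb, -, -⟩ := hc_mul (hF1.pow (m+2)) b 0
    obtain ⟨c', ec, -, -⟩ := hc_mul (hF2.pow (m+2)) c 0
    obtain ⟨u', eu, -, zu⟩ := hc_mul hU u 0
    obtain ⟨v', ev, -, zv⟩ := hc_mul (isHomogeneous_X K (3 : Fin 4)) w' 0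
    have := congrArg (homogeneousComponent 0) hh
    rw [map_add, map_add, map_add, map_add, ea, eb, ec, eu, ev, zu hD, zv one_pos,
      homogeneousComponent_of_mem hw, if_pos rfl] at this
    rw [this]
    exact mem_span3.2 ⟨a', b', c', by ring⟩
  · obtain ⟨a', ea, -, -⟩ := hc_mul (hF0.pow (m+2)) a (D+1)
    obtain ⟨b', eb, -, -⟩ := hc_mul (hF1.pow (m+2)) b (D+1)
    obtain ⟨c', ec, -, -⟩ := hc_mul (hF2.pow (m+2)) c (D+1)
    obtain ⟨u', eu, -, zu⟩ := hc_mul hU u (D+1)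
    obtain ⟨v', ev, hv, -⟩ := hc_mul (isHomogeneous_X K (3 : Fin 4)) w' (D+1)
    have := congrArg (homogeneousComponent (D+1)) hh
    rw [map_add, map_add, map_add, map_add, ea, eb, ec, eu, ev, zu hD,
      homogeneousComponent_of_mem hw, if_pos rfl] at this
    have hs : a' * F0 ^ (m+2) + b' * F1 ^ (m+2) + c' * F2 ^ (m+2) ∈
      Ideal.span {F0 ^ (m+2), F1 ^ (m+2), F2 ^ (m+2)} := mem_span3.2 ⟨a', b', c', rfl⟩
    have hP := h.pow (m+2) (m+2) (m+2)
    have key : ∀ F, F * w ∈ Ideal.span {F0 ^ (m+2), F1 ^ (m+2), F2 ^ (m+2)} →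
        F * v' ∈ Ideal.span {F0 ^ (m+2), F1 ^ (m+2), F2 ^ (m+2)} := by
      intro F hF
      apply hP.colon_t
      have := Ideal.sub_mem _ hF (Ideal.mul_mem_left _ F hs)
      convert this using 1
      rw [‹w = _›]; ring
    have hv' := ih (by omega) v' (by simpa using hv) (key _ h0) (key _ h1) (key _ h2)
    rw [this]
    simp only [zero_mul, add_zero]
    exact Ideal.add_mem _ (Ideal.mul_mem_right _ _ hv') hs

/-- (C) -/
theorem Rad.koszul {F0 F1 F2 : MvPolynomial (Fin 4) K} (h : Rad F0 F1 F2) {e : ℕ}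
    (hF0 : F0.IsHomogeneous e) (hF1 : F1.IsHomogeneous e) (hF2 : F2.IsHomogeneous e) (k : ℕ) :
    ∀ z0 z1 z2 : MvPolynomial (Fin 4) K, z0.IsHomogeneous k → z1.IsHomogeneous k → z2.IsHomogeneous k →
    F0 * z0 + F1 * z1 + F2 * z2 = 0 →
    ∃ v0 v1 v2, z0 = F1 * v2 - F2 * v1 ∧ z1 = F2 * v0 - F0 * v2 ∧ z2 = F0 * v1 - F1 * v0 := by
  have step : ∀ k, ∀ z0 z1 z2 : MvPolynomial (Fin 4) K, z0.IsHomogeneous k → z1.IsHomogeneous k → z2.IsHomogeneous k →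
    F0 * z0 + F1 * z1 + F2 * z2 = 0 →
    ∃ v0 v1 v2 w0 w1 w2, z0 = F1 * v2 - F2 * v1 + w0 * X 3 ∧ z1 = F2 * v0 - F0 * v2 + w1 * X 3 ∧
      z2 = F0 * v1 - F1 * v0 + w2 * X 3 ∧ w0.IsHomogeneous (k-1) ∧ w1.IsHomogeneous (k-1) ∧
      w2.IsHomogeneous (k-1) ∧ (k < 1 → w0 = 0) ∧ (k < 1 → w1 = 0) ∧ (k < 1 → w2 = 0) := by
    intro k z0 z1 z2 hz0 hz1 hz2 hz
    obtain ⟨v0, v1, v2, e0, e1, e2⟩ := h.kz (mt K z0) (mt K z1) (mt K z2) (by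
      simp only [← map_mul, ← map_add]; rw [hz, map_zero])
    obtain ⟨v0, rfl⟩ := mt_surj v0
    obtain ⟨v1, rfl⟩ := mt_surj v1
    obtain ⟨v2, rfl⟩ := mt_surj v2
    simp only [← map_mul, ← map_sub] at e0 e1 e2
    rw [← sub_eq_zero, ← map_sub, mt_eq_zero] at e0 e1 e2
    obtain ⟨b0, e0⟩ := e0
    obtain ⟨b1, e1⟩ := e1
    obtain ⟨b2, e2⟩ := e2
    rw [mul_comm (X 3), sub_eq_iff_eq_add] at e0 e1 e2
    obtain ⟨w0, f0, g0, h0⟩ := hc_mul (isHomogeneous_X K (3 : Fin 4)) b0 k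
    obtain ⟨w1, f1, g1, h1⟩ := hc_mul (isHomogeneous_X K (3 : Fin 4)) b1 k
    obtain ⟨w2, f2, g2, h2⟩ := hc_mul (isHomogeneous_X K (3 : Fin 4)) b2 k
    have key : ∀ v : MvPolynomial (Fin 4) K, ∃ u, ∀ F : MvPolynomial (Fin 4) K, F.IsHomogeneous e →
        homogeneousComponent k (F * v) = F * u := by
      intro v
      refine ⟨if k < e then 0 else homogeneousComponent (k - e) v, fun F hF => ?_⟩
      have h1 : homogeneousComponent k (F * v) =
          ∑ i ∈ Finset.range (v.totalDegree + 1), if i + e = k then F * homogeneousComponent i v else 0 := by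
        conv_lhs => rw [← sum_homogeneousComponent v, Finset.mul_sum, map_sum]
        refine Finset.sum_congr rfl fun i _ => ?_
        rw [homogeneousComponent_of_mem (hF.mul (homogeneousComponent_isHomogeneous i v))]
        simp [eq_comm, add_comm]
      rw [h1]
      split_ifs with hk
      · rw [mul_zero]
        exact Finset.sum_eq_zero fun i _ => if_neg (by omega)
      · rw [Finset.sum_congr rfl (g := fun i => if i = k - e then F * homogeneousComponent i v else 0)
          (fun i _ => by congr 1; simp; omega), Finset.sum_ite_eq']
        split_ifs with h
        · rfl
        · rw [homogeneousComponent_eq_zero, mul_zero]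
          simp at h; omega
    obtain ⟨u0, q0⟩ := key v0
    obtain ⟨u1, q1⟩ := key v1
    obtain ⟨u2, q2⟩ := key v2
    have e0 := congrArg (homogeneousComponent k) e0
    have e1 := congrArg (homogeneousComponent k) e1
    have e2 := congrArg (homogeneousComponent k) e2
    rw [homogeneousComponent_of_mem hz0, if_pos rfl, map_add, map_sub, q2 _ hF1, q1 _ hF2, f0] at e0
    rw [homogeneousComponent_of_mem hz1, if_pos rfl, map_add, map_sub, q0 _ hF2, q2 _ hF0, f1] at e1
    rw [homogeneousComponent_of_mem hz2, if_pos rfl, map_add, map_sub, q1 _ hF0, q0 _ hF1, f2] at e2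
    exact ⟨u0, u1, u2, w0, w1, w2, by rw [e0]; ring, by rw [e1]; ring, by rw [e2]; ring, g0, g1, g2, h0, h1, h2⟩
  induction k with
  | zero =>
    intro z0 z1 z2 hz0 hz1 hz2 hz
    obtain ⟨v0, v1, v2, w0, w1, w2, e0, e1, e2, -, -, -, f0, f1, f2⟩ := step 0 z0 z1 z2 hz0 hz1 hz2 hz
    exact ⟨v0, v1, v2, by simpa [f0 one_pos] using e0, by simpa [f1 one_pos] using e1, by simpa [f2 one_pos] using e2⟩
  | succ k ih =>
    intro z0 z1 z2 hz0 hz1 hz2 hz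
    obtain ⟨v0, v1, v2, w0, w1, w2, e0, e1, e2, g0, g1, g2, -, -, -⟩ := step _ z0 z1 z2 hz0 hz1 hz2 hz
    obtain ⟨u0, u1, u2, q0, q1, q2⟩ := ih w0 w1 w2 g0 g1 g2 (by
      have h2 := (isRegular_X (R := K) (n := (3 : Fin 4))).right.eq_iff (a := F0 * w0 + F1 * w1 + F2 * w2) (b := 0)
      apply h2.1
      rw [zero_mul, ← hz, e0, e1, e2]; ring)
    refine ⟨v0 + u0 * X 3, v1 + u1 * X 3, v2 + u2 * X 3, ?_, ?_, ?_⟩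
    · rw [e0, q0]; ring
    · rw [e1, q1]; ring
    · rw [e2, q2]; ring

end polyt
end NS

namespace NS
section charp
variable {p : ℕ} [hp : Fact p.Prime]

/-- reduction mod p -/
noncomputable abbrev rd (p : ℕ) [Fact p.Prime] :
    MvPolynomial (Fin 4) ℤ_[p] →+* MvPolynomial (Fin 4) (ZMod p) := MvPolynomial.map PadicInt.toZMod

theorem toZMod_zero_iff (r : ℤ_[p]) : PadicInt.toZMod r = 0 ↔ (p : ℤ_[p]) ∣ r := by
  rw [← RingHom.mem_ker, PadicInt.ker_toZMod, PadicInt.maximalIdeal_eq_span_p,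
    Ideal.mem_span_singleton]

theorem toZMod_surj (a : ZMod p) : ∃ b : ℤ_[p], PadicInt.toZMod b = a :=
  ⟨(a.val : ℤ_[p]), by simp⟩

theorem rd_zero {h : MvPolynomial (Fin 4) ℤ_[p]} (hh : rd p h = 0) : ∃ s, h = (p : MvPolynomial (Fin 4) ℤ_[p]) * s := by
  obtain ⟨s, hs⟩ := (C_dvd_iff_map_hom_eq_zero PadicInt.toZMod (p : ℤ_[p]) toZMod_zero_iff h).2 hh
  exact ⟨s, by rw [hs]; simp⟩

theorem rd_p : rd p (p : MvPolynomial (Fin 4) ℤ_[p]) = 0 := by simp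

theorem p_cancel {a b : MvPolynomial (Fin 4) ℤ_[p]} (h : (p : MvPolynomial (Fin 4) ℤ_[p]) * a = p * b) : a = b := by
  refine mul_left_cancel₀ ?_ h
  exact_mod_cast hp.out.ne_zero

theorem exists_delta (h : MvPolynomial (Fin 4) ℤ_[p]) : ∃ s, expand p h = h ^ p + (p : MvPolynomial (Fin 4) ℤ_[p]) * s := by
  obtain ⟨s, hs⟩ := rd_zero (h := expand p h - h ^ p) (by
    rw [map_sub, rd, map_expand, expand_zmod, map_pow, sub_self])
  exact ⟨s, by rw [← hs]; ring⟩

theorem span3_frob {F0 F1 F2 x : MvPolynomial (Fin 4) (ZMod p)} (h : x ∈ Ideal.span {F0, F1, F2}) :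
    x ^ p ∈ Ideal.span {F0 ^ p, F1 ^ p, F2 ^ p} := by
  obtain ⟨a, b, c, rfl⟩ := mem_span3.1 h
  refine mem_span3.2 ⟨a ^ p, b ^ p, c ^ p, ?_⟩
  rw [add_pow_char, add_pow_char, mul_pow, mul_pow, mul_pow]

theorem rd_span3 {F0 F1 F2 x : MvPolynomial (Fin 4) ℤ_[p]} (h : x ∈ Ideal.span {F0, F1, F2}) :
    rd p x ∈ Ideal.span {rd p F0, rd p F1, rd p F2} := by
  obtain ⟨a, b, c, rfl⟩ := mem_span3.1 h
  exact mem_span3.2 ⟨rd p a, rd p b, rd p c, by simp⟩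

theorem rd_span3_pow {F0 F1 F2 x : MvPolynomial (Fin 4) ℤ_[p]} {n : ℕ} (h : x ∈ Ideal.span {F0, F1, F2} ^ n) :
    rd p x ∈ Ideal.span {rd p F0, rd p F1, rd p F2} ^ n := by
  have := Ideal.mem_map_of_mem (rd p) h
  rw [Ideal.map_pow] at this
  refine Ideal.pow_right_mono ?_ n this
  rw [Ideal.map_le_iff_le_comap]
  intro y hy
  exact rd_span3 hy

/-- (1) -/
theorem delta_sq (F0 F1 F2 h : MvPolynomial (Fin 4) ℤ_[p]) (hh : h ∈ Ideal.span {F0, F1, F2} ^ 2)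
    (s : MvPolynomial (Fin 4) ℤ_[p]) (hs : expand p h = h ^ p + (p : MvPolynomial (Fin 4) ℤ_[p]) * s) :
    rd p s ∈ Ideal.span {rd p F0 ^ p, rd p F1 ^ p, rd p F2 ^ p} ⊔
      Ideal.span {rd p F0, rd p F1, rd p F2} ^ (2 * p) := by
  set E := Ideal.span {rd p F0 ^ p, rd p F1 ^ p, rd p F2 ^ p} ⊔
      Ideal.span {rd p F0, rd p F1, rd p F2} ^ (2 * p) with hE
  have main : h ∈ Ideal.span {F0, F1, F2} ^ 2 ∧ ∀ s : MvPolynomial (Fin 4) ℤ_[p], expand p h = h ^ p + (p : MvPolynomial (Fin 4) ℤ_[p]) * s → rd p s ∈ E := by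
    clear hs s
    rw [pow_two] at hh
    induction hh using Submodule.mul_induction_on' with
    | mem_mul_mem m hm n hn =>
      refine ⟨by rw [pow_two]; exact Ideal.mul_mem_mul hm hn, fun s hs => ?_⟩
      obtain ⟨dm, hdm⟩ := exists_delta m
      obtain ⟨dn, hdn⟩ := exists_delta n
      have : s = m ^ p * dn + n ^ p * dm + p * dm * dn := by
        apply p_cancel
        rw [map_mul, hdm, hdn] at hs
        linear_combination -hs
      rw [this]
      simp only [map_add, map_mul, map_pow, rd_p, zero_mul, add_zero]
      exact Ideal.mem_sup_left (Ideal.add_mem _ (Ideal.mul_mem_right _ _ (span3_frob (rd_span3 hm)))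
        (Ideal.mul_mem_right _ _ (span3_frob (rd_span3 hn))))
    | add a _ b _ iha ihb =>
      refine ⟨Ideal.add_mem _ iha.1 ihb.1, fun s hs => ?_⟩
      obtain ⟨da, hda⟩ := exists_delta a
      obtain ⟨db, hdb⟩ := exists_delta b
      have h3 := add_pow_prime_eq' hp.out a b
      set L := ∑ k ∈ Finset.Ioo 0 p, a ^ k * b ^ (p - k) * ((p.choose k / p : ℕ) : MvPolynomial (Fin 4) ℤ_[p]) with hL
      have : s = da + db - L := by
        apply p_cancel
        rw [map_add, hda, hdb, h3] at hs
        linear_combination -hs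
      rw [this, map_sub, map_add]
      refine Ideal.sub_mem _ (Ideal.add_mem _ (iha.2 _ hda) (ihb.2 _ hdb)) (Ideal.mem_sup_right ?_)
      refine rd_span3_pow (Ideal.sum_mem _ fun k hk => Ideal.mul_mem_right _ _ ?_)
      have e : 2 * p = 2 * k + 2 * (p - k) := by simp at hk; omega
      rw [e, pow_add, pow_mul, pow_mul]
      exact Ideal.mul_mem_mul (Ideal.pow_mem_pow iha.1 _) (Ideal.pow_mem_pow ihb.1 _)
  exact main.2 s hs

theorem sup_pow_sharp {R : Type*} [CommRing R] (I J : Ideal R) (n m : ℕ) :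
    (I ⊔ J) ^ (n + m + 1) ≤ I ^ (n + 1) ⊔ J ^ (m + 1) := by
  rw [← Ideal.add_eq_sup, add_pow, Ideal.sum_eq_sup, Finset.sup_le_iff]
  intro k hk
  refine Ideal.mul_le_left.trans ?_
  by_cases h : n + 1 ≤ k
  · exact le_sup_of_le_left (Ideal.mul_le_left.trans (Ideal.pow_le_pow_right h))
  · exact le_sup_of_le_right (Ideal.mul_le_right.trans (Ideal.pow_le_pow_right (by simp at hk; omega)))

theorem span3_pow_le {R : Type*} [CommRing R] (F0 F1 F2 : R) (q : ℕ) :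
    Ideal.span {F0, F1, F2} ^ (3 * q + 1) ≤ Ideal.span {F0 ^ (q+1), F1 ^ (q+1), F2 ^ (q+1)} := by
  have e : ∀ a b c : R, Ideal.span {a, b, c} = Ideal.span {a} ⊔ (Ideal.span {b} ⊔ Ideal.span {c}) := by
    intro a b c
    rw [← Ideal.span_union, ← Ideal.span_union]; rfl
  rw [e, e, ← Ideal.span_singleton_pow, ← Ideal.span_singleton_pow, ← Ideal.span_singleton_pow]
  have h1 := sup_pow_sharp (Ideal.span {F0}) (Ideal.span {F1} ⊔ Ideal.span {F2}) q (2 * q)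
  have h2 := sup_pow_sharp (Ideal.span {F1}) (Ideal.span {F2}) q q
  rw [show 3 * q + 1 = q + 2 * q + 1 by ring]
  refine h1.trans (sup_le_sup le_rfl ?_)
  rwa [show 2 * q + 1 = q + q + 1 by ring]

theorem pderiv_expand (i : Fin 4) (f : MvPolynomial (Fin 4) ℤ_[p]) :
    pderiv i (expand p f) = (p : MvPolynomial (Fin 4) ℤ_[p]) * (X i ^ (p - 1) * expand p (pderiv i f)) := by
  induction f using MvPolynomial.induction_on with
  | C a => simp
  | add a b ha hb => simp only [map_add, ha, hb]; ring
  | mul_X a j ha =>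
    simp only [map_mul, expand_X, Derivation.leibniz, ha, smul_eq_mul, Derivation.leibniz_pow, map_add]
    by_cases h : j = i
    · subst h
      have : (X j : MvPolynomial (Fin 4) ℤ_[p]) ^ p = X j ^ (p - 1) * X j := by
        rw [← pow_succ, Nat.sub_add_cancel hp.out.one_le]
      simp [pderiv_X_self, this]; ring
    · simp [pderiv_X_of_ne h]; ring

theorem isHomogeneous_expand {R : Type*} [CommRing R] (q : ℕ) {f : MvPolynomial (Fin 4) R} {d : ℕ} (hf : f.IsHomogeneous d) :
    (expand q f).IsHomogeneous (q * d) := by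
  have := hf.aeval (fun i => (X i : MvPolynomial (Fin 4) R) ^ q) (n := q)
    (fun i => by simpa using (isHomogeneous_X R i).pow q)
  exact this

theorem isHomogeneous_p {f : MvPolynomial (Fin 4) ℤ_[p]} {d : ℕ} (hf : ((p : MvPolynomial (Fin 4) ℤ_[p]) * f).IsHomogeneous d) :
    f.IsHomogeneous d := by
  intro m hm
  apply hf
  rw [show (p : MvPolynomial (Fin 4) ℤ_[p]) = C (p : ℤ_[p]) by simp, coeff_C_mul]
  exact mul_ne_zero (by exact_mod_cast hp.out.ne_zero) hm

end charp
end NS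

namespace NS
section charp2
variable {p : ℕ} [hp : Fact p.Prime]

theorem pderiv_mem_Ip {F0 F1 F2 x : MvPolynomial (Fin 4) (ZMod p)} (i : Fin 4)
    (h : x ∈ Ideal.span {F0 ^ p, F1 ^ p, F2 ^ p}) : pderiv i x ∈ Ideal.span {F0 ^ p, F1 ^ p, F2 ^ p} := by
  obtain ⟨a, b, c, rfl⟩ := mem_span3.1 h
  refine mem_span3.2 ⟨pderiv i a, pderiv i b, pderiv i c, ?_⟩
  have : ((p : ℕ) : MvPolynomial (Fin 4) (ZMod p)) = 0 := CharP.cast_eq_zero _ _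
  simp [Derivation.leibniz, Derivation.leibniz_pow, this]
  ring

theorem partP2 {d k n N : ℕ} (hn : p = 2 * n + 3) (hpd : 3 * d < p) (hdk : 2 * k + 7 ≤ 3 * d)
    (f g u v σ : MvPolynomial (Fin 4) ℤ_[p]) (hf : f.IsHomogeneous d) (hg : g.IsHomogeneous k)
    (h1 : g * pderiv 3 f ∈ Ideal.span {pderiv 0 f, pderiv 1 f, pderiv 2 f})
    (h2 : X 3 ^ N = u + v * pderiv 3 f)
    (h2' : u * f ∈ Ideal.span {pderiv 0 f, pderiv 1 f, pderiv 2 f} ^ 2)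
    (h3 : Rad (pderiv 0 f) (pderiv 1 f) (pderiv 2 f))
    (hσ : expand p f = f ^ p + (p : MvPolynomial (Fin 4) ℤ_[p]) * σ) :
    rd p g ^ p * rd p f ^ n * rd p σ ∈ Ideal.span {rd p (pderiv 0 f) ^ p, rd p (pderiv 1 f) ^ p, rd p (pderiv 2 f) ^ p} := by
  have hd : 3 ≤ d := by omega
  have hRad : Rad (rd p (pderiv 0 f)) (rd p (pderiv 1 f)) (rd p (pderiv 2 f)) := by
    intro j
    obtain ⟨M, hM⟩ := h3 j
    refine ⟨M, ?_⟩
    obtain ⟨a, b, c, e, h⟩ := mem_span4.1 hM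
    refine mem_span4.2 ⟨rd p a, rd p b, rd p c, rd p e, ?_⟩
    have := congrArg (rd p) h
    simpa using this
  -- names
  set F := rd p f with hF
  set G := rd p g with hG
  set U := rd p u with hU
  set Sg := rd p σ with hSg
  have hpr : ∀ i, rd p (pderiv i f) = pderiv i F := fun i => by rw [hF, pderiv_map]
  have hG3 := rd_span3 h1
  have hUF := rd_span3_pow h2'
  have hdelta := delta_sq _ _ _ (u * f) h2'
  rw [map_mul] at hG3 hUF
  simp only [hpr] at hG3 hUF hdelta hRad ⊢
  set c := Ideal.span {pderiv 0 F, pderiv 1 F, pderiv 2 F} with hc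
  set I := Ideal.span {pderiv 0 F ^ p, pderiv 1 F ^ p, pderiv 2 F ^ p} with hI
  have hFh : F.IsHomogeneous d := hf.map _
  have hGh : G.IsHomogeneous k := hg.map _
  -- G F ∈ c
  have hGF : G * F ∈ c := by
    have eu := hFh.sum_X_mul_pderiv
    rw [Fin.sum_univ_four] at eu
    have hdu : (d : ZMod p) ≠ 0 := by
      rw [Ne, ZMod.natCast_eq_zero_iff]
      intro h; have := Nat.le_of_dvd (by omega) h; omega
    have h4 : C (d : ZMod p) * (G * F) ∈ c := by
      have : C (d : ZMod p) * (G * F) = X 3 * (G * pderiv 3 F) + G * (X 0 * pderiv 0 F + X 1 * pderiv 1 F + X 2 * pderiv 2 F) := by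
        have e2 : C (d : ZMod p) * F = d • F := by simp
        linear_combination G * e2 - G * eu
      rw [this]
      exact Ideal.add_mem _ (Ideal.mul_mem_left _ _ hG3) (mem_span3.2 ⟨G * X 0, G * X 1, G * X 2, by ring⟩)
    have h5 := Ideal.mul_mem_left c (C ((d : ZMod p)⁻¹)) h4
    rwa [← mul_assoc, ← C_mul, inv_mul_cancel₀ hdu, C_1, one_mul] at h5
  have hGFp : G ^ p * F ^ p ∈ I := by rw [← mul_pow]; exact span3_frob hGF
  have hG3p : G ^ p * pderiv 3 F ^ p ∈ I := by rw [← mul_pow]; exact span3_frob hG3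
  -- step 1
  obtain ⟨u', hu'⟩ := exists_delta u
  have hE := hdelta (u ^ p * σ + u' * f ^ p + p * u' * σ) (by
    rw [map_mul, hu', hσ]; ring)
  simp only [map_add, map_mul, map_pow, rd_p, zero_mul, add_zero, ← hF, ← hSg, ← hU] at hE
  have hcI : c ^ (3 * p - 2) ≤ I := by
    have := span3_pow_le (pderiv 0 F) (pderiv 1 F) (pderiv 2 F) (p - 1)
    rw [Nat.sub_add_cancel hp.out.one_le] at this
    rwa [show 3 * p - 2 = 3 * (p - 1) + 1 by omega]
  have hE2 : (U * F) ^ (n + 1) * (U ^ p * Sg + rd p u' * F ^ p) ∈ I := by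
    obtain ⟨y, hy, z, hz, e⟩ := Submodule.mem_sup.1 hE
    rw [← e, mul_add]
    refine Ideal.add_mem _ (Ideal.mul_mem_left _ _ hy) (hcI ?_)
    have h6 : (U * F) ^ (n + 1) ∈ (c ^ 2) ^ (n + 1) := Ideal.pow_mem_pow hUF _
    rw [← pow_mul] at h6
    have h7 := Ideal.mul_mem_mul h6 hz
    rw [← pow_add] at h7
    exact Ideal.pow_le_pow_right (by omega) h7
  have hE3 : U ^ (2 * p) * (G ^ p * F ^ (n + 1) * Sg) ∈ I := by
    have h8 := Ideal.mul_mem_left I (U ^ (p - (n+1)) * G ^ p) hE2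
    have h9 := Ideal.mul_mem_left I (U ^ (p - (n+1)) * (U * F) ^ (n+1) * rd p u') hGFp
    have h10 := Ideal.sub_mem _ h8 h9
    have e : U ^ (2 * p) = U ^ (p - (n+1)) * U ^ (n+1) * U ^ p := by
      rw [← pow_add, ← pow_add]; congr 1; omega
    convert h10 using 1
    rw [e]; ring
  have hE4 : X 3 ^ (N * (2 * p)) * (G ^ p * F ^ (n + 1) * Sg) ∈ I := by
    have h8 : (X 3 : MvPolynomial (Fin 4) (ZMod p)) ^ N = U + rd p v * pderiv 3 F := by
      have := congrArg (rd p) h2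
      simpa only [map_pow, map_add, map_mul, MvPolynomial.map_X, hpr] using this
    rw [pow_mul, h8, mul_comm 2 p, pow_mul, add_pow_char, mul_pow]
    have h9 := Ideal.mul_mem_left I ((2 * U ^ p * rd p v ^ p + (rd p v ^ p) ^ 2 * pderiv 3 F ^ p) * (F ^ (n+1) * Sg)) hG3p
    have h10 := Ideal.add_mem _ hE3 h9
    convert h10 using 1
    ring
  have hW : G ^ p * F ^ (n + 1) * Sg ∈ I := (hRad.pow p p p).colon_t_pow _ hE4
  -- step 1'
  have hder : ∀ i, pderiv i Sg = X i ^ (p - 1) * (pderiv i F) ^ p - F ^ (p - 1) * pderiv i F := by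
    intro i
    have e1 := congrArg (pderiv i) hσ
    rw [pderiv_expand] at e1
    obtain ⟨s, hs⟩ := exists_delta (pderiv i f)
    have e2 : pderiv i σ = X i ^ (p - 1) * expand p (pderiv i f) - f ^ (p - 1) * pderiv i f := by
      apply p_cancel
      rw [map_add, Derivation.leibniz_pow, Derivation.leibniz] at e1
      simp only [smul_eq_mul, nsmul_eq_mul, Derivation.map_natCast, mul_zero, add_zero] at e1
      linear_combination -e1
    have e4 : pderiv i Sg = rd p (pderiv i σ) := by rw [hSg, pderiv_map]
    rw [e4, e2, hs, ← hpr]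
    simp only [map_sub, map_mul, map_add, map_pow, rd_p, MvPolynomial.map_X, zero_mul, add_zero, ← hF]
  have hfin : ∀ i, pderiv i F ^ p ∈ I → pderiv i F * (G ^ p * F ^ n * Sg) ∈ I := by
    intro i hi
    have a1 := pderiv_mem_Ip i hW
    have e : pderiv i (G ^ p * F ^ (n + 1) * Sg) = ((n + 1 : ℕ) : MvPolynomial (Fin 4) (ZMod p)) * (pderiv i F * (G ^ p * F ^ n * Sg)) +
        G ^ p * F ^ (n+1) * X i ^ (p - 1) * pderiv i F ^ p - F ^ n * pderiv i F * (G ^ p * F ^ p) := by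
      have : ((p : ℕ) : MvPolynomial (Fin 4) (ZMod p)) = 0 := CharP.cast_eq_zero _ _
      have e3 : F ^ p = F * F ^ (p-1) := by rw [← pow_succ', Nat.sub_add_cancel hp.out.one_le]
      rw [Derivation.leibniz, Derivation.leibniz, Derivation.leibniz_pow, Derivation.leibniz_pow, hder, e3]
      simp only [smul_eq_mul, nsmul_eq_mul, this, zero_mul, mul_zero, add_zero, Nat.add_sub_cancel]
      ring
    rw [e] at a1
    have a2 : ((n + 1 : ℕ) : MvPolynomial (Fin 4) (ZMod p)) * (pderiv i F * (G ^ p * F ^ n * Sg)) ∈ I := by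
      have := Ideal.sub_mem _ (Ideal.add_mem _ a1 (Ideal.mul_mem_left _ (F ^ n * pderiv i F) hGFp))
        (Ideal.mul_mem_left _ (G ^ p * F ^ (n+1) * X i ^ (p - 1)) hi)
      convert this using 1; ring
    have hnu : ((n + 1 : ℕ) : ZMod p) ≠ 0 := by
      rw [Ne, ZMod.natCast_eq_zero_iff]
      intro h; have := Nat.le_of_dvd (by omega) h; omega
    have h5 := Ideal.mul_mem_left I (C (((n + 1 : ℕ) : ZMod p)⁻¹)) a2
    rw [← mul_assoc, show ((n + 1 : ℕ) : MvPolynomial (Fin 4) (ZMod p)) = C ((n + 1 : ℕ) : ZMod p) by simp,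
      ← C_mul, inv_mul_cancel₀ hnu, C_1, one_mul] at h5
    exact h5
  -- step 2
  have hSgh : Sg.IsHomogeneous (p * d) := by
    refine IsHomogeneous.map (isHomogeneous_p ?_) _
    have : (p : MvPolynomial (Fin 4) ℤ_[p]) * σ = expand p f - f ^ p := by rw [hσ]; ring
    rw [this]
    refine (isHomogeneous_expand p hf).sub ?_
    rw [mul_comm]; exact hf.pow p
  have hB := hRad.colonF hFh.pderiv hFh.pderiv hFh.pderiv (2 * n + 1) (k * p + d * n + p * d) (by
    obtain ⟨d', rfl⟩ : ∃ d', d = d' + 3 := ⟨d - 3, by omega⟩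
    simp only [Nat.add_sub_cancel, show d' + 3 - 1 = d' + 2 by omega]
    subst hn
    nlinarith) (G ^ p * F ^ n * Sg) (((hGh.pow p).mul (hFh.pow n)).mul hSgh)
  rw [show 2 * n + 1 + 2 = p by omega] at hB
  exact hB (hfin 0 (Ideal.subset_span (by simp))) (hfin 1 (Ideal.subset_span (by simp)))
    (hfin 2 (Ideal.subset_span (by simp)))

end charp2
end NS

namespace NS
section ord
variable {R : Type*} [CommRing R]

/-- order of vanishing along the line x=y=z=0 -/
def Ord (k : ℕ) (h : MvPolynomial (Fin 4) R) : Prop :=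
  ∀ m : Fin 4 →₀ ℕ, m 0 + m 1 + m 2 < k → coeff m h = 0

theorem Ord.mul {a b : ℕ} {g h : MvPolynomial (Fin 4) R} (hg : Ord a g) (hh : Ord b h) : Ord (a + b) (g * h) := by
  classical
  intro m hm
  rw [coeff_mul]
  refine Finset.sum_eq_zero fun x hx => ?_
  rw [Finset.HasAntidiagonal.mem_antidiagonal] at hx
  have e0 : x.1 0 + x.2 0 = m 0 := by rw [← hx]; rfl
  have e1 : x.1 1 + x.2 1 = m 1 := by rw [← hx]; rfl
  have e2 : x.1 2 + x.2 2 = m 2 := by rw [← hx]; rfl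
  by_cases h : x.1 0 + x.1 1 + x.1 2 < a
  · rw [hg _ h, zero_mul]
  · rw [hh _ (by omega), mul_zero]

theorem Ord.add {a : ℕ} {g h : MvPolynomial (Fin 4) R} (hg : Ord a g) (hh : Ord a h) : Ord a (g + h) := by
  intro m hm; rw [coeff_add, hg m hm, hh m hm, add_zero]

theorem Ord.mono {a b : ℕ} {g : MvPolynomial (Fin 4) R} (hg : Ord a g) (h : b ≤ a) : Ord b g :=
  fun m hm => hg m (by omega)

theorem Ord.zero (g : MvPolynomial (Fin 4) R) : Ord 0 g := fun m hm => absurd hm (by omega)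

theorem Ord.pow {a : ℕ} {g : MvPolynomial (Fin 4) R} (hg : Ord a g) (n : ℕ) : Ord (a * n) (g ^ n) := by
  induction n with
  | zero => exact Ord.zero _
  | succ n ih => rw [pow_succ, Nat.mul_succ]; exact ih.mul hg

theorem Ord.X {i : Fin 4} (hi : i ≠ 3) : Ord 1 (X i : MvPolynomial (Fin 4) R) := by
  classical
  intro m hm
  rw [coeff_X, if_neg]
  rintro rfl
  fin_cases i <;> simp_all [Finsupp.single_apply]

theorem Ord.pow_sub {f q : MvPolynomial (Fin 4) R} (hf : Ord 2 f) (hq : Ord 2 q) (h : Ord 3 (f - q)) (N : ℕ) :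
    Ord (2 * N + 1) (f ^ N - q ^ N) := by
  induction N with
  | zero => intro m _; simp
  | succ N ih =>
    rw [show f ^ (N+1) - q ^ (N+1) = f ^ N * (f - q) + (f ^ N - q ^ N) * q by ring]
    exact (((hf.pow N).mul h).mono (by omega)).add ((ih.mul hq).mono (by omega))

theorem mem_M (q : ℕ) (h : MvPolynomial (Fin 4) R) :
    h ∈ Ideal.span {(X 0 : MvPolynomial (Fin 4) R) ^ q, X 1 ^ q, X 2 ^ q} ↔
      ∀ m : Fin 4 →₀ ℕ, m 0 < q → m 1 < q → m 2 < q → coeff m h = 0 := by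
  have e : ({(X 0 : MvPolynomial (Fin 4) R) ^ q, X 1 ^ q, X 2 ^ q} : Set _) =
      (fun s => monomial s (1:R)) '' {Finsupp.single 0 q, Finsupp.single 1 q, Finsupp.single 2 q} := by
    simp [Set.image_insert_eq, X_pow_eq_monomial]
  rw [e, mem_ideal_span_monomial_image]
  constructor
  · intro h m h0 h1 h2
    by_contra hc
    obtain ⟨s, hs, hle⟩ := h m (mem_support_iff.2 hc)
    rcases hs with rfl | rfl | rfl <;> rw [Finsupp.single_le_iff] at hle <;> omega
  · intro h m hm
    by_contra! hc
    refine mem_support_iff.1 hm (h m ?_ ?_ ?_)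
    · simpa [Finsupp.single_le_iff] using hc (Finsupp.single 0 q) (by simp)
    · simpa [Finsupp.single_le_iff] using hc (Finsupp.single 1 q) (by simp)
    · simpa [Finsupp.single_le_iff] using hc (Finsupp.single 2 q) (by simp)

theorem mem_M1 (h : MvPolynomial (Fin 4) R) :
    h ∈ Ideal.span {(X 0 : MvPolynomial (Fin 4) R), X 1, X 2} ↔ Ord 1 h := by
  have := mem_M 1 h
  simp only [pow_one] at this
  rw [this]
  exact ⟨fun h m hm => h m (by omega) (by omega) (by omega), fun h m _ _ _ => h m (by omega)⟩

theorem Ord.pderiv {a : ℕ} {g : MvPolynomial (Fin 4) R} (hg : Ord (a+1) g) (i : Fin 4) : Ord a (pderiv i g) := by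
  classical
  intro m hm
  rw [g.as_sum, map_sum, coeff_sum]
  refine Finset.sum_eq_zero fun v hv => ?_
  rw [pderiv_monomial, coeff_monomial]
  split_ifs with h
  · subst h
    by_cases hv : v 0 + v 1 + v 2 < a + 1
    · rw [hg v hv, zero_mul]
    · exfalso
      simp only [Finsupp.tsub_apply, Finsupp.single_apply] at hm
      revert hm
      fin_cases i <;> simp <;> omega
  · rfl

/-- model quadric -/
noncomputable def mq (R : Type*) [CommRing R] (d : ℕ) : MvPolynomial (Fin 4) R :=
  X 3 ^ (d - 2) * (X 0 * X 1 + X 2 ^ 2)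

theorem mq_ord (d : ℕ) : Ord 2 (mq R d) := by
  have h : Ord 2 (X 0 * X 1 + X 2 ^ 2 : MvPolynomial (Fin 4) R) :=
    ((Ord.X (by decide)).mul (Ord.X (by decide))).add ((Ord.X (by decide)).pow 2)
  have := (Ord.zero (X 3 ^ (d-2))).mul h
  rwa [zero_add] at this

theorem coeff_mq (d N j : ℕ) (hj : j ≤ N) :
    coeff (Finsupp.single 0 j + Finsupp.single 1 j + Finsupp.single 2 (2 * (N - j)) + Finsupp.single 3 ((d-2) * N))
      (mq R d ^ N) = (N.choose j : R) := by
  classical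
  rw [mq, mul_pow, add_pow, Finset.mul_sum, coeff_sum]
  rw [Finset.sum_eq_single j]
  · have : (X 3 ^ (d - 2)) ^ N * ((X 0 * X 1) ^ j * (X 2 ^ 2) ^ (N - j) * (N.choose j : MvPolynomial (Fin 4) R))
      = C (N.choose j : R) * monomial (Finsupp.single 0 j + Finsupp.single 1 j + Finsupp.single 2 (2 * (N - j)) + Finsupp.single 3 ((d-2) * N)) (1:R) := by
      simp only [monomial_add_single, ← pow_mul, mul_pow, ← X_pow_eq_monomial, C_eq_coe_nat]
      ring
    rw [this, coeff_C_mul, coeff_monomial, if_pos rfl, mul_one]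
  · intro k hk hkj
    have : (X 3 ^ (d - 2)) ^ N * ((X 0 * X 1) ^ k * (X 2 ^ 2) ^ (N - k) * (N.choose k : MvPolynomial (Fin 4) R))
      = C (N.choose k : R) * monomial (Finsupp.single 0 k + Finsupp.single 1 k + Finsupp.single 2 (2 * (N - k)) + Finsupp.single 3 ((d-2) * N)) (1:R) := by
      simp only [monomial_add_single, ← pow_mul, mul_pow, ← X_pow_eq_monomial, C_eq_coe_nat]
      ring
    rw [this, coeff_C_mul, coeff_monomial, if_neg, mul_zero]
    intro h
    have := DFunLike.congr_fun h 0
    simp at this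
    exact hkj this
  · intro h; simp at h; omega

end ord

section charp3
variable {p : ℕ} [hp : Fact p.Prime]

theorem partP {d k N : ℕ} (hpd : 3 * d < p) (hd : 3 ≤ d) (hdk : 2 * k + 7 ≤ 3 * d)
    (f g u v : MvPolynomial (Fin 4) ℤ_[p]) (hf : f.IsHomogeneous d) (hg : g.IsHomogeneous k)
    (h1 : g * pderiv 3 f ∈ Ideal.span {pderiv 0 f, pderiv 1 f, pderiv 2 f})
    (h2 : X 3 ^ N = u + v * pderiv 3 f)
    (h2' : u * f ∈ Ideal.span {pderiv 0 f, pderiv 1 f, pderiv 2 f} ^ 2)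
    (h3 : Rad (pderiv 0 f) (pderiv 1 f) (pderiv 2 f))
    (h4 : Ord 3 (f - mq ℤ_[p] d)) :
    (p : ℤ_[p]) ∣ coeff (Finsupp.single 3 k) g := by
  classical
  by_contra hng
  obtain ⟨n, hn⟩ : ∃ n, p = 2 * n + 3 := by
    have := hp.out.eq_two_or_odd
    exact ⟨(p - 3) / 2, by omega⟩
  have hf2 : Ord 2 f := by
    have := (h4.mono (show 2 ≤ 3 by omega)).add (mq_ord (R := ℤ_[p]) d)
    rwa [sub_add_cancel] at this
  obtain ⟨σ, hσ⟩ := exists_delta f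
  have hmain := partP2 hn hpd hdk f g u v σ hf hg h1 h2 h2' h3 hσ
  set M := Ideal.span {(X 0 : MvPolynomial (Fin 4) (ZMod p)) ^ p, X 1 ^ p, X 2 ^ p} with hM
  have hI : Ideal.span {rd p (pderiv 0 f) ^ p, rd p (pderiv 1 f) ^ p, rd p (pderiv 2 f) ^ p} ≤ M := by
    rw [Ideal.span_le]
    have key : ∀ i, rd p (pderiv i f) ^ p ∈ M := by
      intro i
      have := rd_span3 ((mem_M1 _).2 (Ord.pderiv hf2 i))
      simp only [MvPolynomial.map_X] at this
      exact span3_frob this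
    rintro x (rfl | rfl | rfl) <;> exact key _
  have hm := hI hmain
  set G := rd p g with hG
  set g0 := coeff (Finsupp.single 3 k) G with hg0
  have hg0ne : g0 ≠ 0 := by
    rw [hg0, hG, coeff_map, Ne, toZMod_zero_iff]; exact hng
  have hG1 : G - C g0 * X 3 ^ k ∈ Ideal.span {(X 0 : MvPolynomial (Fin 4) (ZMod p)), X 1, X 2} := by
    rw [mem_M1]
    intro m hm
    have hm' : m = Finsupp.single 3 (m 3) := by
      ext i; fin_cases i <;> simp [Finsupp.single_apply] <;> omega
    rw [coeff_sub, coeff_C_mul, coeff_X_pow]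
    split_ifs with h
    · rw [← h, hg0]; simp
    · rw [mul_zero, sub_zero]
      by_contra hc
      have := (hg.map PadicInt.toZMod) hc
      rw [hm'] at this
      simp [Finsupp.weight_apply] at this
      exact h (by rw [hm', this])
  have hGp := span3_frob hG1
  rw [sub_pow_char] at hGp
  have hm2 : X 3 ^ (k * p) * (rd p f ^ n * rd p σ) ∈ M := by
    have a1 := Ideal.sub_mem _ hm (Ideal.mul_mem_right (rd p f ^ n * rd p σ) M hGp)
    have a2 := Ideal.mul_mem_left M (C (g0 ^ p)⁻¹) a1
    have e : C (g0 ^ p)⁻¹ * (G ^ p * rd p f ^ n * rd p σ - (G ^ p - (C g0 * X 3 ^ k) ^ p) * (rd p f ^ n * rd p σ))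
      = (C (g0 ^ p)⁻¹ * C (g0 ^ p)) * (X 3 ^ (k * p) * (rd p f ^ n * rd p σ)) := by
      rw [C_pow, pow_mul]; ring
    rw [e, ← C_mul, inv_mul_cancel₀ (pow_ne_zero _ hg0ne), C_1, one_mul] at a2
    exact a2
  have hm3 : rd p f ^ n * rd p σ ∈ M := by
    have := mono_reg (K := ZMod p) ({0, 1, 2} : Set (Fin 4)) (fun _ => p) 3 (by simp) (k * p) (rd p f ^ n * rd p σ)
    simp only [Set.image_insert_eq, Set.image_singleton] at this
    exact this hm2
  set m : Fin 4 →₀ ℕ := Finsupp.single 0 (2*n+2) + Finsupp.single 1 (2*n+2) + Finsupp.single 2 (2 * (3*n+3 - (2*n+2))) + Finsupp.single 3 ((d-2) * (3*n+3)) with hmdef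
  have m0 : m 0 = 2*n+2 := by simp [hmdef]
  have m1 : m 1 = 2*n+2 := by simp [hmdef]
  have m2 : m 2 = 2*n+2 := by simp [hmdef]; omega
  have c1 : coeff m (rd p f ^ n * rd p σ) = 0 := (mem_M p _).1 hm3 m (by omega) (by omega) (by omega)
  rw [← map_pow, ← map_mul, coeff_map, toZMod_zero_iff] at c1
  obtain ⟨y, hy⟩ := c1
  have c2 : coeff m (f ^ n * expand p f) = 0 := by
    refine (mem_M p _).1 (Ideal.mul_mem_left _ _ ?_) m (by omega) (by omega) (by omega)
    obtain ⟨a, b, c, e⟩ := mem_span3.1 ((mem_M1 f).2 (hf2.mono (by omega)))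
    exact mem_span3.2 ⟨expand p a, expand p b, expand p c, by conv_lhs => rw [e]
                                                              simp⟩
  have c3 : coeff m (f ^ (3*n+3)) = ((3*n+3).choose (2*n+2) : ℤ_[p]) := by
    have := (hf2.pow_sub (mq_ord d) h4 (3*n+3)) m (by omega)
    rw [coeff_sub, sub_eq_zero, hmdef, coeff_mq _ _ _ (by omega)] at this
    exact this
  have c4 : f ^ n * expand p f = f ^ (3*n+3) + C (p : ℤ_[p]) * (f ^ n * σ) := by
    rw [hσ, show 3*n+3 = n + p by omega, pow_add]; simp; ring
  rw [c4, coeff_add, coeff_C_mul, c3, hy] at c2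
  have c5 : (p : ℤ_[p]) ^ 2 ∣ (((3*n+3).choose (2*n+2) : ℕ) : ℤ) := ⟨-y, by push_cast; linear_combination c2⟩
  rw [PadicInt.pow_p_dvd_int_iff] at c5
  have c6 : p ^ 2 ∣ (3*n+3).choose (2*n+2) := by exact_mod_cast c5
  have c7 : p ^ 2 ∣ (3*n+3).factorial := by
    rw [← Nat.choose_mul_factorial_mul_factorial (show 2*n+2 ≤ 3*n+3 by omega), mul_assoc]
    exact c6.mul_right _
  rw [padicValNat_dvd_iff_le (Nat.factorial_ne_zero _), show 3*n+3 = p * 1 + n by omega,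
    padicValNat_factorial_mul_add _ (by omega), padicValNat_factorial_mul] at c7
  simp at c7

end charp3
end NS

namespace Polynomial
namespace NS
section red

theorem schur (m : ℤ[X]) (hm : 0 < m.natDegree) (M : ℕ) :
    ∃ p : ℕ, p.Prime ∧ M < p ∧ ∃ a : ℤ, (p : ℤ) ∣ m.eval a := by
  by_cases h0 : m.coeff 0 = 0
  · obtain ⟨p, hp, hpp⟩ := Nat.exists_infinite_primes (M+1)
    exact ⟨p, hpp, by omega, 0, by rw [← coeff_zero_eq_eval_zero, h0]; simp⟩
  set c := m.coeff 0 with hc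
  have hfac : (c * (M.factorial : ℤ)) ≠ 0 := mul_ne_zero h0 (by exact_mod_cast M.factorial_ne_zero)
  -- find k with m(c M! k) ≠ ± c
  have hfin : (((m - C c).rootSet ℤ) ∪ ((m + C c).rootSet ℤ)).Finite :=
    (rootSet_finite _ _).union (rootSet_finite _ _)
  have hinf : (Set.range fun k : ℕ => c * (M.factorial : ℤ) * k).Infinite := by
    apply Set.infinite_range_of_injective
    intro a b h
    have := mul_left_cancel₀ hfac h
    exact_mod_cast this
  obtain ⟨x, ⟨k, rfl⟩, hx⟩ := (hinf.diff hfin).nonempty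
  simp only at hx
  set x := c * (M.factorial : ℤ) * k with hxd
  have hne1 : m - C c ≠ 0 := by
    intro h
    rw [sub_eq_zero] at h
    rw [h] at hm; simp at hm
  have hne2 : m + C c ≠ 0 := by
    intro h
    rw [add_eq_zero_iff_eq_neg] at h
    rw [h] at hm; simp at hm
  have hx1 : m.eval x ≠ c := by
    intro h
    exact hx (Or.inl ((mem_rootSet_of_ne hne1).2 (by simp [h])))
  have hx2 : m.eval x ≠ -c := by
    intro h
    exact hx (Or.inr ((mem_rootSet_of_ne hne2).2 (by simp [h])))
  have hev : m.eval x = c * (1 + M.factorial * (k * m.divX.eval x)) := by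
    conv_lhs => rw [← divX_mul_X_add m]
    simp only [eval_add, eval_mul, eval_X, eval_C, ← hc]
    rw [hxd]; ring
  set s := 1 + (M.factorial : ℤ) * (k * m.divX.eval x) with hs
  have hs1 : s.natAbs ≠ 1 := by
    intro h
    rcases Int.natAbs_eq_iff.1 h with h | h
    · exact hx1 (by rw [hev, h]; simp)
    · exact hx2 (by rw [hev, h]; simp)
  obtain ⟨p, hp, hps⟩ := Nat.exists_prime_and_dvd hs1
  refine ⟨p, hp, ?_, x, ?_⟩
  · by_contra hle
    have h1 : (p : ℤ) ∣ M.factorial := by exact_mod_cast (hp.dvd_factorial).2 (by omega)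
    have h2 : (p : ℤ) ∣ s := Int.natCast_dvd.2 hps
    have h3 : (p : ℤ) ∣ 1 := by
      rw [hs] at h2
      exact (Int.dvd_add_left (h1.mul_right _)).1 h2
    have := hp.one_lt
    have := Int.le_of_dvd one_pos h3
    omega
  · rw [hev]; exact (Int.natCast_dvd.2 hps).mul_left _

theorem clear_den (q : ℚ[X]) : ∃ (b : ℤ) (r : ℤ[X]), b ≠ 0 ∧ r.map (Int.castRingHom ℚ) = C (b : ℚ) * q := by
  obtain ⟨b, hbm, hb⟩ := IsLocalization.integerNormalization_spec (nonZeroDivisors ℤ) q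
  refine ⟨b, IsLocalization.integerNormalization (nonZeroDivisors ℤ) q, nonZeroDivisors.ne_zero hbm, ?_⟩
  rw [show Int.castRingHom ℚ = algebraMap ℤ ℚ from rfl, hb]
  ext; simp

theorem padic_unit {p : ℕ} [hp : Fact p.Prime] {b : ℤ} (hb : b ≠ 0) (h : b.natAbs < p) : ‖(b : ℤ_[p])‖ = 1 := by
  apply le_antisymm (PadicInt.norm_le_one _)
  rw [← not_lt, PadicInt.norm_int_lt_one_iff_dvd]
  intro hd
  have := Nat.le_of_dvd (Int.natAbs_pos.2 hb) (Int.natCast_dvd.1 hd)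
  omega

theorem reduction_field (L : Type*) [Field L] [Algebra ℚ L] [FiniteDimensional ℚ L] (T : Finset L) (M : ℕ) :
    ∃ (p : ℕ) (_ : Fact p.Prime) (φ : L →+* ℚ_[p]), M < p ∧ ∀ t ∈ T, ‖φ t‖ ≤ 1 := by
  classical
  let pb := Field.powerBasisOfFiniteOfSeparable ℚ L
  set m0 := minpoly ℚ pb.gen with hm0
  have hirr : Irreducible m0 := minpoly.irreducible pb.isIntegral_gen
  obtain ⟨b, m, hb, hm⟩ := clear_den m0
  obtain ⟨u, v, huv⟩ := hirr.separable
  obtain ⟨b1, u1, hb1, hu1⟩ := clear_den u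
  obtain ⟨b2, v1, hb2, hv1⟩ := clear_den v
  have hinj : Function.Injective (Polynomial.map (Int.castRingHom ℚ)) :=
    Polynomial.map_injective _ (RingHom.injective_int _)
  have hbez : C b2 * u1 * m + C b1 * v1 * derivative m = C (b * b1 * b2) := by
    apply hinj
    simp only [Polynomial.map_add, Polynomial.map_mul, Polynomial.map_C, ← Polynomial.derivative_map, hm, hu1, hv1,
      derivative_C_mul]
    have : (C (b:ℚ) * C (b1:ℚ) * C (b2 : ℚ)) * (u * m0 + v * derivative m0) = C (b:ℚ) * C (b1:ℚ) * C (b2 : ℚ) := by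
      rw [huv, mul_one]
    simp only [eq_intCast, Int.cast_mul, Polynomial.C_mul]
    linear_combination this
  have hdeg : 0 < m.natDegree := by
    have h1 : (m.map (Int.castRingHom ℚ)).natDegree = m.natDegree :=
      natDegree_map_eq_of_injective (RingHom.injective_int _) m
    rw [← h1, hm, natDegree_C_mul (by exact_mod_cast hb)]
    exact hirr.natDegree_pos
  have hT : ∀ t : L, ∃ (e : ℤ) (q : ℤ[X]), e ≠ 0 ∧ (e : L) * t = aeval pb.gen q := by
    intro t
    obtain ⟨f, hf⟩ := pb.exists_eq_aeval' t
    obtain ⟨e, q, he, hq⟩ := clear_den f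
    refine ⟨e, q, he, ?_⟩
    have : aeval pb.gen q = aeval pb.gen (q.map (Int.castRingHom ℚ)) := by
      rw [show Int.castRingHom ℚ = algebraMap ℤ ℚ from rfl, aeval_map_algebraMap]
    rw [this, hq, map_mul, aeval_C, ← hf]; simp
  choose e q he hq using hT
  obtain ⟨p, hp, hMp, a, ha⟩ := schur m hdeg (M + (b * b1 * b2).natAbs + b.natAbs + ∑ t ∈ T, (e t).natAbs)
  haveI : Fact p.Prime := ⟨hp⟩
  have haz : ∀ q : ℤ[X], aeval (a : ℤ_[p]) q = ((q.eval a : ℤ) : ℤ_[p]) := by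
    intro q
    rw [aeval_def, eval₂_eq_eval_map, algebraMap_int_eq]
    exact eval_intCast_map _ q a
  have hd : ‖aeval (a : ℤ_[p]) (derivative m)‖ = 1 := by
    apply le_antisymm (PadicInt.norm_le_one _)
    rw [← not_lt, haz, PadicInt.norm_int_lt_one_iff_dvd]
    intro h
    have h2 := congrArg (Polynomial.eval a) hbez
    simp only [eval_add, eval_mul, eval_C] at h2
    have h3 : (p : ℤ) ∣ b * b1 * b2 := by
      rw [← h2]; exact dvd_add (ha.mul_left _) (h.mul_left _)
    have := Nat.le_of_dvd (Int.natAbs_pos.2 (mul_ne_zero (mul_ne_zero hb hb1) hb2)) (Int.natCast_dvd.1 h3)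
    omega
  obtain ⟨z, hz, -⟩ := hensels_lemma (p := p) (F := m) (a := (a : ℤ_[p])) (by
    rw [hd, one_pow, haz, PadicInt.norm_int_lt_one_iff_dvd]; exact ha)
  have hzq : ∀ q : ℤ[X], aeval (z : ℚ_[p]) q = ((aeval z q : ℤ_[p]) : ℚ_[p]) := by
    intro q
    exact aeval_algebraMap_apply ℚ_[p] z q
  have hz0 : aeval (z : ℚ_[p]) m0 = 0 := by
    have h1 : aeval (z : ℚ_[p]) (m.map (Int.castRingHom ℚ)) = 0 := by
      rw [show Int.castRingHom ℚ = algebraMap ℤ ℚ from rfl, aeval_map_algebraMap, hzq, hz]; simp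
    rw [hm, map_mul, aeval_C] at h1
    refine (mul_eq_zero.1 h1).resolve_left ?_
    simpa using hb
  let φ := pb.lift (z : ℚ_[p]) hz0
  refine ⟨p, ⟨hp⟩, φ.toRingHom, by omega, fun t ht => ?_⟩
  have h1 : (e t : ℚ_[p]) * φ t = ((aeval z (q t) : ℤ_[p]) : ℚ_[p]) := by
    rw [← hzq]
    have := congrArg φ (hq t)
    rw [map_mul, map_intCast] at this
    rw [this]
    have h2 := (aeval_algHom_apply (φ.restrictScalars ℤ) pb.gen (q t))
    have h3 : φ pb.gen = z := pb.lift_gen _ _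
    simp only [AlgHom.restrictScalars_apply, h3] at h2
    exact h2.symm
  have h2 : ‖(e t : ℚ_[p])‖ = 1 := by
    have h4 := padic_unit (p := p) (he t) (by
      have : (e t).natAbs ≤ ∑ t ∈ T, (e t).natAbs := Finset.single_le_sum (f := fun t => (e t).natAbs) (fun _ _ => Nat.zero_le _) ht
      omega)
    simpa using h4
  have h3 := congrArg norm h1
  rw [norm_mul, h2, one_mul] at h3
  show ‖φ t‖ ≤ 1
  rw [h3]; exact (aeval z (q t)).2

theorem reduction_aux (T : Finset ℂ) (p : ℕ) [Fact p.Prime] (ψ : Algebra.adjoin ℤ (T : Set ℂ) →+* ℚ_[p])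
    (h : ∀ t (ht : t ∈ T), ‖ψ ⟨t, Algebra.subset_adjoin ht⟩‖ ≤ 1) :
    Nonempty (Algebra.adjoin ℤ (T : Set ℂ) →+* ℤ_[p]) := by
  have hall : ∀ x (hx : x ∈ Algebra.adjoin ℤ (T : Set ℂ)), ‖ψ ⟨x, hx⟩‖ ≤ 1 := by
    intro x hx
    induction hx using Algebra.adjoin_induction with
    | mem x hx => exact h x hx
    | algebraMap r =>
      have : ψ ⟨algebraMap ℤ ℂ r, (Algebra.adjoin ℤ (T : Set ℂ)).algebraMap_mem r⟩ = (r : ℚ_[p]) := by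
        rw [← map_intCast ψ r]; rfl
      rw [this]
      have := PadicInt.norm_le_one (r : ℤ_[p])
      rw [PadicInt.norm_def, PadicInt.coe_intCast] at this
      exact this
    | add x y hx hy ihx ihy =>
      have : ψ ⟨x + y, add_mem hx hy⟩ = ψ ⟨x, hx⟩ + ψ ⟨y, hy⟩ := by
        rw [← map_add]; rfl
      rw [this]
      exact (Padic.nonarchimedean _ _).trans (max_le ihx ihy)
    | mul x y hx hy ihx ihy =>
      have : ψ ⟨x * y, mul_mem hx hy⟩ = ψ ⟨x, hx⟩ * ψ ⟨y, hy⟩ := by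
        rw [← map_mul]; rfl
      rw [this, norm_mul]
      exact mul_le_one₀ ihx (norm_nonneg _) ihy
  refine ⟨RingHom.codRestrict ψ (PadicInt.subring p) (fun x => hall x.1 x.2)⟩

theorem reduction (T : Finset ℂ) (M : ℕ) :
    ∃ (p : ℕ) (_ : Fact p.Prime), M < p ∧ Nonempty (Algebra.adjoin ℤ (T : Set ℂ) →+* ℤ_[p]) := by
  classical
  let A := Algebra.adjoin ℚ (T : Set ℂ)
  haveI : Algebra.FiniteType ℚ A := (Algebra.adjoin ℚ (T : Set ℂ)).fg_iff_finiteType.1 ⟨T, rfl⟩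
  obtain ⟨𝔪, h𝔪⟩ := Ideal.exists_maximal A
  letI : Field (A ⧸ 𝔪) := Ideal.Quotient.field 𝔪
  haveI : Algebra.FiniteType ℚ (A ⧸ 𝔪) := inferInstance
  haveI : Module.Finite ℚ (A ⧸ 𝔪) := finite_of_finite_type_of_isJacobsonRing ℚ (A ⧸ 𝔪)
  have hle : ∀ x ∈ Algebra.adjoin ℤ (T : Set ℂ), x ∈ A := by
    intro x hx
    induction hx using Algebra.adjoin_induction with
    | mem x hx => exact Algebra.subset_adjoin hx
    | algebraMap r => 
      have := A.algebraMap_mem (r : ℚ)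
      simpa using this
    | add x y _ _ hx hy => exact add_mem hx hy
    | mul x y _ _ hx hy => exact mul_mem hx hy
  let ι : Algebra.adjoin ℤ (T : Set ℂ) →+* A ⧸ 𝔪 := (Ideal.Quotient.mk 𝔪).comp
    { toFun := fun x => ⟨x.1, hle x.1 x.2⟩, map_one' := rfl, map_mul' := fun _ _ => rfl, map_zero' := rfl,
      map_add' := fun _ _ => rfl }
  let T' : Finset (A ⧸ 𝔪) := T.attach.image fun (t : {x // x ∈ T}) => ι ⟨(t : ℂ), Algebra.subset_adjoin t.2⟩
  have hrf := reduction_field (A ⧸ 𝔪) T' M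
  obtain ⟨p, hp, φ, hM, hφ⟩ := hrf
  refine ⟨p, hp, hM, reduction_aux T p (RingHom.comp φ ι) ?_⟩
  intro t ht
  exact hφ _ (Finset.mem_image.2 ⟨⟨t, ht⟩, Finset.mem_attach _ _, rfl⟩)

end red
end NS
end Polynomial

namespace NS
section tr

theorem sq_unpack {K : Type*} [CommRing K] (F : Fin 3 → K) (x : K) :
    x ∈ Ideal.span {F 0, F 1, F 2} ^ 2 ↔ ∃ c : Fin 3 → Fin 3 → K, x = ∑ i, ∑ j, c i j * F i * F j := by
  constructor
  · intro h
    rw [pow_two] at h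
    induction h using Submodule.mul_induction_on' with
    | mem_mul_mem m hm n hn =>
      obtain ⟨s, t, u, rfl⟩ := mem_span3.1 hm
      obtain ⟨s', t', u', rfl⟩ := mem_span3.1 hn
      refine ⟨fun i j => ![s,t,u] i * ![s',t',u'] j, ?_⟩
      simp [Fin.sum_univ_three]; ring
    | add x _ y _ hx hy =>
      obtain ⟨c, rfl⟩ := hx
      obtain ⟨c', rfl⟩ := hy
      refine ⟨fun i j => c i j + c' i j, ?_⟩
      simp [Fin.sum_univ_three]; ring
  · rintro ⟨c, rfl⟩
    have hF : ∀ i, F i ∈ Ideal.span {F 0, F 1, F 2} := by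
      intro i
      apply Ideal.subset_span
      fin_cases i <;> simp
    refine Ideal.sum_mem _ fun i _ => Ideal.sum_mem _ fun j _ => ?_
    rw [mul_assoc, pow_two]
    exact Ideal.mul_mem_left _ _ (Ideal.mul_mem_mul (hF i) (hF j))

structure Cert (K : Type*) [CommRing K] (d k N : ℕ) (f g u v : MvPolynomial (Fin 4) K)
    (a : Fin 3 → MvPolynomial (Fin 4) K) (c : Fin 3 → Fin 3 → MvPolynomial (Fin 4) K)
    (r : Fin 4 → Fin 4 → MvPolynomial (Fin 4) K) (e : Fin 4 → ℕ) : Prop where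
  hf : f.IsHomogeneous d
  hg : g.IsHomogeneous k
  h1 : g * pderiv 3 f = a 0 * pderiv 0 f + a 1 * pderiv 1 f + a 2 * pderiv 2 f
  h2 : X 3 ^ N = u + v * pderiv 3 f
  h2' : u * f = ∑ i, ∑ j, c i j * (![pderiv 0 f, pderiv 1 f, pderiv 2 f] : Fin 3 → _) i * (![pderiv 0 f, pderiv 1 f, pderiv 2 f] : Fin 3 → _) j
  h3 : ∀ j, X j ^ e j = r j 0 * pderiv 0 f + r j 1 * pderiv 1 f + r j 2 * pderiv 2 f + r j 3 * X 3
  h4 : Ord 3 (f - mq K d)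

theorem Cert.map {K K' : Type*} [CommRing K] [CommRing K'] (φ : K →+* K') {d k N : ℕ} {f g u v a c r e}
    (h : Cert K d k N f g u v a c r e) :
    Cert K' d k N (MvPolynomial.map φ f) (MvPolynomial.map φ g) (MvPolynomial.map φ u) (MvPolynomial.map φ v)
      (fun i => MvPolynomial.map φ (a i)) (fun i j => MvPolynomial.map φ (c i j)) (fun i j => MvPolynomial.map φ (r i j)) e where
  hf := h.hf.map φ
  hg := h.hg.map φ
  h1 := by have := congrArg (MvPolynomial.map φ) h.h1; simpa [pderiv_map] using this
  h2 := by have := congrArg (MvPolynomial.map φ) h.h2; simpa [pderiv_map] using this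
  h2' := by have := congrArg (MvPolynomial.map φ) h.h2'; simpa [pderiv_map, Fin.sum_univ_three] using this
  h3 := fun j => by have := congrArg (MvPolynomial.map φ) (h.h3 j); simpa [pderiv_map] using this
  h4 := by
    have : MvPolynomial.map φ f - mq K' d = MvPolynomial.map φ (f - mq K d) := by simp [mq]
    rw [this]
    intro m hm
    rw [coeff_map, h.h4 m hm, map_zero]

theorem Cert.of_map {K K' : Type*} [CommRing K] [CommRing K'] (φ : K →+* K') (hφ : Function.Injective φ) {d k N : ℕ} {f g u v a c r e}
    (h : Cert K' d k N (MvPolynomial.map φ f) (MvPolynomial.map φ g) (MvPolynomial.map φ u) (MvPolynomial.map φ v)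
      (fun i => MvPolynomial.map φ (a i)) (fun i j => MvPolynomial.map φ (c i j)) (fun i j => MvPolynomial.map φ (r i j)) e) :
    Cert K d k N f g u v a c r e where
  hf := IsHomogeneous.of_map hφ h.hf
  hg := IsHomogeneous.of_map hφ h.hg
  h1 := by apply map_injective φ hφ; have := h.h1; simpa [pderiv_map] using this
  h2 := by apply map_injective φ hφ; have := h.h2; simpa [pderiv_map] using this
  h2' := by apply map_injective φ hφ; have := h.h2'; simpa [pderiv_map, Fin.sum_univ_three] using this
  h3 := fun j => by apply map_injective φ hφ; have := (h.h3 j); simpa [pderiv_map] using this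
  h4 := by
    have : MvPolynomial.map φ f - mq K' d = MvPolynomial.map φ (f - mq K d) := by simp [mq]
    have h4 := h.h4
    rw [this] at h4
    intro m hm
    apply hφ
    rw [← coeff_map, h4 m hm, map_zero]

theorem transfer {d k N : ℕ} (hd : 3 ≤ d) (hdk : 2*k+7 ≤ 3*d) (f g u v : MvPolynomial (Fin 4) ℂ)
    (hf : f.IsHomogeneous d) (hg : g.IsHomogeneous k)
    (h1 : g * pderiv 3 f ∈ Ideal.span {pderiv 0 f, pderiv 1 f, pderiv 2 f})
    (h2 : X 3^N = u + v*pderiv 3 f) (h2' : u*f ∈ Ideal.span {pderiv 0 f, pderiv 1 f, pderiv 2 f}^2)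
    (h3 : Rad (pderiv 0 f) (pderiv 1 f) (pderiv 2 f)) (h4 : Ord 3 (f - mq ℂ d)) :
    coeff (Finsupp.single 3 k) g = 0 := by
  classical
  by_contra hg0
  obtain ⟨a0, a1, a2, ha⟩ := mem_span3.1 h1
  obtain ⟨c, hc⟩ := (sq_unpack (![pderiv 0 f, pderiv 1 f, pderiv 2 f]) (u*f)).1 h2'
  have h3' : ∀ j : Fin 4, ∃ (e : ℕ) (r : Fin 4 → MvPolynomial (Fin 4) ℂ), X j ^ e = r 0 * pderiv 0 f + r 1 * pderiv 1 f + r 2 * pderiv 2 f + r 3 * X 3 := by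
    intro j
    obtain ⟨e, he⟩ := h3 j
    obtain ⟨s, t, u, v, h⟩ := mem_span4.1 he
    exact ⟨e, ![s,t,u,v], by simpa using h⟩
  choose e r hr using h3'
  have hcert : Cert ℂ d k N f g u v ![a0,a1,a2] c r e := ⟨hf, hg, by simpa using ha, h2, hc, hr, h4⟩
  generalize (![a0,a1,a2] : Fin 3 → _) = a at hcert
  let L : Finset (MvPolynomial (Fin 4) ℂ) := {f, g, u, v} ∪ Finset.univ.image a ∪ Finset.univ.image (fun x : Fin 3 × Fin 3 => c x.1 x.2) ∪
    Finset.univ.image (fun x : Fin 4 × Fin 4 => r x.1 x.2)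
  let T : Finset ℂ := insert (coeff (Finsupp.single 3 k) g)⁻¹ (L.biUnion fun q => q.support.image fun m => coeff m q)
  obtain ⟨p, hp, hpM, ⟨φ⟩⟩ := Polynomial.NS.reduction T (3*d)
  set R := Algebra.adjoin ℤ (T : Set ℂ) with hR
  let ι : R →+* ℂ := R.subtype
  have hι : Function.Injective ι := Subtype.val_injective
  have hlift : ∀ q ∈ L, ∃ q' : MvPolynomial (Fin 4) R, MvPolynomial.map ι q' = q := by
    intro q hq
    have : q ∈ Set.range (MvPolynomial.map ι) := by
      rw [mem_range_map_iff_coeffs_subset]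
      intro x hx
      refine ⟨⟨x, Algebra.subset_adjoin ?_⟩, rfl⟩
      obtain ⟨m, hm, rfl⟩ := mem_coeffs_iff.1 hx
      refine Finset.mem_insert_of_mem (Finset.mem_biUnion.2 ⟨q, hq, Finset.mem_image.2 ⟨m, hm, rfl⟩⟩)
    exact this
  obtain ⟨f', ef⟩ := hlift f (by simp [L])
  obtain ⟨g', eg⟩ := hlift g (by simp [L])
  obtain ⟨u', eu⟩ := hlift u (by simp [L])
  obtain ⟨v', ev⟩ := hlift v (by simp [L])
  have ha' : ∀ i, ∃ q, MvPolynomial.map ι q = a i := fun i => hlift _ (by simp [L])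
  have hc' : ∀ i j, ∃ q, MvPolynomial.map ι q = c i j := fun i j => hlift _ (by
    simp only [L, Finset.mem_union, Finset.mem_image]; exact Or.inl (Or.inr ⟨(i,j), Finset.mem_univ _, rfl⟩))
  have hr' : ∀ i j, ∃ q, MvPolynomial.map ι q = r i j := fun i j => hlift _ (by
    simp only [L, Finset.mem_union, Finset.mem_image]; exact Or.inr ⟨(i,j), Finset.mem_univ _, rfl⟩)
  choose a' ha' using ha'
  choose c' hc' using hc'
  choose r' hr' using hr'
  have hcert2 : Cert R d k N f' g' u' v' a' c' r' e := by
    apply Cert.of_map ι hι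
    simp only [ha', hc', hr', ef, eg, eu, ev]
    exact hcert
  have C3 := hcert2.map φ
  have hdvd := partP hpM hd hdk _ _ _ _ C3.hf C3.hg (mem_span3.2 ⟨_, _, _, C3.h1⟩) C3.h2
    ((sq_unpack (![pderiv 0 _, pderiv 1 _, pderiv 2 _]) _).2 ⟨_, C3.h2'⟩)
    (fun j => ⟨e j, mem_span4.2 ⟨_, _, _, _, C3.h3 j⟩⟩) C3.h4
  rw [coeff_map] at hdvd
  rw [← eg, coeff_map] at hg0
  have hinv : (coeff (Finsupp.single 3 k) g)⁻¹ ∈ R := Algebra.subset_adjoin (Finset.mem_insert_self _ _)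
  have hu : (coeff (Finsupp.single 3 k) g') * (⟨_, hinv⟩ : R) = 1 := by
    apply hι
    rw [map_mul, map_one]
    show _ * (coeff (Finsupp.single 3 k) g)⁻¹ = 1
    rw [← eg, coeff_map]
    exact mul_inv_cancel₀ hg0
  have hunit : IsUnit (φ (coeff (Finsupp.single 3 k) g')) := (IsUnit.of_mul_eq_one _ hu).map φ
  exact PadicInt.prime_p.not_unit (isUnit_of_dvd_unit hdvd hunit)

end tr
end NS

namespace NS
noncomputable section ge

/-- Nullstellensatz. -/
theorem nss (I : Ideal S4) (q : S4) (h : ∀ v : Fin 4 → ℂ, (∀ p ∈ I, eval v p = 0) → eval v q = 0) : q ∈ I.radical := by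
  rw [← vanishingIdeal_zeroLocus_eq_radical (K := ℂ) I, mem_vanishingIdeal_iff]
  intro x hx
  rw [aeval_eq_eval]
  apply h
  intro p hp
  have := hx p hp
  rwa [aeval_eq_eval] at this

def sb (A : Matrix (Fin 4) (Fin 4) ℂ) : S4 →ₐ[ℂ] S4 := aeval (fun i => ∑ j, C (A i j) * X j)

theorem sb_X (A : Matrix (Fin 4) (Fin 4) ℂ) (i) : sb A (X i) = ∑ j, C (A i j) * X j := by simp [sb]

theorem sb_C (A : Matrix (Fin 4) (Fin 4) ℂ) (a : ℂ) : sb A (C a) = C a := by simp [sb]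

theorem eval_sb (A : Matrix (Fin 4) (Fin 4) ℂ) (v) (f : S4) : eval v (sb A f) = eval (A.mulVec v) f := by
  have : ((aeval v : S4 →ₐ[ℂ] ℂ).comp (sb A)) = aeval (A.mulVec v) := by
    ext i
    simp [sb_X, Matrix.mulVec, dotProduct]
  have := DFunLike.congr_fun this f
  simpa [aeval_eq_eval] using this

theorem sb_sb (A B : Matrix (Fin 4) (Fin 4) ℂ) (f : S4) : sb B (sb A f) = sb (A * B) f := by
  have : (sb B).comp (sb A) = sb (A * B) := by
    apply MvPolynomial.algHom_ext
    intro i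
    simp only [AlgHom.comp_apply, sb_X, map_sum, map_mul, sb_C, Finset.mul_sum, Matrix.mul_apply, Finset.sum_mul]
    rw [Finset.sum_comm]
    simp [mul_assoc]
  exact DFunLike.congr_fun this f

theorem sb_one (f : S4) : sb 1 f = f := by
  have : sb 1 = AlgHom.id ℂ S4 := by
    apply MvPolynomial.algHom_ext
    intro i
    rw [sb_X]
    simp [Matrix.one_apply]
  rw [this]; rfl

theorem sb_hom {A : Matrix (Fin 4) (Fin 4) ℂ} {f : S4} {n} (hf : f.IsHomogeneous n) : (sb A f).IsHomogeneous n := by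
  have := hf.aeval (fun i => ∑ j, C (A i j) * X j) (n := 1) (fun i => by
    refine IsHomogeneous.sum _ _ _ fun j _ => ?_
    simpa using (isHomogeneous_C (Fin 4) (A i j)).mul (isHomogeneous_X ℂ j))
  simpa [sb] using this

theorem pderiv_sb (A : Matrix (Fin 4) (Fin 4) ℂ) (f : S4) (j) : pderiv j (sb A f) = ∑ i, C (A i j) * sb A (pderiv i f) := by
  induction f using MvPolynomial.induction_on with
  | C a => simp [sb_C]
  | add p q hp hq => simp [hp, hq, mul_add, Finset.sum_add_distrib]
  | mul_X p n hp =>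
    rw [map_mul, Derivation.leibniz, hp, sb_X]
    simp only [Derivation.leibniz, map_sum, map_add, pderiv_X, smul_eq_mul, pderiv_C, smul_zero, mul_zero, add_zero, map_mul, mul_add, Finset.sum_add_distrib]
    congr 1
    · simp only [Pi.single_apply, mul_ite, mul_one, mul_zero, Finset.sum_ite_eq', Finset.sum_ite_eq, Finset.mem_univ, if_true, apply_ite (sb A), map_one, map_zero, sb_X]
      rw [mul_comm]
    · rw [← sb_X, Finset.mul_sum]
      exact Finset.sum_congr rfl fun i _ => by ring

theorem eval_pderiv_sb (A : Matrix (Fin 4) (Fin 4) ℂ) (f : S4) (j) (v) :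
    eval v (pderiv j (sb A f)) = ∑ i, A i j * eval (A.mulVec v) (pderiv i f) := by
  rw [pderiv_sb]; simp [eval_sb]

theorem hessian_sb (A : Matrix (Fin 4) (Fin 4) ℂ) (f : S4) (v) :
    hessian (sb A f) v = A.transpose * hessian f (A.mulVec v) * A := by
  ext i j
  simp only [hessian, Matrix.of_apply, Matrix.mul_apply, Matrix.transpose_apply]
  rw [pderiv_sb]
  simp only [map_sum, pderiv_C_mul, smul_eq_C_mul, map_mul, eval_C, eval_pderiv_sb]
  refine Finset.sum_congr rfl fun a _ => ?_
  rw [mul_comm]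

def e3 : Fin 4 → ℂ := Pi.single 3 1

theorem eval_e3 {q : S4} {n} (hq : q.IsHomogeneous n) : eval e3 q = coeff (Finsupp.single 3 n) q := by
  rw [eval_eq']
  by_cases h : Finsupp.single (3 : Fin 4) n ∈ q.support
  · rw [Finset.sum_eq_single_of_mem _ h]
    · have : ∏ i, e3 i ^ (Finsupp.single (3 : Fin 4) n) i = 1 := by
        apply Finset.prod_eq_one
        intro i _
        by_cases hi : i = 3
        · subst hi; simp [e3]
        · simp [Finsupp.single_apply, Ne.symm hi]
      rw [this, mul_one]
    · intro m hm hne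
      have hdeg := hq (mem_support_iff.1 hm)
      have : ∃ i, i ≠ 3 ∧ m i ≠ 0 := by
        by_contra hcon
        push Not at hcon
        apply hne
        have h3 : m = Finsupp.single 3 (m 3) := by
          ext i
          by_cases hi : i = 3
          · subst hi; simp
          · rw [hcon i hi, Finsupp.single_apply, if_neg (Ne.symm hi)]
        rw [Finsupp.weight_apply] at hdeg
        rw [h3] at hdeg
        simp at hdeg
        rw [h3, hdeg]
      obtain ⟨i, hi, hmi⟩ := this
      rw [Finset.prod_eq_zero (Finset.mem_univ i), mul_zero]
      simp [e3, hi, hmi]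
  · rw [notMem_support_iff.1 h]
    apply Finset.sum_eq_zero
    intro m hm
    have hdeg := hq (mem_support_iff.1 hm)
    have : ∃ i, i ≠ 3 ∧ m i ≠ 0 := by
      by_contra hcon
      push Not at hcon
      apply h
      have h3 : m = Finsupp.single 3 (m 3) := by
        ext i
        by_cases hi : i = 3
        · subst hi; simp
        · rw [hcon i hi, Finsupp.single_apply, if_neg (Ne.symm hi)]
      rw [Finsupp.weight_apply] at hdeg
      rw [h3] at hdeg
      simp at hdeg
      rw [← hdeg, ← h3]; exact hm
    obtain ⟨i, hi, hmi⟩ := this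
    rw [Finset.prod_eq_zero (Finset.mem_univ i), mul_zero]
    simp [e3, hi, hmi]

theorem ord1 {q : S4} {n} (hq : q.IsHomogeneous n) (h : eval e3 q = 0) : Ord 1 q := by
  intro m hm
  by_contra hne
  have hdeg := hq hne
  have h3 : m = Finsupp.single 3 (m 3) := by
    ext i
    fin_cases i <;> simp <;> omega
  rw [Finsupp.weight_apply] at hdeg
  rw [h3] at hdeg
  simp at hdeg
  rw [eval_e3 hq, ← hdeg, ← h3] at h
  exact hne h

theorem ord_succ {q : S4} {n k} (hq : q.IsHomogeneous n) (h : eval e3 q = 0) (h0 : Ord k (pderiv 0 q))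
    (h1 : Ord k (pderiv 1 q)) (h2 : Ord k (pderiv 2 q)) : Ord (k+1) q := by
  intro m hm
  by_cases hs : m 0 + m 1 + m 2 < 1
  · exact ord1 hq h m hs
  have key : ∀ i : Fin 4, i ≠ 3 → Ord k (pderiv i q) → m i ≠ 0 → coeff m q = 0 := by
    intro i hi hO hmi
    obtain ⟨m', rfl⟩ : ∃ m', m = m' + Finsupp.single i 1 := ⟨m - Finsupp.single i 1, by
      rw [tsub_add_cancel_of_le]; simpa using Nat.one_le_iff_ne_zero.2 hmi⟩
    have := hO m' (by
      simp only [Finsupp.add_apply, Finsupp.single_apply] at hm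
      fin_cases i <;> simp at hm hi ⊢ <;> omega)
    rw [coeff_pderiv] at this
    have h2 : ((m' i : ℂ) + 1) ≠ 0 := by exact_mod_cast Nat.succ_ne_zero (m' i)
    exact (mul_eq_zero.1 this).resolve_right h2
  by_cases m0 : m 0 = 0
  · by_cases m1 : m 1 = 0
    · exact key 2 (by decide) h2 (by omega)
    · exact key 1 (by decide) h1 m1
  · exact key 0 (by decide) h0 m0

end ge
end NS

namespace NS
noncomputable section ge2

theorem ord_pow {k : ℕ} {h : S4} (hh : Ord k h) : h ∈ Ideal.span {(X 0 : S4), X 1, X 2} ^ k := by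
  rw [h.as_sum]
  refine Ideal.sum_mem _ fun m hm => ?_
  have hk : k ≤ m 0 + m 1 + m 2 := by
    by_contra hc
    exact mem_support_iff.1 hm (hh m (by omega))
  refine Ideal.pow_le_pow_right hk ?_
  rw [monomial_eq, Finsupp.prod_fintype _ _ (fun i => pow_zero _), Fin.prod_univ_four]
  refine Ideal.mul_mem_left _ _ (Ideal.mul_mem_right _ _ ?_)
  rw [pow_add, pow_add]
  refine Ideal.mul_mem_mul (Ideal.mul_mem_mul ?_ ?_) ?_ <;>
  exact Ideal.pow_mem_pow (Ideal.subset_span (by simp)) _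

abbrev cI (h : S4) : Ideal S4 := Ideal.span {pderiv 0 h, pderiv 1 h, pderiv 2 h}

structure Good (d : ℕ) (f : S4) (ℓ : Fin 4 → ℂ) : Prop where
  hom : f.IsHomogeneous d
  tg : ∀ v : Fin 4 → ℂ, v ≠ 0 → ℓ ⬝ᵥ v = 0 → ∀ c : ℂ, ¬ ∀ i, eval v (pderiv i f) = c * ℓ i
  nod : ∀ v : Fin 4 → ℂ, v ≠ 0 → (∀ i, eval v (pderiv i f) = 0) → ∀ w, (hessian f v).mulVec w = 0 → ∃ c : ℂ, w = c • v

theorem Good.subst {d f ℓ} (h : Good d f ℓ) (A B : Matrix (Fin 4) (Fin 4) ℂ) (hAB : A * B = 1) :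
    Good d (sb A f) (Matrix.vecMul ℓ A) := by
  have hBA : B * A = 1 := mul_eq_one_comm.1 hAB
  have hinj : ∀ v : Fin 4 → ℂ, A.mulVec v = 0 → v = 0 := by
    intro v hv
    have := congrArg B.mulVec hv
    rwa [Matrix.mulVec_mulVec, hBA, Matrix.one_mulVec, Matrix.mulVec_zero] at this
  have hinjT : ∀ v : Fin 4 → ℂ, Matrix.vecMul v A = 0 → v = 0 := by
    intro v hv
    have := congrArg (fun w => Matrix.vecMul w B) hv
    simpa only [Matrix.vecMul_vecMul, hAB, Matrix.vecMul_one, Matrix.zero_vecMul] using this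
  have hgrad : ∀ v : Fin 4 → ℂ, (fun j => eval v (pderiv j (NS.sb A f))) = Matrix.vecMul (fun i => eval (A.mulVec v) (pderiv i f)) A := by
    intro v
    ext j
    rw [eval_pderiv_sb]
    simp [Matrix.vecMul, dotProduct, mul_comm]
  refine ⟨sb_hom h.hom, ?_, ?_⟩
  · intro v hv hl c hc
    refine h.tg (A.mulVec v) (fun h0 => hv (hinj v h0)) ?_ c ?_
    · rw [Matrix.dotProduct_mulVec]; exact hl
    · have h1 : (fun j => eval v (pderiv j (NS.sb A f))) = c • Matrix.vecMul ℓ A := by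
        ext j; rw [hc j]; rfl
      rw [hgrad, ← Matrix.smul_vecMul] at h1
      have h2 := hinjT ((fun i => eval (A.mulVec v) (pderiv i f)) - c • ℓ) (by rw [Matrix.sub_vecMul, h1, sub_self])
      intro i
      have := congrFun h2 i
      simp only [Pi.sub_apply, Pi.zero_apply, Pi.smul_apply, smul_eq_mul] at this
      exact sub_eq_zero.1 this
  · intro v hv hs w hw
    have h1 : (fun i => eval (A.mulVec v) (pderiv i f)) = 0 := by
      apply hinjT
      rw [← hgrad]; ext i; exact hs i
    rw [hessian_sb, ← Matrix.mulVec_mulVec, ← Matrix.mulVec_mulVec] at hw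
    have h2 : (hessian f (A.mulVec v)).mulVec (A.mulVec w) = 0 := by
      apply hinjT
      rwa [← Matrix.mulVec_transpose]
    obtain ⟨c, hc⟩ := h.nod _ (fun h0 => hv (hinj v h0)) (fun i => congrFun h1 i) _ h2
    refine ⟨c, ?_⟩
    have h3 := hinj (w - c • v) (by rw [Matrix.mulVec_sub, Matrix.mulVec_smul, hc, sub_self])
    exact sub_eq_zero.1 h3

theorem Good.rad {d h} (H : Good d h e3) : Rad (pderiv 0 h) (pderiv 1 h) (pderiv 2 h) := by
  intro j
  apply nss
  intro v hv
  by_contra hne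
  have hv0 : v ≠ 0 := fun h0 => hne (by simp [h0])
  have m : ∀ x ∈ ({pderiv 0 h, pderiv 1 h, pderiv 2 h, X 3} : Set S4), eval v x = 0 := fun x hx => hv x (Ideal.subset_span hx)
  have h3 : v 3 = 0 := by simpa using m (X 3) (by simp)
  refine H.tg v hv0 (by simp [e3, h3]) (eval v (pderiv 3 h)) ?_
  intro i
  fin_cases i
  · simpa [e3] using m (pderiv 0 h) (by simp)
  · simpa [e3] using m (pderiv 1 h) (by simp)
  · simpa [e3] using m (pderiv 2 h) (by simp)
  · simp [e3]

theorem pd_comm (i j : Fin 4) (h : S4) : pderiv i (pderiv j h) = pderiv j (pderiv i h) := by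
  have : ⁅(pderiv i : Derivation ℂ S4 S4), (pderiv j : Derivation ℂ S4 S4)⁆ = 0 := by
    apply MvPolynomial.derivation_ext
    intro k
    simp [Derivation.commutator_apply, pderiv_X, Pi.single_apply, apply_ite]
  have h2 := DFunLike.congr_fun this h
  rw [Derivation.commutator_apply] at h2
  exact sub_eq_zero.1 h2

/-- Local multiplier at the node `e3`. -/
theorem Good.mult0 {d h ℓ} (hd : 2 ≤ d) (H : Good d h ℓ) (hs : ∀ i, eval e3 (pderiv i h) = 0) :
    ∃ u : S4, eval e3 u ≠ 0 ∧ (∀ m, Ord 1 m → u * m ∈ cI h) ∧ u ^ 2 * h ∈ cI h ^ 2 := by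
  have hph : ∀ i, (pderiv i h).IsHomogeneous (d-1) := fun i => H.hom.pderiv
  have ho : ∀ i, Ord 1 (pderiv i h) := fun i => ord1 (hph i) (hs i)
  have he : eval e3 h = 0 := by
    have := congrArg (eval e3) H.hom.sum_X_mul_pderiv
    simp only [map_sum, map_mul, hs, mul_zero, Finset.sum_const_zero, nsmul_eq_mul, map_natCast] at this
    have hd0 : (d : ℂ) ≠ 0 := by exact_mod_cast (by omega : d ≠ 0)
    exact (mul_eq_zero.1 this.symm).resolve_left hd0
  have ho2 : Ord 2 h := ord_succ H.hom he (ho 0) (ho 1) (ho 2)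
  have hex : ∀ i : Fin 3, ∃ a : Fin 3 → S4, pderiv i.castSucc h = ∑ j, a j * X j.castSucc := by
    intro i
    obtain ⟨s, t, u, hx⟩ := mem_span3.1 ((mem_M1 _).2 (ho i.castSucc))
    exact ⟨![s,t,u], by rw [hx, Fin.sum_univ_three]; simp⟩
  choose a ha using hex
  let A : Matrix (Fin 3) (Fin 3) S4 := Matrix.of a
  have hmv : A.mulVec (fun j => X j.castSucc) = fun i => pderiv i.castSucc h := by
    ext1 i
    rw [ha i]; rfl
  have hux : ∀ j : Fin 3, A.det * X j.castSucc ∈ cI h := by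
    intro j
    have := congrArg (A.adjugate.mulVec) hmv
    rw [Matrix.mulVec_mulVec, Matrix.adjugate_mul, Matrix.smul_mulVec, Matrix.one_mulVec] at this
    have := congrFun this j
    simp only [Pi.smul_apply, smul_eq_mul] at this
    rw [this]
    simp only [Matrix.mulVec, dotProduct]
    refine Ideal.sum_mem _ fun i _ => Ideal.mul_mem_left _ _ (Ideal.subset_span ?_)
    fin_cases i <;> simp
  have huM : ∀ m, m ∈ Ideal.span {(X 0 : S4), X 1, X 2} → A.det * m ∈ cI h := by
    intro m hm
    obtain ⟨s, t, u, rfl⟩ := mem_span3.1 hm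
    have e0 : A.det * X 0 ∈ cI h := hux 0
    have e1 : A.det * X 1 ∈ cI h := hux 1
    have e2 : A.det * X 2 ∈ cI h := hux 2
    have := Ideal.add_mem _ (Ideal.add_mem _ (Ideal.mul_mem_left _ s e0) (Ideal.mul_mem_left _ t e1)) (Ideal.mul_mem_left _ u e2)
    convert this using 1; ring
  refine ⟨A.det, ?_, fun m hm => huM m ((mem_M1 m).2 hm), ?_⟩
  · -- nondegenerate
    rw [RingHom.map_det]
    intro hdet
    obtain ⟨w, hw0, hw⟩ := Matrix.exists_mulVec_eq_zero_iff.2 hdet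
    have hA : ∀ i j : Fin 3, eval e3 (A i j) = eval e3 (pderiv j.castSucc (pderiv i.castSucc h)) := by
      intro i j
      rw [ha i]
      simp only [map_sum, Derivation.leibniz, smul_eq_mul, pderiv_X, map_add, map_mul, eval_X]
      rw [Finset.sum_add_distrib, Finset.sum_eq_single j]
      · have : ∀ x : Fin 3, (e3 x.castSucc) = 0 := by intro x; fin_cases x <;> simp [e3]
        simp [this, A]
      · intro b _ hb
        rw [Pi.single_apply, if_neg, map_zero, mul_zero]
        intro hh; exact hb (Fin.castSucc_injective _ hh)
      · simp
    have heul : ∀ i, eval e3 (pderiv 3 (pderiv i h)) = 0 := by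
      intro i
      have := congrArg (eval e3) (hph i).sum_X_mul_pderiv
      rw [map_nsmul, hs i] at this
      simpa [e3, Fin.sum_univ_four] using this
    have hcomm : ∀ i j, pderiv i (pderiv j h) = pderiv j (pderiv i h) := fun i j => pd_comm i j h
    obtain ⟨c, hc⟩ := H.nod e3 (by simp [e3]) hs (Fin.snoc (α := fun _ => ℂ) w 0) (by
      ext i
      simp only [Matrix.mulVec, dotProduct, hessian, Matrix.of_apply, Pi.zero_apply]
      rw [Fin.sum_univ_castSucc]
      simp only [Fin.snoc_castSucc, Fin.snoc_last, mul_zero, add_zero]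
      refine Fin.lastCases ?_ (fun i => ?_) i
      · apply Finset.sum_eq_zero
        intro j _
        have := heul j.castSucc
        rw [show Fin.last 3 = (3 : Fin 4) from rfl, this, zero_mul]
      · have := congrFun hw i
        simp only [Matrix.mulVec, dotProduct, RingHom.mapMatrix_apply, Matrix.map_apply, Pi.zero_apply, hA] at this
        rw [← this]
        refine Finset.sum_congr rfl fun j _ => ?_
        rw [hcomm])
    apply hw0
    ext i
    have := congrFun hc i.castSucc
    rw [Fin.snoc_castSucc] at this
    rw [this]
    fin_cases i <;> simp [e3]
  · have hsq : ∀ x ∈ Ideal.span {(X 0 : S4), X 1, X 2} ^ 2, A.det ^ 2 * x ∈ cI h ^ 2 := by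
      intro x hx
      rw [pow_two] at hx
      induction hx using Submodule.mul_induction_on' with
      | mem_mul_mem m hm n hn =>
        rw [show A.det ^ 2 * (m * n) = (A.det * m) * (A.det * n) by ring, pow_two]
        exact Ideal.mul_mem_mul (huM m hm) (huM n hn)
      | add x _ y _ hx hy => rw [mul_add]; exact Ideal.add_mem _ hx hy
    exact hsq h (ord_pow ho2)

end ge2
end NS

namespace NS
noncomputable section ge3

theorem eval_smul_hom {m : S4} {n} (hm : m.IsHomogeneous n) (c : ℂ) (v : Fin 4 → ℂ) : eval (c • v) m = c ^ n * eval v m := by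
  rw [eval_eq', eval_eq', Finset.mul_sum]
  refine Finset.sum_congr rfl fun x hx => ?_
  have hdeg := hm (mem_support_iff.1 hx)
  rw [Finsupp.weight_apply, Finsupp.sum_fintype _ _ (by simp)] at hdeg
  simp only [Pi.smul_apply, smul_eq_mul, mul_pow, Finset.prod_mul_distrib, Finset.prod_pow_eq_pow_sum]
  simp only [Pi.one_apply, smul_eq_mul, mul_one] at hdeg
  rw [hdeg]; ring

theorem Good.mult {d h ℓ} (hd : 2 ≤ d) (H : Good d h ℓ) (v : Fin 4 → ℂ) (hv : v 3 ≠ 0)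
    (hs : ∀ i, eval v (pderiv i h) = 0) :
    ∃ u : S4, eval v u ≠ 0 ∧ (∀ m n, m.IsHomogeneous n → eval v m = 0 → u * m ∈ cI h) ∧ u ^ 2 * h ∈ cI h ^ 2 := by
  let A : Matrix (Fin 4) (Fin 4) ℂ := !![1,0,0,v 0; 0,1,0,v 1; 0,0,1,v 2; 0,0,0,v 3]
  let B : Matrix (Fin 4) (Fin 4) ℂ := !![1,0,0,-v 0/v 3; 0,1,0,-v 1/v 3; 0,0,1,-v 2/v 3; 0,0,0,(v 3)⁻¹]
  have hAB : A * B = 1 := by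
    ext i j
    fin_cases i <;> fin_cases j <;> simp [A, B, Matrix.mul_apply, Fin.sum_univ_four, hv] <;> field_simp <;> ring
  have hBA : B * A = 1 := mul_eq_one_comm.1 hAB
  have hAe : A.mulVec e3 = v := by
    ext i
    fin_cases i <;> simp [A, e3, Matrix.mulVec, dotProduct, Fin.sum_univ_four]
  have hBv : B.mulVec v = e3 := by rw [← hAe, Matrix.mulVec_mulVec, hBA, Matrix.one_mulVec]
  have hp : ∀ j : Fin 3, pderiv j.castSucc (sb A h) = sb A (pderiv j.castSucc h) := by
    intro j
    rw [pderiv_sb]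
    fin_cases j <;> simp [A, Fin.sum_univ_four]
  have hle : (cI (sb A h)).map (sb B) ≤ cI h := by
    rw [cI, Ideal.map_span, Ideal.span_le]
    rintro _ ⟨x, hx, rfl⟩
    have : ∀ j : Fin 3, sb B (pderiv j.castSucc (sb A h)) ∈ cI h := by
      intro j
      rw [hp j, sb_sb, hAB, sb_one]
      apply Ideal.subset_span
      fin_cases j <;> simp
    rcases hx with rfl | rfl | rfl
    · exact this 0
    · exact this 1
    · exact this 2
  obtain ⟨u, hu, hu1, hu2⟩ := (H.subst A B hAB).mult0 hd (by
    intro i; rw [eval_pderiv_sb, hAe]; simp [hs])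
  refine ⟨sb B u, by rwa [eval_sb, hBv], ?_, ?_⟩
  · intro m n hm hmv
    have := hu1 (sb A m) (ord1 (sb_hom hm) (by rw [eval_sb, hAe, hmv]))
    have := hle (Ideal.mem_map_of_mem (sb B) this)
    rwa [map_mul, sb_sb, hAB, sb_one] at this
  · have := Ideal.mem_map_of_mem (sb B) hu2
    rw [Ideal.map_pow] at this
    have := Ideal.pow_right_mono hle 2 this
    rwa [map_mul, map_pow, sb_sb, hAB, sb_one] at this

theorem Good.h2 {d h} (hd : 2 ≤ d) (H : Good d h e3) :
    ∃ (N : ℕ) (u v : S4), X 3 ^ N = u + v * pderiv 3 h ∧ u * h ∈ cI h ^ 2 := by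
  let D : Ideal S4 := { carrier := {x | ∃ u v, x = u + v * pderiv 3 h ∧ u * h ∈ cI h ^ 2}
                        zero_mem' := ⟨0, 0, by simp, by simp⟩
                        add_mem' := by
                          rintro _ _ ⟨u, v, rfl, h1⟩ ⟨u', v', rfl, h2⟩
                          exact ⟨u+u', v+v', by ring, by rw [add_mul]; exact Ideal.add_mem _ h1 h2⟩
                        smul_mem' := by
                          rintro c _ ⟨u, v, rfl, h1⟩
                          exact ⟨c*u, c*v, by simp; ring, by rw [mul_assoc]; exact Ideal.mul_mem_left _ _ h1⟩ }
  have key : X 3 ∈ D.radical := by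
    apply nss
    intro v hv
    rw [eval_X]
    by_contra hne
    have hc : ∀ x ∈ cI h, eval v x = 0 := by
      intro x hx
      have := hv (x^2) ⟨x^2, 0, by ring, Ideal.mul_mem_right _ _ (Ideal.pow_mem_pow hx 2)⟩
      rw [map_pow] at this
      exact pow_eq_zero_iff (two_ne_zero) |>.1 this
    have h3 := hv (pderiv 3 h) ⟨0, 1, by ring, by simp⟩
    have hs : ∀ i, eval v (pderiv i h) = 0 := by
      intro i
      fin_cases i
      · exact hc _ (Ideal.subset_span (by simp))
      · exact hc _ (Ideal.subset_span (by simp))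
      · exact hc _ (Ideal.subset_span (by simp))
      · exact h3
    obtain ⟨u, hu, -, hu2⟩ := H.mult hd v hne hs
    have := hv (u^2) ⟨u^2, 0, by ring, hu2⟩
    rw [map_pow] at this
    exact hu (pow_eq_zero_iff (two_ne_zero) |>.1 this)
  obtain ⟨N, u, v, h1, h2⟩ := key
  exact ⟨N, u, v, h1, h2⟩

/-- if `g` vanishes at all nodes, then it is in the ideal -/
theorem Good.mem {d h} (hd : 2 ≤ d) (H : Good d h e3) {g : S4} {k} (hg : g.IsHomogeneous k)
    (h1 : g * pderiv 3 h ∈ cI h)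
    (hn : ∀ v : Fin 4 → ℂ, v ≠ 0 → (∀ i, eval v (pderiv i h) = 0) → eval v g = 0) : g ∈ cI h := by
  let D : Ideal S4 := { carrier := {x | x * g ∈ cI h}
                        zero_mem' := by simp
                        add_mem' := by
                          intro a b ha hb
                          show (a + b) * g ∈ cI h
                          rw [add_mul]; exact Ideal.add_mem _ ha hb
                        smul_mem' := by
                          intro c x hx
                          show (c * x) * g ∈ cI h
                          rw [mul_assoc]; exact Ideal.mul_mem_left _ _ hx }
  have key : X 3 ∈ D.radical := by
    apply nss
    intro v hv
    rw [eval_X]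
    by_contra hne
    have hc : ∀ x ∈ cI h, eval v x = 0 := fun x hx => hv x (Ideal.mul_mem_right _ _ hx)
    have h3 := hv (pderiv 3 h) (by show pderiv 3 h * g ∈ cI h; rwa [mul_comm])
    have hs : ∀ i, eval v (pderiv i h) = 0 := by
      intro i
      fin_cases i
      · exact hc _ (Ideal.subset_span (by simp))
      · exact hc _ (Ideal.subset_span (by simp))
      · exact hc _ (Ideal.subset_span (by simp))
      · exact h3
    obtain ⟨u, hu, hu1, -⟩ := H.mult hd v hne hs
    exact hu (hv u (hu1 g k hg (hn v (fun h0 => hne (by simp [h0])) hs)))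
  obtain ⟨N, hN⟩ := key
  exact H.rad.colon_t_pow N hN

/-- skew representation of Koszul relations -/
def SK (f : S4) (ρ : Fin 4 → S4) : Prop :=
  ∃ B : Matrix (Fin 4) (Fin 4) S4, B.transpose = -B ∧ ρ = B.mulVec (fun i => pderiv i f)

theorem Good.koszul {d h} (hd : 2 ≤ d) (H : Good d h e3) {k} {ρ : Fin 4 → S4} (hρ : ∀ i, (ρ i).IsHomogeneous k)
    (hsyz : ∑ i, ρ i * pderiv i h = 0)
    (hn : ∀ v : Fin 4 → ℂ, v ≠ 0 → (∀ i, eval v (pderiv i h) = 0) → eval v (ρ 3) = 0) : SK h ρ := by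
  rw [Fin.sum_univ_four] at hsyz
  have hph : ∀ i, (pderiv i h).IsHomogeneous (d-1) := fun i => H.hom.pderiv
  have hm := H.mem hd (hρ 3) (mem_span3.2 ⟨-ρ 0, -ρ 1, -ρ 2, by linear_combination hsyz⟩) hn
  obtain ⟨s0, s1, s2, hs⟩ := mem_span3.1 hm
  -- homogeneous cofactors
  obtain ⟨t0, t1, t2, ht, ht0, ht1, ht2⟩ : ∃ t0 t1 t2, ρ 3 = t0 * pderiv 0 h + t1 * pderiv 1 h + t2 * pderiv 2 h ∧
      (∀ i, (t0 * pderiv i h).IsHomogeneous k) ∧ (∀ i, (t1 * pderiv i h).IsHomogeneous k) ∧ (∀ i, (t2 * pderiv i h).IsHomogeneous k) := by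
    have hs' := congrArg (homogeneousComponent k) hs
    rw [homogeneousComponent_of_mem (hρ 3), if_pos rfl] at hs'
    simp only [map_add] at hs'
    obtain ⟨b0, e0, h0, z0⟩ := hc_mul (hph 0) s0 k
    obtain ⟨b1, e1, h1, z1⟩ := hc_mul (hph 1) s1 k
    obtain ⟨b2, e2, h2, z2⟩ := hc_mul (hph 2) s2 k
    rw [e0, e1, e2] at hs'
    have : ∀ b : S4, b.IsHomogeneous (k-(d-1)) → (k < d - 1 → b = 0) → ∀ i, (b * pderiv i h).IsHomogeneous k := by
      intro b hb hb0 i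
      by_cases hk : d - 1 ≤ k
      · have := hb.mul (hph i)
        rwa [Nat.sub_add_cancel hk] at this
      · rw [hb0 (by omega), zero_mul]; exact isHomogeneous_zero _ _ _
    exact ⟨b0, b1, b2, hs', this _ h0 z0, this _ h1 z1, this _ h2 z2⟩
  have hz : pderiv 0 h * (ρ 0 + t0 * pderiv 3 h) + pderiv 1 h * (ρ 1 + t1 * pderiv 3 h) + pderiv 2 h * (ρ 2 + t2 * pderiv 3 h) = 0 := by
    linear_combination hsyz - pderiv 3 h * ht
  obtain ⟨v0, v1, v2, e0, e1, e2⟩ := H.rad.koszul (hph 0) (hph 1) (hph 2) k _ _ _ ((hρ 0).add (ht0 3)) ((hρ 1).add (ht1 3))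
    ((hρ 2).add (ht2 3)) hz
  refine ⟨!![0, v2, -v1, -t0; -v2, 0, v0, -t1; v1, -v0, 0, -t2; t0, t1, t2, 0], ?_, ?_⟩
  · ext1 i j
    fin_cases i <;> fin_cases j <;> simp
  · ext1 i
    fin_cases i <;> simp [Matrix.mulVec, dotProduct, Fin.sum_univ_four]
    · linear_combination e0
    · linear_combination e1
    · linear_combination e2
    · linear_combination ht

end ge3
end NS

namespace NS
noncomputable section ge4

def bf (M : Matrix (Fin 3) (Fin 3) ℂ) : LinearMap.BilinMap ℂ (Fin 3 → ℂ) ℂ := Matrix.toLinearMap₂' ℂ M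

theorem congr3 (G Q : Matrix (Fin 3) (Fin 3) ℂ) (hG : G.transpose = G) (hQ : Q.transpose = Q)
    (dG : G.det ≠ 0) (dQ : Q.det ≠ 0) : ∃ C : Matrix (Fin 3) (Fin 3) ℂ, C.transpose * G * C = Q := by
  have hap : ∀ (M : Matrix (Fin 3) (Fin 3) ℂ) (x y : Fin 3 → ℂ), bf M x y = x ⬝ᵥ M.mulVec y := by
    intro M x y; exact Matrix.toLinearMap₂'_apply' M x y
  have hsym : ∀ M : Matrix (Fin 3) (Fin 3) ℂ, M.transpose = M → ∀ x y, bf M x y = bf M y x := by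
    intro M hM x y
    rw [hap, hap, Matrix.dotProduct_mulVec, ← Matrix.mulVec_transpose, hM, dotProduct_comm]
  have hsep : ∀ M : Matrix (Fin 3) (Fin 3) ℂ, M.transpose = M → M.det ≠ 0 →
      (QuadraticMap.associated (R := ℂ) (LinearMap.BilinMap.toQuadraticMap (bf M))).SeparatingLeft := by
    intro M hM hd
    rw [QuadraticMap.associated_left_inverse ℂ (hsym M hM)]
    exact LinearMap.separatingLeft_toLinearMap₂'_of_det_ne_zero' hd
  obtain ⟨e⟩ := QuadraticForm.equivalent_of_isAlgClosed _ _ (hsep Q hQ dQ) (hsep G hG dG)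
  have he : ∀ x, bf G (e x) (e x) = bf Q x x := fun x => e.map_app x
  have hpol : ∀ x y, bf G (e x) (e y) = bf Q x y := by
    intro x y
    have h1 := he (x + y)
    have h2 := he x
    have h3 := he y
    have h4 := hsym G hG (e x) (e y)
    have h5 := hsym Q hQ x y
    have h6 : e (x + y) = e x + e y := map_add e.toLinearEquiv x y
    rw [h6] at h1
    simp only [map_add, LinearMap.add_apply] at h1
    linear_combination (1/2) * h1 - (1/2) * h2 - (1/2) * h3 + (1/2) * h4 - (1/2) * h5
  refine ⟨LinearMap.toMatrix' (e.toLinearEquiv : (Fin 3 → ℂ) →ₗ[ℂ] (Fin 3 → ℂ)), ?_⟩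
  set C := LinearMap.toMatrix' (e.toLinearEquiv : (Fin 3 → ℂ) →ₗ[ℂ] (Fin 3 → ℂ)) with hC
  have hCx : ∀ x, C.mulVec x = e x := by
    intro x
    rw [← Matrix.toLin'_apply, hC, Matrix.toLin'_toMatrix']; rfl
  have hbi : Function.Injective bf := fun M M' hM => (Matrix.toLinearMap₂' ℂ).injective hM
  apply hbi
  apply LinearMap.ext₂
  intro x y
  rw [← hpol, hap, hap, ← hCx, ← hCx, ← Matrix.mulVec_mulVec, ← Matrix.mulVec_mulVec, Matrix.dotProduct_mulVec,
    Matrix.vecMul_transpose]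

theorem syz_sb {f : S4} {ρ : Fin 4 → S4} (hs : ∑ i, ρ i * pderiv i f = 0) (A B : Matrix (Fin 4) (Fin 4) ℂ) (hAB : A * B = 1) :
    ∑ j, (∑ i, C (B j i) * sb A (ρ i)) * pderiv j (sb A f) = 0 := by
  have h0 := congrArg (sb A) hs
  simp only [map_sum, map_mul, map_zero] at h0
  rw [← h0]
  have hone : ∀ a i, ∑ j, (C (A a j) : S4) * C (B j i) = if a = i then 1 else 0 := by
    intro a i
    have := congrFun (congrFun hAB a) i
    rw [Matrix.mul_apply, Matrix.one_apply] at this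
    simp only [← C_mul, ← map_sum, this]
    split_ifs <;> simp
  calc ∑ j, (∑ i, C (B j i) * sb A (ρ i)) * pderiv j (sb A f)
      = ∑ j, ∑ i, ∑ a, (C (A a j) * C (B j i)) * (sb A (ρ i) * sb A (pderiv a f)) := by
        refine Finset.sum_congr rfl fun j _ => ?_
        rw [pderiv_sb, Finset.sum_mul]
        refine Finset.sum_congr rfl fun i _ => ?_
        rw [Finset.mul_sum]
        exact Finset.sum_congr rfl fun a _ => by ring
    _ = ∑ i, ∑ a, (∑ j, C (A a j) * C (B j i)) * (sb A (ρ i) * sb A (pderiv a f)) := by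
        rw [Finset.sum_comm]
        refine Finset.sum_congr rfl fun i _ => ?_
        rw [Finset.sum_comm]
        exact Finset.sum_congr rfl fun a _ => by rw [Finset.sum_mul]
    _ = _ := by
        refine Finset.sum_congr rfl fun i _ => ?_
        simp [hone]

theorem hom_sb {ρ : Fin 4 → S4} {k} (hρ : ∀ i, (ρ i).IsHomogeneous k) (A B : Matrix (Fin 4) (Fin 4) ℂ) (j) :
    (∑ i, C (B j i) * sb A (ρ i)).IsHomogeneous k :=
  IsHomogeneous.sum _ _ _ fun i _ => by
    simpa using (isHomogeneous_C (Fin 4) (B j i)).mul (sb_hom (A := A) (hρ i))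

theorem Good.hess_last {d h ℓ} (H : Good d h ℓ) (hs : ∀ i, eval e3 (pderiv i h) = 0) (i) :
    eval e3 (pderiv 3 (pderiv i h)) = 0 := by
  have := congrArg (eval e3) (H.hom.pderiv (i := i)).sum_X_mul_pderiv
  rw [map_nsmul, hs i] at this
  simpa [e3, Fin.sum_univ_four] using this

theorem Good.det {d h ℓ} (H : Good d h ℓ) (hs : ∀ i, eval e3 (pderiv i h) = 0) :
    (Matrix.of fun i j : Fin 3 => eval e3 (pderiv i.castSucc (pderiv j.castSucc h))).det ≠ 0 := by
  intro hdet
  obtain ⟨w, hw0, hw⟩ := Matrix.exists_mulVec_eq_zero_iff.2 hdet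
  obtain ⟨c, hc⟩ := H.nod e3 (by simp [e3]) hs (Fin.snoc (α := fun _ => ℂ) w 0) (by
    ext i
    simp only [Matrix.mulVec, dotProduct, hessian, Matrix.of_apply, Pi.zero_apply]
    rw [Fin.sum_univ_castSucc]
    simp only [Fin.snoc_castSucc, Fin.snoc_last, mul_zero, add_zero]
    refine Fin.lastCases ?_ (fun i => ?_) i
    · apply Finset.sum_eq_zero
      intro j _
      rw [show Fin.last 3 = (3 : Fin 4) from rfl, H.hess_last hs, zero_mul]
    · exact congrFun hw i)
  apply hw0
  ext i
  have := congrFun hc i.castSucc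
  rw [Fin.snoc_castSucc] at this
  rw [this]
  fin_cases i <;> simp [e3]

def QQ : Matrix (Fin 3) (Fin 3) ℂ := !![0,1,0;1,0,0;0,0,2]

theorem mq_hom {d : ℕ} (hd : 2 ≤ d) : (mq ℂ d).IsHomogeneous d := by
  have h1 : (X 0 * X 1 + X 2 ^ 2 : S4).IsHomogeneous 2 :=
    ((isHomogeneous_X ℂ 0).mul (isHomogeneous_X ℂ 1)).add (by simpa using (isHomogeneous_X ℂ (2 : Fin 4)).pow 2)
  have h2 : (X 3 ^ (d-2) : S4).IsHomogeneous (d-2) := by simpa using (isHomogeneous_X ℂ (3 : Fin 4)).pow (d-2)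
  have := h2.mul h1
  rwa [Nat.sub_add_cancel hd] at this

theorem mq_eval (d : ℕ) : eval e3 (mq ℂ d) = 0 := by simp [mq, e3]

theorem mq_eval1 (d : ℕ) (i : Fin 3) : eval e3 (pderiv i.castSucc (mq ℂ d)) = 0 := by
  fin_cases i <;> simp [mq, e3, pderiv_X, Pi.single_apply, Derivation.leibniz, Derivation.leibniz_pow]

theorem mq_eval2 (d : ℕ) (i j : Fin 3) : eval e3 (pderiv i.castSucc (pderiv j.castSucc (mq ℂ d))) = QQ i j := by
  fin_cases i <;> fin_cases j <;> simp [mq, e3, pderiv_X, Pi.single_apply, Derivation.leibniz, Derivation.leibniz_pow, QQ]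

theorem ord3_of {d : ℕ} (hd : 2 ≤ d) {h : S4} (hh : h.IsHomogeneous d) (h0 : eval e3 h = 0)
    (h1 : ∀ i, eval e3 (pderiv i h) = 0)
    (h2 : ∀ i j : Fin 3, eval e3 (pderiv i.castSucc (pderiv j.castSucc h)) = QQ i j) : Ord 3 (h - mq ℂ d) := by
  have hq : (h - mq ℂ d).IsHomogeneous d := hh.sub (mq_hom hd)
  have key : ∀ j : Fin 3, Ord 2 (pderiv j.castSucc (h - mq ℂ d)) := by
    intro j
    have key2 : ∀ i : Fin 3, Ord 1 (pderiv i.castSucc (pderiv j.castSucc (h - mq ℂ d))) := by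
      intro i
      exact ord1 hq.pderiv.pderiv (by simp [h2, mq_eval2])
    exact ord_succ hq.pderiv (by simp [h1, mq_eval1]) (key2 0) (key2 1) (key2 2)
  exact ord_succ hq (by simp [h0, mq_eval]) (key 0) (key 1) (key 2)

theorem Good.node0 {d k h} (hd : 3 ≤ d) (hdk : 2*k+7 ≤ 3*d) (H : Good d h e3) (hs : ∀ i, eval e3 (pderiv i h) = 0)
    {ρ : Fin 4 → S4} (hρ : ∀ i, (ρ i).IsHomogeneous k) (hsyz : ∑ i, ρ i * pderiv i h = 0) : eval e3 (ρ 3) = 0 := by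
  set G : Matrix (Fin 3) (Fin 3) ℂ := Matrix.of fun i j : Fin 3 => eval e3 (pderiv i.castSucc (pderiv j.castSucc h)) with hG
  have dG : G.det ≠ 0 := H.det hs
  have dQ : QQ.det ≠ 0 := by simp [QQ, Matrix.det_fin_three]
  obtain ⟨Cm, hC⟩ := congr3 G QQ (by ext i j; simp [hG, pd_comm]) (by ext i j; fin_cases i <;> fin_cases j <;> simp [QQ]) dG dQ
  have dC : IsUnit Cm.det := by
    rw [isUnit_iff_ne_zero]
    intro h0
    have := congrArg Matrix.det hC
    rw [Matrix.det_mul, h0, mul_zero] at this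
    exact dQ this.symm
  have hCC : Cm * Cm⁻¹ = 1 := Matrix.mul_nonsing_inv _ dC
  let bl : Matrix (Fin 3) (Fin 3) ℂ → Matrix (Fin 4) (Fin 4) ℂ := fun M =>
    !![M 0 0, M 0 1, M 0 2, 0; M 1 0, M 1 1, M 1 2, 0; M 2 0, M 2 1, M 2 2, 0; 0, 0, 0, 1]
  have hAB : bl Cm * bl Cm⁻¹ = 1 := by
    have e : ∀ i j, (Cm * Cm⁻¹) i j = (1 : Matrix (Fin 3) (Fin 3) ℂ) i j := fun i j => by rw [hCC]
    simp only [Matrix.mul_apply, Fin.sum_univ_three, Matrix.one_apply] at e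
    generalize Cm⁻¹ = D at e
    ext i j
    rw [Matrix.mul_apply, Fin.sum_univ_four]
    fin_cases i <;> fin_cases j <;> simp [bl, e]
  set A := bl Cm with hA
  set B := bl Cm⁻¹ with hB
  have hAe : A.mulVec e3 = e3 := by
    ext i
    fin_cases i <;> simp [A, bl, e3, Matrix.mulVec, dotProduct, Fin.sum_univ_four]
  have heA : Matrix.vecMul e3 A = e3 := by
    ext i
    fin_cases i <;> simp [A, bl, e3, Matrix.vecMul, dotProduct, Fin.sum_univ_four]
  have H' := H.subst A B hAB
  rw [heA] at H'
  have hs' : ∀ i, eval e3 (pderiv i (sb A h)) = 0 := by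
    intro i; rw [eval_pderiv_sb, hAe]; simp [hs]
  have h0 : eval e3 h = 0 := by
    have := congrArg (eval e3) H.hom.sum_X_mul_pderiv
    simp only [map_sum, map_mul, hs, mul_zero, Finset.sum_const_zero, nsmul_eq_mul, map_natCast] at this
    have hd0 : (d : ℂ) ≠ 0 := by exact_mod_cast (by omega : d ≠ 0)
    exact (mul_eq_zero.1 this.symm).resolve_left hd0
  have h4 : Ord 3 (sb A h - mq ℂ d) := by
    refine ord3_of (by omega) H'.hom (by rw [eval_sb, hAe, h0]) hs' ?_
    intro i j
    have e1 := congrFun (congrFun (hessian_sb A h e3) i.castSucc) j.castSucc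
    rw [hAe] at e1
    have e2 := congrFun (congrFun hC i) j
    rw [← e2]
    have e3' : ∀ i j : Fin 3, hessian h e3 i.castSucc j.castSucc = G i j := fun i j => rfl
    have e4 := fun i j => e3' i j
    refine Eq.trans e1 ?_
    simp only [Matrix.mul_apply, Matrix.transpose_apply]
    rw [Fin.sum_univ_castSucc]
    have e5 : ∀ j : Fin 3, A (Fin.last 3) j.castSucc = 0 := by intro j; fin_cases j <;> simp [A, bl, show Fin.last 3 = 3 from rfl]
    have e6 : ∀ i j : Fin 3, A i.castSucc j.castSucc = Cm i j := by intro i j; fin_cases i <;> fin_cases j <;> simp [A, bl]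
    rw [e5, mul_zero, add_zero]
    refine Finset.sum_congr rfl fun a _ => ?_
    rw [Fin.sum_univ_castSucc, e5, zero_mul, add_zero, e6]
    congr 1
    refine Finset.sum_congr rfl fun b _ => ?_
    rw [e6, e3']
  have hsy := syz_sb hsyz A B hAB
  rw [Fin.sum_univ_four] at hsy
  have hB3 : ∑ i, C (B 3 i) * sb A (ρ i) = sb A (ρ 3) := by
    simp [Fin.sum_univ_four, B, bl]
  rw [hB3] at hsy
  have hmem : sb A (ρ 3) * pderiv 3 (sb A h) ∈ cI (sb A h) := by
    generalize (∑ i, C (B 0 i) * sb A (ρ i)) = r0 at hsy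
    generalize (∑ i, C (B 1 i) * sb A (ρ i)) = r1 at hsy
    generalize (∑ i, C (B 2 i) * sb A (ρ i)) = r2 at hsy
    exact mem_span3.2 ⟨-r0, -r1, -r2, by linear_combination hsy⟩
  obtain ⟨N, u, v, e1, e2⟩ := H'.h2 (by omega)
  have := transfer hd hdk (sb A h) (sb A (ρ 3)) u v H'.hom (sb_hom (hρ 3))
    hmem e1 e2 H'.rad h4
  rw [← eval_e3 (sb_hom (hρ 3)), eval_sb, hAe] at this
  exact this

end ge4
end NS

namespace NS
noncomputable section ge5

theorem Good.node {d k h} (hd : 3 ≤ d) (hdk : 2*k+7 ≤ 3*d) (H : Good d h e3) (v : Fin 4 → ℂ) (hv0 : v ≠ 0)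
    (hs : ∀ i, eval v (pderiv i h) = 0)
    {ρ : Fin 4 → S4} (hρ : ∀ i, (ρ i).IsHomogeneous k) (hsyz : ∑ i, ρ i * pderiv i h = 0) : eval v (ρ 3) = 0 := by
  have hv : v 3 ≠ 0 := by
    intro h0
    exact H.tg v hv0 (by simp [e3, h0]) 0 (by simp [hs])
  let A : Matrix (Fin 4) (Fin 4) ℂ := !![1,0,0,v 0/v 3; 0,1,0,v 1/v 3; 0,0,1,v 2/v 3; 0,0,0,1]
  let B : Matrix (Fin 4) (Fin 4) ℂ := !![1,0,0,-(v 0/v 3); 0,1,0,-(v 1/v 3); 0,0,1,-(v 2/v 3); 0,0,0,1]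
  have hAB : A * B = 1 := by
    ext i j
    rw [Matrix.mul_apply, Fin.sum_univ_four]
    fin_cases i <;> fin_cases j <;> simp [A, B]
  have hAe : A.mulVec e3 = (v 3)⁻¹ • v := by
    ext i
    fin_cases i <;> simp [A, e3, Matrix.mulVec, dotProduct, Fin.sum_univ_four, hv, div_eq_mul_inv, mul_comm]
  have heA : Matrix.vecMul e3 A = e3 := by
    ext i
    fin_cases i <;> simp [A, e3, Matrix.vecMul, dotProduct, Fin.sum_univ_four]
  have H' := H.subst A B hAB
  rw [heA] at H'
  have hs' : ∀ i, eval e3 (pderiv i (sb A h)) = 0 := by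
    intro i; rw [eval_pderiv_sb, hAe]
    apply Finset.sum_eq_zero
    intro j _
    rw [eval_smul_hom (H.hom.pderiv (i := j)), hs, mul_zero, mul_zero]
  have := H'.node0 hd hdk hs' (ρ := fun j => ∑ i, C (B j i) * sb A (ρ i)) (hom_sb hρ A B) (syz_sb hsyz A B hAB)
  have hB3 : ∑ i, C (B 3 i) * sb A (ρ i) = sb A (ρ 3) := by
    simp [Fin.sum_univ_four, B]
  simp only [hB3] at this
  rw [eval_sb, hAe, eval_smul_hom (hρ 3)] at this
  exact (mul_eq_zero.1 this).resolve_left (pow_ne_zero _ (inv_ne_zero hv))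

theorem SK.back {f : S4} {ρ : Fin 4 → S4} (A B : Matrix (Fin 4) (Fin 4) ℂ) (hAB : A * B = 1)
    (h : SK (sb A f) (fun j => ∑ i, C (B j i) * sb A (ρ i))) : SK f ρ := by
  obtain ⟨S, hS, hρ⟩ := h
  let AC : Matrix (Fin 4) (Fin 4) S4 := A.map C
  let BC : Matrix (Fin 4) (Fin 4) S4 := B.map C
  have hABC : AC * BC = 1 := by
    have h0 : AC * BC = (A * B).map (C : ℂ →+* S4) := (Matrix.map_mul ..).symm
    rw [h0, hAB]
    exact Matrix.map_one _ (map_zero _) (map_one _)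
  have h1 : (fun j => ∑ i, C (B j i) * sb A (ρ i)) = BC.mulVec (fun i => sb A (ρ i)) := rfl
  have h2 : (fun j => pderiv j (sb A f)) = AC.transpose.mulVec (fun i => sb A (pderiv i f)) := by
    ext1 j; rw [pderiv_sb]; rfl
  rw [h1, h2] at hρ
  have h3 := congrArg AC.mulVec hρ
  rw [Matrix.mulVec_mulVec, hABC, Matrix.one_mulVec, Matrix.mulVec_mulVec, Matrix.mulVec_mulVec] at h3
  have hT : (AC * S * AC.transpose).transpose = - (AC * S * AC.transpose) := by
    rw [Matrix.transpose_mul, Matrix.transpose_mul, hS, Matrix.transpose_transpose, Matrix.neg_mul, Matrix.mul_neg,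
      Matrix.mul_assoc]
  refine ⟨(AC * S * AC.transpose).map (sb B), ?_, ?_⟩
  · ext1 i j
    have := congrFun (congrFun hT i) j
    rw [Matrix.transpose_apply, Matrix.neg_apply] at this
    rw [Matrix.transpose_apply, Matrix.neg_apply, Matrix.map_apply, Matrix.map_apply, this, map_neg]
  · have h4 : ∀ x : S4, sb B (sb A x) = x := fun x => by rw [sb_sb, hAB, sb_one]
    ext1 i
    have := congrArg (sb B) (congrFun h3 i)
    rw [h4] at this
    rw [this]
    simp only [Matrix.mulVec, dotProduct, map_sum, map_mul, h4, Matrix.map_apply]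

theorem exAB (ℓ : Fin 4 → ℂ) (hℓ : ℓ 3 ≠ 0) : ∃ A B : Matrix (Fin 4) (Fin 4) ℂ, A * B = 1 ∧ Matrix.vecMul ℓ A = e3 := by
  let A : Matrix (Fin 4) (Fin 4) ℂ := !![1,0,0,0; 0,1,0,0; 0,0,1,0; -(ℓ 0/ℓ 3), -(ℓ 1/ℓ 3), -(ℓ 2/ℓ 3), (ℓ 3)⁻¹]
  let B : Matrix (Fin 4) (Fin 4) ℂ := !![1,0,0,0; 0,1,0,0; 0,0,1,0; ℓ 0, ℓ 1, ℓ 2, ℓ 3]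
  have hx : ∀ a : ℂ, -(a / ℓ 3) + (ℓ 3)⁻¹ * a = 0 := fun a => by rw [div_eq_mul_inv]; ring
  have hy : ∀ a : ℂ, a + -(ℓ 3 * (a / ℓ 3)) = 0 := fun a => by rw [mul_div_cancel₀ _ hℓ, add_neg_cancel]
  have hAB : A * B = 1 := by
    ext i j
    rw [Matrix.mul_apply, Fin.sum_univ_four]
    fin_cases i <;> fin_cases j <;> simp [A, B, hℓ, hx]
  have heA : Matrix.vecMul ℓ A = e3 := by
    ext i
    fin_cases i <;> simp [A, e3, Matrix.vecMul, dotProduct, Fin.sum_univ_four, hℓ, hy]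
  exact ⟨A, B, hAB, heA⟩

theorem Good.toSK {d k f ℓ} (hd : 3 ≤ d) (hdk : 2*k+7 ≤ 3*d) (H : Good d f ℓ) (hℓ : ℓ 3 ≠ 0)
    {ρ : Fin 4 → S4} (hρ : ∀ i, (ρ i).IsHomogeneous k) (hsyz : ∑ i, ρ i * pderiv i f = 0) : SK f ρ := by
  obtain ⟨A, B, hAB, heA⟩ := exAB ℓ hℓ
  have H' := H.subst A B hAB
  rw [heA] at H'
  have h1 := hom_sb hρ A B
  have h2 := syz_sb hsyz A B hAB
  have h3 := fun v hv hs => H'.node hd hdk v hv hs h1 h2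
  have h4 := H'.koszul (by omega) h1 h2 h3
  exact SK.back A B hAB h4

theorem SK.KR {f : S4} {ρ : Fin 4 → S4} (h : SK f ρ) : ρ ∈ KR f := by
  obtain ⟨S, hS, rfl⟩ := h
  have hs : ∀ i j, S j i = - S i j := fun i j => congrFun (congrFun hS i) j
  have hz : ∀ i, S i i = 0 := fun i => self_eq_neg.1 (hs i i)
  have hm : ∀ i j : Fin 4, i < j → S i j • koszul f i j ∈ _root_.KR f := fun i j hij =>
    Submodule.smul_mem _ _ (Submodule.subset_span ⟨i, j, hij, rfl⟩)
  have := Submodule.add_mem _ (Submodule.add_mem _ (Submodule.add_mem _ (Submodule.add_mem _ (Submodule.add_mem _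
    (hm 0 1 (by decide)) (hm 0 2 (by decide))) (hm 0 3 (by decide))) (hm 1 2 (by decide))) (hm 1 3 (by decide))) (hm 2 3 (by decide))
  convert this using 1
  ext1 i
  fin_cases i <;> simp [Matrix.mulVec, dotProduct, Fin.sum_univ_four, koszul, hz, hs 0 1, hs 0 2, hs 0 3, hs 1 2, hs 1 3, hs 2 3]

end ge5
end NS

namespace NS
noncomputable section ge6

theorem alg_dep {f : S4} (hf : f ≠ 0) : ∃ Φ : S4, Φ ≠ 0 ∧ f ∣ aeval (fun i => pderiv i f) Φ := by
  let x : Option (Fin 4) → S4 := fun o => o.elim f (fun i => pderiv i f)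
  have hx : ¬ AlgebraicIndependent ℂ x := by
    intro h
    have h1 := h.cardinalMk_le_trdeg
    rw [MvPolynomial.trdeg_of_isDomain] at h1
    simp at h1
    norm_num at h1
  rw [algebraicIndependent_iff] at hx
  push Not at hx
  obtain ⟨p, hp, hp0⟩ := hx
  let P := optionEquivLeft ℂ (Fin 4) p
  have hP0 : P ≠ 0 := by simpa [P] using hp0
  let g : Polynomial S4 →+* S4 := Polynomial.eval₂RingHom (aeval (fun i => pderiv i f) : S4 →ₐ[ℂ] S4).toRingHom f
  have hg : g P = 0 := by
    rw [← hp]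
    have : (g.comp (optionEquivLeft ℂ (Fin 4)).toRingEquiv.toRingHom) = (aeval x : MvPolynomial (Option (Fin 4)) ℂ →ₐ[ℂ] S4).toRingHom := by
      apply MvPolynomial.ringHom_ext
      · intro r
        simp [g, optionEquivLeft_C]
      · intro i
        cases i <;> simp [g, x, optionEquivLeft_X_none, optionEquivLeft_X_some]
    exact congrArg (fun h => h p) this
  obtain ⟨Q, hQ, hQd⟩ := Polynomial.exists_eq_pow_rootMultiplicity_mul_and_not_dvd P hP0 0
  rw [map_zero, sub_zero] at hQ hQd
  have hgX : g Polynomial.X = f := by simp [g]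
  rw [hQ, map_mul, map_pow, hgX] at hg
  have hgQ := (mul_eq_zero.1 hg).resolve_left (pow_ne_zero _ hf)
  refine ⟨Q.coeff 0, fun h => hQd (Polynomial.X_dvd_iff.2 h), ?_⟩
  have h2 := congrArg g (Polynomial.X_mul_divX_add Q)
  rw [map_add, map_mul, hgX, hgQ] at h2
  have h3 : g (Polynomial.C (Q.coeff 0)) = aeval (fun i => pderiv i f) (Q.coeff 0) := by simp [g]
  rw [h3] at h2
  exact ⟨-g Q.divX, by linear_combination h2⟩

theorem euler {f : S4} {d} (hf : f.IsHomogeneous d) (v : Fin 4 → ℂ) : ∑ i, v i * eval v (pderiv i f) = d * eval v f := by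
  have := congrArg (eval v) hf.sum_X_mul_pderiv
  simpa using this

theorem sing_rep {f : S4} {d} (hf : f.IsHomogeneous d) {v : Fin 4 → ℂ} (hv : v ≠ 0) (hs : ∀ i, eval v (pderiv i f) = 0) :
    ∃ P ∈ singLocus f, ∃ a : ℂ, a ≠ 0 ∧ v = a • P.rep := by
  obtain ⟨a, ha⟩ := Projectivization.exists_smul_eq_mk_rep ℂ v hv
  have ha' : (a : ℂ) • v = (Projectivization.mk ℂ v hv).rep := ha
  refine ⟨Projectivization.mk ℂ v hv, ?_, (a : ℂ)⁻¹, inv_ne_zero a.ne_zero, ?_⟩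
  · intro i
    rw [← ha', eval_smul_hom (hf.pderiv (i := i)), hs, mul_zero]
  · rw [← ha', smul_smul, inv_mul_cancel₀ a.ne_zero, one_smul]

theorem lin_ne {w : Fin 4 → ℂ} (hw : w ≠ 0) : (∑ i, C (w i) * X i : S4) ≠ 0 := by
  intro h
  apply hw
  ext i
  have := congrArg (eval (Pi.single i 1)) h
  simpa [Pi.single_apply] using this

theorem exists_good {f : S4} {d : ℕ} (hd : 5 ≤ d) (hf : f.IsHomogeneous d) (hiso : (singLocus f).Finite)
    (hnodal : ∀ P ∈ singLocus f, (hessian f P.rep).rank = 3) : ∃ ℓ : Fin 4 → ℂ, Good d f ℓ ∧ ℓ 3 ≠ 0 := by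
  have hf0 : f ≠ 0 := by
    rintro rfl
    have h1 := hnodal (Projectivization.mk ℂ e3 (by intro h; simpa [e3] using congrFun h 3)) (by intro i; simp)
    have h2 : ∀ v, hessian 0 v = 0 := by intro v; ext i j; simp [hessian]
    rw [h2] at h1
    simp at h1
  obtain ⟨Φ, hΦ, g, hg⟩ := alg_dep hf0
  have hne : Φ * X 3 * ∏ P ∈ hiso.toFinset, (∑ i, C (P.rep i) * X i : S4) ≠ 0 := by
    refine mul_ne_zero (mul_ne_zero hΦ (X_ne_zero _)) (Finset.prod_ne_zero_iff.2 fun P _ => lin_ne P.rep_nonzero)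
  obtain ⟨ℓ, hℓ⟩ : ∃ ℓ, eval ℓ (Φ * X 3 * ∏ P ∈ hiso.toFinset, (∑ i, C (P.rep i) * X i : S4)) ≠ 0 := by
    by_contra hc
    push Not at hc
    exact hne (MvPolynomial.funext fun x => by rw [hc x, map_zero])
  rw [map_mul, map_mul, map_prod] at hℓ
  have hℓ1 : eval ℓ Φ ≠ 0 := left_ne_zero_of_mul (left_ne_zero_of_mul hℓ)
  have hℓ2 : ℓ 3 ≠ 0 := by simpa using right_ne_zero_of_mul (left_ne_zero_of_mul hℓ)
  have hℓ3 : ∀ P ∈ singLocus f, ∑ i, P.rep i * ℓ i ≠ 0 := by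
    intro P hP
    have := Finset.prod_ne_zero_iff.1 (right_ne_zero_of_mul hℓ) P (hiso.mem_toFinset.2 hP)
    simpa using this
  have hsing : ∀ v : Fin 4 → ℂ, v ≠ 0 → ℓ ⬝ᵥ v = 0 → (∀ i, eval v (pderiv i f) = 0) → False := by
    intro v hv hlv hs
    obtain ⟨P, hP, a, ha, rfl⟩ := sing_rep hf hv hs
    apply hℓ3 P hP
    have : ℓ ⬝ᵥ (a • P.rep) = a * ∑ i, P.rep i * ℓ i := by
      rw [dotProduct, Finset.mul_sum]
      exact Finset.sum_congr rfl fun i _ => by simp; ring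
    rw [this] at hlv
    exact (mul_eq_zero.1 hlv).resolve_left ha
  refine ⟨ℓ, ⟨hf, ?_, ?_⟩, hℓ2⟩
  · intro v hv hlv c hc
    by_cases hc0 : c = 0
    · exact hsing v hv hlv fun i => by rw [hc, hc0, zero_mul]
    obtain ⟨s, hs⟩ := IsAlgClosed.exists_pow_nat_eq (c⁻¹) (show 0 < d - 1 by omega)
    have hfv : eval v f = 0 := by
      have h1 := euler hf v
      have h2 : ∑ i, v i * eval v (pderiv i f) = c * (ℓ ⬝ᵥ v) := by
        rw [dotProduct, Finset.mul_sum]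
        exact Finset.sum_congr rfl fun i _ => by rw [hc]; ring
      rw [h2, hlv, mul_zero] at h1
      exact (mul_eq_zero.1 h1.symm).resolve_left (by exact_mod_cast (by omega : d ≠ 0))
    have hgr : (fun i => eval (s • v) (pderiv i f)) = ℓ := by
      ext i
      rw [eval_smul_hom (hf.pderiv (i := i)), hs, hc, inv_mul_cancel_left₀ hc0]
    have h3 := congrArg (eval (s • v)) hg
    rw [map_mul, eval_smul_hom hf, hfv, mul_zero, zero_mul] at h3
    have h4 : eval (s • v) (aeval (fun i => pderiv i f) Φ) = eval (fun i => eval (s • v) (pderiv i f)) Φ := by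
      have : ((eval (s • v)).comp (aeval (fun i => pderiv i f) : S4 →ₐ[ℂ] S4).toRingHom) = eval (fun i => eval (s • v) (pderiv i f)) := by
        apply MvPolynomial.ringHom_ext
        · intro r; simp
        · intro i; simp
      exact congrArg (fun h => h Φ) this
    rw [h4, hgr] at h3
    exact hℓ1 h3
  · intro v hv hs w hw
    obtain ⟨P, hP, a, ha, rfl⟩ := sing_rep hf hv hs
    have hhs : hessian f (a • P.rep) = a ^ (d-1-1) • hessian f P.rep := by
      ext i j
      simp only [hessian, Matrix.of_apply, Matrix.smul_apply, smul_eq_mul]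
      exact eval_smul_hom ((hf.pderiv (i := j)).pderiv) _ _
    rw [hhs, Matrix.smul_mulVec] at hw
    have hw' := (smul_eq_zero.1 hw).resolve_left (pow_ne_zero _ ha)
    have hrk := hnodal P hP
    have hP0 : (hessian f P.rep).mulVec P.rep = 0 := by
      ext i
      have := euler (hf.pderiv (i := i)) P.rep
      rw [hP i, mul_zero] at this
      rw [Pi.zero_apply, ← this, Matrix.mulVec, dotProduct]
      refine Finset.sum_congr rfl fun j _ => ?_
      simp only [hessian, Matrix.of_apply]
      rw [pd_comm, mul_comm]
    have hker : Module.finrank ℂ (LinearMap.ker (hessian f P.rep).mulVecLin) = 1 := by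
      have := LinearMap.finrank_range_add_finrank_ker (hessian f P.rep).mulVecLin
      rw [← Matrix.rank, hrk] at this
      simp at this
      omega
    obtain ⟨c, hc⟩ := (finrank_eq_one_iff_of_nonzero' (⟨P.rep, hP0⟩ : LinearMap.ker (hessian f P.rep).mulVecLin)
      (by intro h; exact P.rep_nonzero (congrArg Subtype.val h))).1 hker ⟨w, hw'⟩
    have hc' : c • P.rep = w := congrArg Subtype.val hc
    exact ⟨c * a⁻¹, by rw [← hc', smul_smul, mul_assoc, inv_mul_cancel₀ ha, mul_one]⟩

end ge6
end NS

namespace NS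
noncomputable section ge7

theorem hc_eq {n : ℕ} {G : S4} (hG : G.IsHomogeneous n) (a : S4) (D : ℕ) :
    homogeneousComponent D (a * G) = if n ≤ D then homogeneousComponent (D - n) a * G else 0 := by
  have h1 : homogeneousComponent D (a * G) =
      ∑ i ∈ Finset.range (a.totalDegree + 1), if i + n = D then homogeneousComponent i a * G else 0 := by
    conv_lhs => rw [← sum_homogeneousComponent a, Finset.sum_mul, map_sum]
    refine Finset.sum_congr rfl fun i _ => ?_
    rw [homogeneousComponent_of_mem ((homogeneousComponent_isHomogeneous i a).mul hG)]
    simp only [eq_comm]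
  rw [h1]
  split_ifs with h
  · have h2 : ∀ i, (i + n = D) = (i = D - n) := fun i => propext (by omega)
    simp only [h2]
    rw [Finset.sum_ite_eq']
    split_ifs with h3
    · rfl
    · rw [Finset.mem_range] at h3
      rw [homogeneousComponent_eq_zero _ _ (by omega), zero_mul]
  · exact Finset.sum_eq_zero fun i _ => if_neg (by omega)

theorem hc_self {n : ℕ} {G : S4} (hG : G.IsHomogeneous n) : homogeneousComponent n G = G := by
  rw [homogeneousComponent_of_mem hG, if_pos rfl]

theorem cc_hom {n : ℕ} {G : S4} (hG : G.IsHomogeneous n) (hn : n ≠ 0) : constantCoeff G = 0 := by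
  rw [constantCoeff_eq]
  exact hG.coeff_eq_zero (by simpa using hn.symm)

theorem sk_hom {f : S4} {d k} (hf : f.IsHomogeneous d) {ρ : Fin 4 → S4} (hρ : ∀ i, (ρ i).IsHomogeneous k) (h : SK f ρ) :
    (k < d - 1 → ρ = 0) ∧ ∃ S : Matrix (Fin 4) (Fin 4) S4, S.transpose = -S ∧ ρ = S.mulVec (fun i => pderiv i f) ∧
      ∀ i j, (S i j).IsHomogeneous (k - (d-1)) := by
  obtain ⟨S, hS, e⟩ := h
  have h1 : ∀ i, ρ i = ∑ j, if d - 1 ≤ k then homogeneousComponent (k - (d-1)) (S i j) * pderiv j f else 0 := by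
    intro i
    rw [← hc_self (hρ i), e, Matrix.mulVec, dotProduct, map_sum]
    exact Finset.sum_congr rfl fun j _ => hc_eq hf.pderiv _ _
  have h0 : k < d - 1 → ρ = 0 := by
    intro hk; ext1 i
    rw [h1]
    exact Finset.sum_eq_zero fun j _ => if_neg (by omega)
  refine ⟨h0, ?_⟩
  by_cases hk : d - 1 ≤ k
  · refine ⟨Matrix.of fun i j => homogeneousComponent (k - (d-1)) (S i j), ?_, ?_, fun i j => homogeneousComponent_isHomogeneous _ _⟩
    · ext1 i j
      have : S j i = - S i j := congrFun (congrFun hS i) j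
      simp [this]
    · ext1 i
      rw [h1]
      simp [hk, Matrix.mulVec, dotProduct]
  · refine ⟨0, by simp, by rw [h0 (by omega), Matrix.zero_mulVec], fun i j => isHomogeneous_zero _ _ _⟩

def th (f : S4) : Fin 6 → Fin 4 → S4 := ![koszul f 0 1, koszul f 0 2, koszul f 0 3, koszul f 1 2, koszul f 1 3, koszul f 2 3]

theorem th_skew {f : S4} {S : Matrix (Fin 4) (Fin 4) S4} (hS : S.transpose = -S) :
    S.mulVec (fun i => pderiv i f) = ∑ k, (![S 0 1, S 0 2, S 0 3, S 1 2, S 1 3, S 2 3] k) • th f k := by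
  have hs : ∀ i j, S j i = - S i j := fun i j => congrFun (congrFun hS i) j
  have hz : ∀ i, S i i = 0 := fun i => self_eq_neg.1 (hs i i)
  rw [Fin.sum_univ_six]
  ext1 i
  fin_cases i <;> simp [Matrix.mulVec, dotProduct, Fin.sum_univ_four, th, koszul, hz, hs 0 1, hs 0 2, hs 0 3, hs 1 2, hs 1 3, hs 2 3]

theorem th_syz (f : S4) (k) : ∑ i, th f k i * pderiv i f = 0 := by
  fin_cases k <;> simp [th, koszul, Fin.sum_univ_four] <;> ring

theorem th_hom {f : S4} {d} (hf : f.IsHomogeneous d) (k i) : (th f k i).IsHomogeneous (d-1) := by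
  have h : ∀ i j l, (koszul f i j l).IsHomogeneous (d-1) := by
    intro i j l
    unfold koszul
    split_ifs
    · exact hf.pderiv
    · exact hf.pderiv.neg
    · exact isHomogeneous_zero _ _ _
  fin_cases k <;> exact h _ _ _

theorem pd_indep {f : S4} {d} (hd : 2 ≤ d) (hf : f.IsHomogeneous d)
    (HK : ∀ ρ : Fin 4 → S4, (∀ i, (ρ i).IsHomogeneous 0) → ∑ i, ρ i * pderiv i f = 0 → SK f ρ)
    (c : Fin 4 → ℂ) (h : ∑ i, C (c i) * pderiv i f = 0) : c = 0 := by
  have := (sk_hom hf (fun i => isHomogeneous_C _ _) (HK (fun i => C (c i)) (fun i => isHomogeneous_C _ _) h)).1 (by omega)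
  ext i
  simpa using congrFun this i

theorem th_indep {f : S4} {d} (hd : 2 ≤ d) (hf : f.IsHomogeneous d)
    (HK : ∀ ρ : Fin 4 → S4, (∀ i, (ρ i).IsHomogeneous 0) → ∑ i, ρ i * pderiv i f = 0 → SK f ρ) 
    (b : Fin 6 → ℂ) (h : ∑ k, b k • th f k = 0) : b = 0 := by
  rw [Fin.sum_univ_six] at h
  have h0 := pd_indep hd hf HK ![0, b 0, b 1, b 2] (by
    have := congrFun h 0
    simp [th, koszul, smul_eq_C_mul] at this
    rw [Fin.sum_univ_four, ← this]; simp)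
  have h1 := pd_indep hd hf HK ![-b 0, 0, b 3, b 4] (by
    have := congrFun h 1
    simp [th, koszul, smul_eq_C_mul] at this
    rw [Fin.sum_univ_four, ← this]; simp)
  have h2 := pd_indep hd hf HK ![-b 1, -b 3, 0, b 5] (by
    have := congrFun h 2
    simp [th, koszul, smul_eq_C_mul] at this
    rw [Fin.sum_univ_four, ← this]; simp)
  ext k
  have := congrFun h0 1
  have := congrFun h0 2
  have := congrFun h0 3
  have := congrFun h1 2
  have := congrFun h1 3
  have := congrFun h2 3
  fin_cases k <;> simp_all

variable {f : S4} {p q r : ℕ} {dd : Fin p → ℕ} {cc : Fin q → ℕ} {bb : Fin r → ℕ}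

theorem ker_cc (R : JacRes f dd cc bb) (hmin : R.Minimal) (c : Fin p → S4) (h : R.M1.mulVec c = 0) (a) :
    constantCoeff (c a) = 0 := by
  have h1 : c ∈ LinearMap.ker R.M1.mulVecLin := h
  rw [← R.ex1] at h1
  obtain ⟨w, rfl⟩ := h1
  simp only [Matrix.mulVecLin_apply, Matrix.mulVec, dotProduct, map_sum, map_mul, hmin.2.1, zero_mul, Finset.sum_const_zero]

theorem col_syz (R : JacRes f dd cc bb) (a) : ∑ i, R.M1 i a * pderiv i f = 0 := by
  have h1 : R.M1.mulVecLin (Pi.single a 1) ∈ LinearMap.ker (jacMap f) := R.ex0 ▸ ⟨_, rfl⟩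
  have h2 : R.M1.mulVecLin (Pi.single a 1) = fun i => R.M1 i a := by
    rw [Matrix.mulVecLin_apply, Matrix.mulVec_single_one]; rfl
  rw [h2] at h1
  exact h1

theorem dd_eq (R : JacRes f dd cc bb) (hmin : R.Minimal) {d N} (hf : f.IsHomogeneous d)
    (HK : ∀ k < N, ∀ ρ : Fin 4 → S4, (∀ i, (ρ i).IsHomogeneous k) → ∑ i, ρ i * pderiv i f = 0 → SK f ρ)
    (a) (ha : dd a < N) : dd a = d - 1 := by
  have hc : R.M1.mulVec (Pi.single a 1) = fun i => R.M1 i a := by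
    rw [Matrix.mulVec_single_one]; rfl
  obtain ⟨h1, S, hS, e, hh⟩ := sk_hom hf (fun i => R.hM1 i a) (HK _ ha (fun i => R.M1 i a) (fun i => R.hM1 i a) (col_syz R a))
  by_contra hne
  rcases Nat.lt_or_gt_of_ne hne with hl | hl
  · rw [← hc] at h1
    have := ker_cc R hmin _ (h1 hl) a
    simp at this
  · have ht : ∀ k, ∃ t, R.M1.mulVec t = th f k := by
      intro k
      have : th f k ∈ LinearMap.ker (jacMap f) := th_syz f k
      rw [← R.ex0] at this
      exact this
    choose t ht using ht
    rw [th_skew hS] at e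
    have hz : ∀ k, constantCoeff ((![S 0 1, S 0 2, S 0 3, S 1 2, S 1 3, S 2 3] : Fin 6 → S4) k) = 0 := by
      intro k
      fin_cases k <;> exact cc_hom (hh _ _) (by omega)
    have := ker_cc R hmin (Pi.single a 1 - ∑ k, ((![S 0 1, S 0 2, S 0 3, S 1 2, S 1 3, S 2 3] : Fin 6 → S4) k) • t k) (by
      rw [Matrix.mulVec_sub, hc, e, Matrix.mulVec_sum, sub_eq_zero]
      refine Finset.sum_congr rfl fun k _ => ?_
      rw [Matrix.mulVec_smul, ht]) a
    rw [Pi.sub_apply, Finset.sum_apply, map_sub, map_sum] at this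
    simp only [Pi.smul_apply, smul_eq_mul, map_mul, hz, zero_mul, Finset.sum_const_zero] at this
    simp at this

theorem card_six (R : JacRes f dd cc bb) (hmin : R.Minimal) {d N} (hd : 2 ≤ d) (hN : d - 1 < N) (hf : f.IsHomogeneous d)
    (HK : ∀ k < N, ∀ ρ : Fin 4 → S4, (∀ i, (ρ i).IsHomogeneous k) → ∑ i, ρ i * pderiv i f = 0 → SK f ρ) :
    (Finset.univ.filter fun a => dd a = d - 1).card = 6 := by
  let T := Fintype.linearCombination ℂ (th f)
  let L := Fintype.linearCombination ℂ (fun (a : {a // dd a = d - 1}) (i : Fin 4) => R.M1 i a)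
  have hT : Function.Injective T := by
    rw [injective_iff_map_eq_zero]
    intro b hb
    exact th_indep hd hf (HK 0 (by omega)) b hb
  have hL : Function.Injective L := by
    rw [injective_iff_map_eq_zero]
    intro b hb
    ext a
    have := ker_cc R hmin (fun a => if h : dd a = d - 1 then C (b ⟨a, h⟩) else 0) (by
      rw [← hb]
      ext1 i
      simp only [L, Fintype.linearCombination_apply, Finset.sum_apply, Matrix.mulVec, dotProduct, Pi.smul_apply]
      have h2 : ∀ a, R.M1 i a * (if h : dd a = d - 1 then C (b ⟨a, h⟩) else 0) =
          if h : dd a = d - 1 then b ⟨a, h⟩ • R.M1 i a else 0 := by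
        intro a
        split_ifs with h
        · rw [smul_eq_C_mul, mul_comm]
        · rw [mul_zero]
      simp only [h2]
      rw [Finset.sum_dite, Finset.sum_const_zero, add_zero]
      refine Finset.sum_bij (fun x _ => ⟨x.1, (Finset.mem_filter.1 x.2).2⟩) (fun _ _ => Finset.mem_univ _) ?_ ?_ ?_
      · intro x _ y _ h
        exact Subtype.ext (congrArg (fun z => z.1) h)
      · intro y _
        exact ⟨⟨y.1, Finset.mem_filter.2 ⟨Finset.mem_univ _, y.2⟩⟩, Finset.mem_attach _ _, rfl⟩
      · intro x _
        rfl) a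
    simpa [a.2] using this
  have hr : LinearMap.range T = LinearMap.range L := by
    apply le_antisymm
    · rintro _ ⟨b, rfl⟩
      rw [show T b = ∑ k, b k • th f k from rfl]
      refine Submodule.sum_mem _ fun k _ => Submodule.smul_mem _ _ ?_
      have : th f k ∈ LinearMap.ker (jacMap f) := th_syz f k
      rw [← R.ex0] at this
      obtain ⟨t, ht⟩ := this
      refine ⟨fun a => constantCoeff (t a.1), ?_⟩
      ext1 i
      have h1 := congrArg (homogeneousComponent (d-1)) (congrFun ht i)
      rw [hc_self (th_hom hf k i), Matrix.mulVecLin_apply, Matrix.mulVec, dotProduct, map_sum] at h1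
      rw [← h1]
      have h2 : ∀ a, homogeneousComponent (d-1) (R.M1 i a * t a) = if dd a = d - 1 then constantCoeff (t a) • R.M1 i a else 0 := by
        intro a
        rw [mul_comm, hc_eq (R.hM1 i a)]
        split_ifs with h3 h4 h4
        · rw [h4, Nat.sub_self, homogeneousComponent_zero, smul_eq_C_mul]; rfl
        · exact absurd (dd_eq R hmin hf HK a (by omega)) h4
        · omega
        · rfl
      simp only [h2]
      rw [← Finset.sum_filter]
      simp only [L, Fintype.linearCombination_apply, Finset.sum_apply, Pi.smul_apply]
      exact (Finset.sum_subtype _ (by simp) (fun a => constantCoeff (t a) • R.M1 i a)).symm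
    · rintro _ ⟨b, rfl⟩
      rw [show L b = ∑ a, b a • (fun i : Fin 4 => R.M1 i a.1) from rfl]
      refine Submodule.sum_mem _ fun a _ => Submodule.smul_mem _ _ ?_
      obtain ⟨h1, S, hS, e, hh⟩ := sk_hom hf (fun i => R.hM1 i a.1) (HK _ (by rw [a.2]; exact hN) (fun i => R.M1 i a) (fun i => R.hM1 i a) (col_syz R a))
      have h3 : ∀ i j, S i j = C (constantCoeff (S i j)) := by
        intro i j
        have := hh i j
        rw [a.2, Nat.sub_self] at this
        conv_lhs => rw [← hc_self this, homogeneousComponent_zero]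
        rfl
      refine ⟨fun k => constantCoeff ((![S 0 1, S 0 2, S 0 3, S 1 2, S 1 3, S 2 3] : Fin 6 → S4) k), ?_⟩
      rw [e, th_skew hS, show ∀ b, T b = ∑ k, b k • th f k from fun _ => rfl]
      refine Finset.sum_congr rfl fun k _ => ?_
      ext1 i
      rw [Pi.smul_apply, Pi.smul_apply, smul_eq_C_mul, smul_eq_mul]
      congr 1
      fin_cases k <;> exact (h3 _ _).symm
  have h1 := LinearMap.finrank_range_of_inj hT
  have h2 := LinearMap.finrank_range_of_inj hL
  rw [hr, h2] at h1
  simpa [Fintype.card_subtype] using h1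

end ge7
end NS

/-- Proposition propN: for a nodal surface `X : f = 0` of degree `d ≥ 5`,
`mdr(f) ≥ 2d − ⌊d/2⌋ − 3 > d − 1`, i.e. every homogeneous Jacobian syzygy of degree
`< 2d − ⌊d/2⌋ − 3` is of Koszul type; consequently in the minimal resolution one has `p ≥ 6`,
`dᵢ = d − 1` for `i = 1,…,6` and `dᵢ ≥ 2d − ⌊d/2⌋ − 3` for `i > 6`. -/
theorem stmt8 (f : S4) (d : ℕ) (hd : 5 ≤ d) (hhom : f.IsHomogeneous d) (hred : Squarefree f)
    (hiso : (singLocus f).Finite)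
    (hnodal : ∀ P ∈ singLocus f, (hessian f P.rep).rank = 3)
    (p q r : ℕ) (hp : 3 ≤ p)
    (dd : Fin p → ℕ) (cc : Fin q → ℕ) (bb : Fin r → ℕ)
    (hddpos : ∀ i, 0 < dd i) (hccpos : ∀ j, 0 < cc j) (hbbpos : ∀ k, 0 < bb k)
    (hddmono : Monotone dd) (hccmono : Monotone cc) (hbbmono : Monotone bb)
    (R : JacRes f dd cc bb) (hmin : R.Minimal) :
    d - 1 < 2 * d - d / 2 - 3 ∧
    (∀ k : ℕ, k < 2 * d - d / 2 - 3 → ∀ ρ : Fin 4 → S4, isSyzygy f ρ →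
      (∀ i, (ρ i).IsHomogeneous k) → ρ ∈ KR f) ∧
    6 ≤ p ∧
    (∀ i : Fin p, ((i : ℕ) < 6 → dd i = d - 1) ∧ (6 ≤ (i : ℕ) → 2 * d - d / 2 - 3 ≤ dd i)) := by
  obtain ⟨ℓ, H, hℓ⟩ := NS.exists_good hd hhom hiso hnodal
  have hN : d - 1 < 2 * d - d / 2 - 3 := by omega
  have HK : ∀ k < 2 * d - d / 2 - 3, ∀ ρ : Fin 4 → S4, (∀ i, (ρ i).IsHomogeneous k) →
      ∑ i, ρ i * pderiv i f = 0 → NS.SK f ρ := fun k hk ρ hρ hs =>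
    H.toSK (by omega) (by omega) hℓ hρ hs
  have h6 := NS.card_six R hmin (by omega) hN hhom HK
  have hdd := NS.dd_eq R hmin hhom HK
  refine ⟨hN, fun k hk ρ hs hρ => (HK k hk ρ hρ hs).KR, ?_, fun i => ⟨fun hi => ?_, fun hi => ?_⟩⟩
  · rw [← h6]
    simpa using Finset.card_le_univ (Finset.univ.filter fun a => dd a = d - 1)
  · by_contra hne
    have h1 : (Finset.univ.filter fun a => dd a = d - 1) ⊆ Finset.Iio i := by
      intro a ha
      rw [Finset.mem_filter] at ha
      rw [Finset.mem_Iio]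
      by_contra hc
      have h2 := hddmono (not_lt.1 hc)
      exact hne (hdd i (by omega))
    have h3 := Finset.card_le_card h1
    rw [h6, Fin.card_Iio] at h3
    omega
  · by_contra hne
    have h1 : Finset.Iic i ⊆ (Finset.univ.filter fun a => dd a = d - 1) := by
      intro a ha
      rw [Finset.mem_Iic] at ha
      have h2 := hddmono ha
      exact Finset.mem_filter.2 ⟨Finset.mem_univ _, hdd a (by omega)⟩
    have h3 := Finset.card_le_card h1
    rw [h6, Fin.card_Iic] at h3
    omega
end
end

section
/- Let g, h ∈ ℂ[x,y,z,t] be homogeneous of the same degree k ≥ 2, and assume the base locus B = {g = h = 0} ⊂ P³ of the pencil αg + βh is a reduced curve (the subscheme of P³ defined by the ideal (g,h) is reduced and of pure dimension 1). For each variable v ∈ {x,y,z,t} set ω^v = dv ∧ dg ∧ dh. If c^x·ω^x + c^y·ω^y + c^z·ω^z + c^t·ω^t = 0 for complex numbers c^x, c^y, c^z, c^t not all zero (equivalently, all 3×3 minors of the 3×4 Jacobian matrix of (ℓ, g, h) vanish identically, where ℓ = c^x x + c^y y + c^z z + c^t t), then B is contained in the plane H : ℓ = 0. In particular, the differential 3-forms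 ω^x, ω^y, ω^z, ω^t span a ℂ-vector space of dimension 3 or 4. -/
open MvPolynomial

noncomputable section

/-- The `3 × 4` Jacobian matrix of three polynomials. -/
def jac3 (a b c : S4) : Matrix (Fin 3) (Fin 4) S4 :=
  Matrix.of ![fun v => pderiv v a, fun v => pderiv v b, fun v => pderiv v c]

/-- The coordinates of the differential 3-form `da ∧ db ∧ dc`, identified with a quadruple of
polynomials: the signed `3 × 3` minors of the Jacobian matrix of `(a, b, c)`. -/
def wedge3 (a b c : S4) : Fin 4 → S4 :=
  fun i => (-1 : S4) ^ (i : ℕ) * ((jac3 a b c).submatrix id i.succAbove).det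

lemma aux_dim (P : Ideal S4) [P.IsPrime] (hP : ringKrullDim (S4 ⧸ P) = 2) :
    ∃ s : ℕ, s ≤ 2 ∧ ∃ ψ : MvPolynomial (Fin s) ℂ →ₐ[ℂ] S4, (∀ p, ψ p ∈ P → p = 0) ∧
      ∀ a : S4, ∃ q : Polynomial (MvPolynomial (Fin s) ℂ), q ≠ 0 ∧
        Polynomial.eval₂ (ψ : MvPolynomial (Fin s) ℂ →+* S4) a q ∈ P := by
  obtain ⟨s, f, hinj, hint⟩ := exists_integral_inj_algHom_of_fg ℂ (S4 ⧸ P)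
  have hsurj : ∀ i : Fin s, ∃ y : S4, Ideal.Quotient.mk P y = f (X i) :=
    fun i => Ideal.Quotient.mk_surjective _
  choose y hy using hsurj
  have hcomp : ∀ p, Ideal.Quotient.mk P (aeval y p) = f p := by
    have : (Ideal.Quotient.mkₐ ℂ P).comp (aeval y) = f := by
      ext i
      simp [hy]
    intro p
    rw [← this]; simp
  refine ⟨s, ?_, aeval y, ?_, ?_⟩
  · have h1 : ringKrullDim (MvPolynomial (Fin s) ℂ) ≤ ringKrullDim (S4 ⧸ P) := by
      algebraize [f.toRingHom]
      have hf : FaithfulSMul (MvPolynomial (Fin s) ℂ) (S4 ⧸ P) :=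
        (faithfulSMul_iff_algebraMap_injective _ _).mpr hinj
      refine iSup_le fun l => ?_
      obtain ⟨Q, hQ⟩ := Algebra.IsIntegral.comap_surjective (MvPolynomial (Fin s) ℂ) (S4 ⧸ P) l.head
      have : Q.asIdeal.LiesOver (RelSeries.head l).asIdeal := ⟨by rw [← hQ]; rfl⟩
      obtain ⟨L, hL, -⟩ := Ideal.exists_ltSeries_of_hasGoingUp l Q.asIdeal
      rw [← hL]
      exact Order.LTSeries.length_le_krullDim L
    rw [MvPolynomial.ringKrullDim_of_isNoetherianRing, hP] at h1
    simp at h1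
    exact_mod_cast h1
  · intro p hp
    rw [← Ideal.Quotient.eq_zero_iff_mem, hcomp] at hp
    exact hinj (by rw [hp, map_zero])
  · intro a
    obtain ⟨q, hq, hqa⟩ := hint (Ideal.Quotient.mk P a)
    refine ⟨q, hq.ne_zero, ?_⟩
    rw [← Ideal.Quotient.eq_zero_iff_mem, Polynomial.hom_eval₂, ← hqa]
    congr 1
    ext x
    · simp
      rfl
    · simp [hy]

/-- directional derivative with values in a field -/
def dd {K : Type*} [Field K] (φ : S4 →+* K) (v : Fin 4 → K) (f : S4) : K :=
  ∑ i, φ (pderiv i f) * v i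

section
variable {K : Type*} [Field K] (φ : S4 →+* K) (v : Fin 4 → K)

lemma dd_add (f g : S4) : dd φ v (f + g) = dd φ v f + dd φ v g := by
  simp [dd, add_mul, Finset.sum_add_distrib]

lemma dd_C (c : ℂ) : dd φ v (C c) = 0 := by
  simp [dd]

lemma dd_X (i : Fin 4) : dd φ v (X i) = v i := by
  simp [dd, pderiv_X, Pi.single_apply, apply_ite φ]

lemma dd_mul (f g : S4) : dd φ v (f * g) = φ f * dd φ v g + φ g * dd φ v f := by
  simp only [dd, pderiv_mul, map_add, map_mul, Finset.mul_sum, ← Finset.sum_add_distrib]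
  refine Finset.sum_congr rfl fun i _ => ?_
  ring

lemma dd_comp {s : ℕ} (ψ : MvPolynomial (Fin s) ℂ →ₐ[ℂ] S4)
    (h0 : ∀ i, dd φ v (ψ (X i)) = 0) (p) : dd φ v (ψ p) = 0 := by
  induction p using MvPolynomial.induction_on with
  | C a =>
    have : ψ (C a) = C a := by
      rw [← MvPolynomial.algebraMap_eq, AlgHom.commutes, MvPolynomial.algebraMap_eq]
    rw [this, dd_C]
  | add p q hp hq => rw [map_add, dd_add, hp, hq, add_zero]
  | mul_X p i hp => rw [map_mul, dd_mul, hp, h0]; simp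

lemma dd_eval₂ {s : ℕ} (ψ : MvPolynomial (Fin s) ℂ →ₐ[ℂ] S4)
    (h0 : ∀ i, dd φ v (ψ (X i)) = 0) (a : S4) (q : Polynomial (MvPolynomial (Fin s) ℂ)) :
    dd φ v (q.eval₂ (ψ : MvPolynomial (Fin s) ℂ →+* S4) a) =
      φ (q.derivative.eval₂ (ψ : MvPolynomial (Fin s) ℂ →+* S4) a) * dd φ v a := by
  induction q using Polynomial.induction_on with
  | C b => simp [dd_comp φ v ψ h0]
  | add p q hp hq => simp [Polynomial.eval₂_add, dd_add, hp, hq, add_mul]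
  | monomial n b ih =>
    have e : (Polynomial.C b * Polynomial.X ^ (n+1) : Polynomial (MvPolynomial (Fin s) ℂ))
      = (Polynomial.C b * Polynomial.X ^ n) * Polynomial.X := by ring
    rw [e, Polynomial.eval₂_mul_X, dd_mul, ih,
      Polynomial.derivative_mul (g := Polynomial.X), Polynomial.derivative_X,
      mul_one, Polynomial.eval₂_add, Polynomial.eval₂_mul_X, map_add, map_mul φ]
    ring

lemma dd_zero_of_alg {s : ℕ} (ψ : MvPolynomial (Fin s) ℂ →ₐ[ℂ] S4)
    (h0 : ∀ i, dd φ v (ψ (X i)) = 0) (hψ : ∀ p, φ (ψ p) = 0 → p = 0)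
    (hv : ∀ f, φ f = 0 → dd φ v f = 0) (a : S4) (n : ℕ) :
    ∀ q : Polynomial (MvPolynomial (Fin s) ℂ), q.natDegree = n → q ≠ 0 →
      φ (q.eval₂ (ψ : MvPolynomial (Fin s) ℂ →+* S4) a) = 0 → dd φ v a = 0 := by
  induction n using Nat.strong_induction_on with
  | _ n ih =>
    intro q hn hq hqa
    by_cases hd : q.natDegree = 0
    · obtain ⟨c, rfl⟩ := Polynomial.natDegree_eq_zero.mp hd
      rw [Polynomial.eval₂_C] at hqa
      exact absurd (hψ c hqa) (by simpa using hq)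
    · have h1 := hv _ hqa
      rw [dd_eval₂ φ v ψ h0] at h1
      rcases mul_eq_zero.mp h1 with h2 | h2
      · refine ih q.derivative.natDegree ?_ _ rfl ?_ h2
        · rw [← hn]; exact Polynomial.natDegree_derivative_lt hd
        · intro h; exact hd (Polynomial.derivative_eq_zero.mp h)
      · exact h2

end

lemma exists_mul_mem (I P : Ideal S4) (hI : I.IsRadical) (hP : P ∈ I.minimalPrimes) (x : S4)
    (hx : x ∈ P) : ∃ u ∉ P, x * u ∈ I := by
  have hPp : P.IsPrime := hP.1.1
  have h := IsLocalization.AtPrime.radical_map_of_mem_minimalPrimes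
    (A := Localization.AtPrime P) P I hP
  have hx' : algebraMap S4 (Localization.AtPrime P) x ∈
      (I.map (algebraMap S4 (Localization.AtPrime P))).radical := by
    rw [h]; exact Ideal.mem_map_of_mem _ hx
  obtain ⟨n, hn⟩ := hx'
  rw [← map_pow, IsLocalization.algebraMap_mem_map_algebraMap_iff P.primeCompl] at hn
  obtain ⟨m, hm, hmn⟩ := hn
  refine ⟨m, hm, hI ⟨n + 1, ?_⟩⟩
  have : (x * m) ^ (n + 1) = (m * x ^ n) * (x * m ^ n) := by ring
  rw [this]
  exact I.mul_mem_right _ hmn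

lemma exists_field (P : Ideal S4) [P.IsPrime] :
    ∃ (K : Type) (_ : Field K) (φ : S4 →+* K), ∀ f, φ f = 0 ↔ f ∈ P := by
  refine ⟨FractionRing (S4 ⧸ P), inferInstance,
    (algebraMap (S4 ⧸ P) (FractionRing (S4 ⧸ P))).comp (Ideal.Quotient.mk P), fun f => ?_⟩
  rw [← Ideal.Quotient.eq_zero_iff_mem]
  exact map_eq_zero_iff (algebraMap (S4 ⧸ P) (FractionRing (S4 ⧸ P)))
    (IsFractionRing.injective (S4 ⧸ P) (FractionRing (S4 ⧸ P)))

lemma exists_minor (g h : S4) (hrad : (Ideal.span {g, h} : Ideal S4).IsRadical)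
    (P : Ideal S4) (hP : P ∈ (Ideal.span {g, h} : Ideal S4).minimalPrimes)
    (hdim : ringKrullDim (S4 ⧸ P) = 2) :
    ∃ a b, pderiv a g * pderiv b h - pderiv b g * pderiv a h ∉ P := by
  by_contra! hcon
  have hPp : P.IsPrime := hP.1.1
  obtain ⟨s, hs, ψ, hψ, halg⟩ := aux_dim P hdim
  obtain ⟨K, hK, φ, hφ⟩ := exists_field P
  have hgP : φ g = 0 := (hφ g).2 (hP.1.2 (Ideal.subset_span (by simp)))
  have hhP : φ h = 0 := (hφ h).2 (hP.1.2 (Ideal.subset_span (by simp)))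
  have hmin : ∀ a b, φ (pderiv a g) * φ (pderiv b h) = φ (pderiv b g) * φ (pderiv a h) := by
    intro a b
    have := (hφ _).2 (hcon a b)
    rw [map_sub, map_mul, map_mul] at this
    exact sub_eq_zero.mp this
  -- functional
  obtain ⟨w, hw⟩ : ∃ w : Fin 4 → K, ∀ v : Fin 4 → K, (∑ i, w i * v i = 0) →
      dd φ v g = 0 ∧ dd φ v h = 0 := by
    by_cases h0 : ∀ i, φ (pderiv i g) = 0
    · refine ⟨fun i => φ (pderiv i h), fun v hv => ⟨?_, hv⟩⟩
      simp [dd, h0]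
    · push Not at h0
      obtain ⟨a, ha⟩ := h0
      refine ⟨fun i => φ (pderiv i g), fun v hv => ⟨hv, ?_⟩⟩
      have : φ (pderiv a g) * dd φ v h = φ (pderiv a h) * ∑ i, φ (pderiv i g) * v i := by
        simp only [dd, Finset.mul_sum]
        refine Finset.sum_congr rfl fun i _ => ?_
        rw [← mul_assoc, hmin a i]; ring
      rw [hv, mul_zero] at this
      exact (mul_eq_zero.mp this).resolve_left ha
  -- linear map K^4 → K × K^s is injective
  let T : (Fin 4 → K) →ₗ[K] K × (Fin s → K) :=
    { toFun := fun v => (∑ i, w i * v i, fun j => dd φ v (ψ (X j)))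
      map_add' := fun x y => by
        ext <;> simp [dd, mul_add, Finset.sum_add_distrib]
      map_smul' := fun c x => by
        ext <;> simp [dd, Finset.mul_sum, mul_left_comm] }
  have hT : Function.Injective T := by
    rw [← LinearMap.ker_eq_bot, LinearMap.ker_eq_bot']
    intro v hv
    have hv1 : ∑ i, w i * v i = 0 := congrArg Prod.fst hv
    have hv2 : ∀ j, dd φ v (ψ (X j)) = 0 := fun j => congrFun (congrArg Prod.snd hv) j
    obtain ⟨hg0, hh0⟩ := hw v hv1
    have hkill : ∀ f, φ f = 0 → dd φ v f = 0 := by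
      intro f hf
      obtain ⟨u, hu, hfu⟩ := exists_mul_mem _ P hrad hP f ((hφ f).1 hf)
      obtain ⟨a, b, hab⟩ := Ideal.mem_span_pair.mp hfu
      have h1 := congrArg (dd φ v) hab
      rw [dd_add, dd_mul, dd_mul, dd_mul, hg0, hh0, hgP, hhP, hf] at h1
      simp only [mul_zero, zero_mul, add_zero, zero_add] at h1
      exact (mul_eq_zero.mp h1.symm).resolve_left (fun h => hu ((hφ u).1 h))
    ext i
    obtain ⟨q, hq, hqa⟩ := halg (X i)
    rw [← dd_X φ v i]
    exact dd_zero_of_alg φ v ψ hv2 (fun p hp => hψ p ((hφ _).1 hp)) hkill (X i) _ q rfl hq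
      ((hφ _).2 hqa)
  have := LinearMap.finrank_le_finrank_of_injective hT
  simp at this
  omega

lemma ell_mul_minor (g h : S4) (k : ℕ)
    (hg : g.IsHomogeneous k) (hh : h.IsHomogeneous k) (c : Fin 4 → ℂ)
    (hc : ∀ i, (∑ v, MvPolynomial.C (c v) * wedge3 (X v) g h i) = 0) (a b : Fin 4) :
    (∑ v, C (c v) * X v) * (pderiv a g * pderiv b h - pderiv b g * pderiv a h) ∈
      (Ideal.span {g, h} : Ideal S4) := by
  have key : ∀ a b m : Fin 4,
      C (c a) * (pderiv b g * pderiv m h - pderiv m g * pderiv b h)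
      - C (c b) * (pderiv a g * pderiv m h - pderiv m g * pderiv a h)
      + C (c m) * (pderiv a g * pderiv b h - pderiv b g * pderiv a h) = 0 := by
    have s00 : Fin.succAbove (0 : Fin 4) (0 : Fin 3) = 1 := rfl
    have s01 : Fin.succAbove (0 : Fin 4) (1 : Fin 3) = 2 := rfl
    have s02 : Fin.succAbove (0 : Fin 4) (2 : Fin 3) = 3 := rfl
    have s10 : Fin.succAbove (1 : Fin 4) (0 : Fin 3) = 0 := rfl
    have s11 : Fin.succAbove (1 : Fin 4) (1 : Fin 3) = 2 := rfl
    have s12 : Fin.succAbove (1 : Fin 4) (2 : Fin 3) = 3 := rfl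
    have s20 : Fin.succAbove (2 : Fin 4) (0 : Fin 3) = 0 := rfl
    have s21 : Fin.succAbove (2 : Fin 4) (1 : Fin 3) = 1 := rfl
    have s22 : Fin.succAbove (2 : Fin 4) (2 : Fin 3) = 3 := rfl
    have s30 : Fin.succAbove (3 : Fin 4) (0 : Fin 3) = 0 := rfl
    have s31 : Fin.succAbove (3 : Fin 4) (1 : Fin 3) = 1 := rfl
    have s32 : Fin.succAbove (3 : Fin 4) (2 : Fin 3) = 2 := rfl
    have h0 := hc 0
    have h1 := hc 1
    have h2 := hc 2
    have h3 := hc 3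
    simp [Fin.sum_univ_four, wedge3, jac3, Matrix.det_fin_three, pderiv_X, Pi.single_apply,
      s00, s01, s02, s10, s11, s12, s20, s21, s22, s30, s31, s32] at h0 h1 h2 h3
    intro a b m
    fin_cases a <;> fin_cases b <;> fin_cases m <;> simp only [Fin.zero_eta, Fin.mk_one, Fin.reduceFinMk] <;>
    first
    | ring1
    | linear_combination h0
    | linear_combination -h0
    | linear_combination h1
    | linear_combination -h1
    | linear_combination h2
    | linear_combination -h2
    | linear_combination h3
    | linear_combination -h3
  have eg := hg.sum_X_mul_pderiv
  have eh := hh.sum_X_mul_pderiv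
  rw [nsmul_eq_mul] at eg eh
  have K0 := key a b 0
  have K1 := key a b 1
  have K2 := key a b 2
  have K3 := key a b 3
  rw [Fin.sum_univ_four] at eg eh ⊢
  refine Ideal.mem_span_pair.mpr ⟨(k : S4) * (C (c a) * pderiv b h - C (c b) * pderiv a h),
    - (k : S4) * (C (c a) * pderiv b g - C (c b) * pderiv a g), ?_⟩
  linear_combination (-(C (c a) * pderiv b h - C (c b) * pderiv a h)) * eg
    + (C (c a) * pderiv b g - C (c b) * pderiv a g) * eh
    - X 0 * K0 - X 1 * K1 - X 2 * K2 - X 3 * K3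

lemma ell_mem (g h : S4) (k : ℕ)
    (hg : g.IsHomogeneous k) (hh : h.IsHomogeneous k)
    (hrad : (Ideal.span {g, h} : Ideal S4).IsRadical)
    (hcurve : ∀ P ∈ (Ideal.span {g, h} : Ideal S4).minimalPrimes,
      ringKrullDim (S4 ⧸ P) = 2) (c : Fin 4 → ℂ)
    (hc : ∀ i, (∑ v, MvPolynomial.C (c v) * wedge3 (X v) g h i) = 0) :
    (∑ v, C (c v) * X v) ∈ (Ideal.span {g, h} : Ideal S4) := by
  rw [← hrad.radical, ← Ideal.sInf_minimalPrimes, Submodule.mem_sInf]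
  intro P hP
  obtain ⟨a, b, hab⟩ := exists_minor g h hrad P hP (hcurve P hP)
  exact (hP.1.1.mem_or_mem (hP.1.2 (ell_mul_minor g h k hg hh c hc a b))).resolve_right hab

lemma eval_zero_homog (g : S4) (k : ℕ) (hk : 1 ≤ k) (hg : g.IsHomogeneous k) :
    eval (0 : Fin 4 → ℂ) g = 0 := by
  rw [MvPolynomial.eval_zero]
  exact hg.coeff_eq_zero (by simp; omega)

lemma ell_zero (g h : S4) (k : ℕ) (hk : 2 ≤ k)
    (hg : g.IsHomogeneous k) (hh : h.IsHomogeneous k) (c : Fin 4 → ℂ)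
    (hc : (∑ v, C (c v) * X v) ∈ (Ideal.span {g, h} : Ideal S4)) : c = 0 := by
  obtain ⟨a, b, hab⟩ := Ideal.mem_span_pair.mp hc
  ext i
  have h1 := congrArg (fun f => eval (0 : Fin 4 → ℂ) (pderiv i f)) hab
  simp only [map_add, pderiv_mul, map_mul] at h1
  rw [eval_zero_homog g k (by omega) hg, eval_zero_homog h k (by omega) hh,
    eval_zero_homog _ (k-1) (by omega) hg.pderiv, eval_zero_homog _ (k-1) (by omega) hh.pderiv] at h1
  simp [pderiv_X, Pi.single_apply] at h1
  simpa using h1.symm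

/-- Theorem thmPPP: let the base locus `B : g = h = 0` of the pencil be a
reduced curve. If `cˣωˣ + cʸωʸ + cᶻωᶻ + cᵗωᵗ = 0` with the `cᵛ` not all zero, where
`ωᵛ = dv ∧ dg ∧ dh`, then `B` is contained in the plane `ℓ = Σ cᵛ v = 0`. In particular the
forms `ωˣ, ωʸ, ωᶻ, ωᵗ` span a vector space of dimension `3` or `4`. -/
theorem stmt9 (g h : S4) (k : ℕ) (hk : 2 ≤ k)
    (hg : g.IsHomogeneous k) (hh : h.IsHomogeneous k)
    (hrad : (Ideal.span {g, h} : Ideal S4).IsRadical)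
    (hcurve : ∀ P ∈ (Ideal.span {g, h} : Ideal S4).minimalPrimes,
      ringKrullDim (S4 ⧸ P) = 2) :
    (∀ c : Fin 4 → ℂ, c ≠ 0 →
      (∀ i, (∑ v, MvPolynomial.C (c v) * wedge3 (X v) g h i) = 0) →
      ∀ P : Projectivization ℂ (Fin 4 → ℂ), eval P.rep g = 0 → eval P.rep h = 0 →
        (∑ v, c v * P.rep v) = 0) ∧
    3 ≤ Module.finrank ℂ
        (Submodule.span ℂ (Set.range fun v : Fin 4 => wedge3 (X v) g h)) ∧
    Module.finrank ℂ
        (Submodule.span ℂ (Set.range fun v : Fin 4 => wedge3 (X v) g h)) ≤ 4 := by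
  refine ⟨fun c _ hc P hgP hhP => ?_, ?_⟩
  · obtain ⟨a, b, hab⟩ := Ideal.mem_span_pair.mp (ell_mem g h k hg hh hrad hcurve c hc)
    have h1 := congrArg (eval P.rep) hab
    simp only [map_add, map_mul, hgP, hhP, mul_zero, add_zero, map_sum, eval_C, eval_X] at h1
    exact h1.symm
  · have hli : LinearIndependent ℂ (fun v : Fin 4 => wedge3 (X v) g h) := by
      rw [Fintype.linearIndependent_iff]
      intro c hc i
      refine congrFun (ell_zero g h k hk hg hh c
        (ell_mem g h k hg hh hrad hcurve c fun j => ?_)) i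
      have := congrFun hc j
      simpa [MvPolynomial.smul_eq_C_mul] using this
    rw [finrank_span_eq_card hli]
    simp
end
end

section
/- Let X : f = 0 be a reduced surface of degree d ≥ 3 in P³ whose Jacobian algebra M(f) admits a graded free resolution 0 → ⊕_{k=1}^{r} S(1−d−b_k) → ⊕_{j=1}^{q} S(1−d−c_j) → ⊕_{i=1}^{p} S(1−d−d_i) → S(1−d)^4 → S → M(f) → 0. Then for every sufficiently large integer s one has 6·dim_ℂ M(f)_{s+d−1} = (p − q + r − 3)s³ + 3(d − 1 − d_1 − d_2 − d_3 − Σ_{i=4}^{p}(d_i − 2) + Σ_{j=1}^{q}(c_j − 2) − Σ_{k=1}^{r}(b_k − 2))s² + (3d² + 6d + 2 − 44 + Σ_{i=1}^{p}(3d_i² − 12d_i + 11) − Σ_{j=1}^{q}(3c_j² − 12c_j + 11) + Σ_{k=1}^{r}(3b_k² − 12b_k + 11))s + d³ + 3d² + 2d − 24 − Σ_{i=1}^{p}(d_i³ − 6d_i² + 11d_i − 6) + Σ_{j=1}^{q}(c_j³ − 6c_j² + 11c_j − 6) − Σ_{k=1}^{r}(b_k³ − 6b_k² + 11b_k − 6).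 -/
open MvPolynomial

noncomputable section

lemma hc_mul {g : S4} {a : ℕ} (hg : g.IsHomogeneous a) (k : ℕ) (h : S4) :
    homogeneousComponent (a + k) (g * h) = g * homogeneousComponent k h := by
  conv_lhs => rw [← sum_homogeneousComponent h, Finset.mul_sum, map_sum]
  have : ∀ i ∈ Finset.range (h.totalDegree + 1),
      homogeneousComponent (a + k) (g * homogeneousComponent i h) =
        if k = i then g * homogeneousComponent i h else 0 := by
    intro i _
    rw [homogeneousComponent_of_mem (hg.mul (homogeneousComponent_isHomogeneous i h))]
    simp
  rw [Finset.sum_congr rfl this, Finset.sum_ite_eq]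
  split_ifs with hk
  · rfl
  · rw [homogeneousComponent_eq_zero, mul_zero]
    simpa using hk

lemma hc_mulZ {g : S4} {e e' N : ℕ} (hg : HomogZ g ((e' : ℤ) - (e : ℤ))) (hN : e' ≤ N) (h : S4) :
    homogeneousComponent (N - e) (g * h) = g * homogeneousComponent (N - e') h := by
  rcases hg with rfl | ⟨h0, hg⟩
  · simp
  · rw [← hc_mul hg]
    congr 2
    omega

/-- graded piece of a free module -/
def GP {n : ℕ} (e : Fin n → ℕ) (N : ℕ) : Submodule ℂ (Fin n → S4) :=
  Submodule.pi Set.univ (fun i => homogeneousSubmodule (Fin 4) ℂ (N - e i))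

lemma finrank_hom (n : ℕ) :
    Module.finrank ℂ (homogeneousSubmodule (Fin 4) ℂ n) = (n + 3).choose 3 := by
  have e : homogeneousSubmodule (Fin 4) ℂ n ≃ₗ[ℂ] ({d : Fin 4 →₀ ℕ // d.degree = n} →₀ ℂ) := by
    rw [homogeneousSubmodule_eq_finsupp_supported]
    exact AddMonoidAlgebra.supportedEquivFinsupp {d : Fin 4 →₀ ℕ | d.degree = n}
  have e2 : {d : Fin 4 →₀ ℕ // d.degree = n} ≃ Sym (Fin 4) n :=
    (Equiv.subtypeEquivRight (fun d => by
      rw [Finsupp.degree_apply]; rfl)).trans (Sym.equivNatSum (Fin 4) n).symm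
  have : Fintype {d : Fin 4 →₀ ℕ // d.degree = n} := Fintype.ofEquiv _ e2.symm
  rw [e.finrank_eq, Module.finrank_finsupp_self, Fintype.card_congr e2,
    Sym.card_sym_eq_choose, Fintype.card_fin]
  have : 4 + n - 1 = n + 3 := by omega
  rw [this, ← Nat.choose_symm_add]

instance fin_hom (n : ℕ) : Module.Finite ℂ (homogeneousSubmodule (Fin 4) ℂ n) :=
  Module.finite_of_finrank_pos (by rw [finrank_hom]; exact Nat.choose_pos (by omega))

def GPequiv {n : ℕ} (e : Fin n → ℕ) (N : ℕ) :
    GP e N ≃ₗ[ℂ] ((i : Fin n) → homogeneousSubmodule (Fin 4) ℂ (N - e i)) where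
  toFun v i := ⟨v.1 i, v.2 i trivial⟩
  map_add' _ _ := rfl
  map_smul' _ _ := rfl
  invFun w := ⟨fun i => (w i).1, fun i _ => (w i).2⟩
  left_inv _ := rfl
  right_inv _ := rfl

instance fin_GP {n : ℕ} (e : Fin n → ℕ) (N : ℕ) : Module.Finite ℂ (GP e N) :=
  Module.Finite.equiv (GPequiv e N).symm

lemma finrank_GP {n : ℕ} (e : Fin n → ℕ) (N : ℕ) :
    Module.finrank ℂ (GP e N) = ∑ i, (N - e i + 3).choose 3 := by
  rw [(GPequiv e N).finrank_eq, Module.finrank_pi_fintype]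
  simp_rw [finrank_hom]

lemma abs_rank {V W : Type*} [AddCommGroup V] [Module ℂ V] [AddCommGroup W] [Module ℂ W]
    (L : V →ₗ[ℂ] W) (U : Submodule ℂ V) (U' : Submodule ℂ W) [Module.Finite ℂ U]
    (P : V → V) (Q : W → W) (hP : ∀ v, P v ∈ U) (hPU : ∀ v ∈ U, P v = v)
    (hQ : ∀ v, Q v ∈ U') (hQU : ∀ w ∈ U', Q w = w)
    (hc : ∀ v, Q (L v) = L (P v)) :
    Module.finrank ℂ U = Module.finrank ℂ (U ⊓ LinearMap.ker L : Submodule ℂ V)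
      + Module.finrank ℂ (U' ⊓ LinearMap.range L : Submodule ℂ W) := by
  have h1 : U.map L = U' ⊓ LinearMap.range L := by
    ext w
    constructor
    · rintro ⟨u, hu, rfl⟩
      refine ⟨?_, u, rfl⟩
      have := hc u
      rw [hPU u hu] at this
      rw [← this]; exact hQ _
    · rintro ⟨hw, v, rfl⟩
      refine ⟨P v, hP v, ?_⟩
      rw [← hc, hQU _ hw]
  have h2 : Module.finrank ℂ (LinearMap.ker (L.domRestrict U)) =
      Module.finrank ℂ (U ⊓ LinearMap.ker L : Submodule ℂ V) := by
    rw [LinearMap.ker_domRestrict, ← Submodule.finrank_map_subtype_eq,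
      Submodule.map_comap_subtype]
  have h3 := LinearMap.finrank_range_add_finrank_ker (L.domRestrict U)
  rw [LinearMap.range_domRestrict, h1, h2] at h3
  omega

def PP {n : ℕ} (e : Fin n → ℕ) (N : ℕ) (v : Fin n → S4) : Fin n → S4 :=
  fun i => homogeneousComponent (N - e i) (v i)

lemma PP_mem {n : ℕ} (e : Fin n → ℕ) (N : ℕ) (v : Fin n → S4) : PP e N v ∈ GP e N :=
  fun _ _ => homogeneousComponent_mem _ _

lemma PP_self {n : ℕ} (e : Fin n → ℕ) (N : ℕ) (v : Fin n → S4) (hv : v ∈ GP e N) :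
    PP e N v = v :=
  funext fun i => homogeneousComponent_eq_self (hv i trivial)

lemma mat_rank {m n : ℕ} (M : Matrix (Fin m) (Fin n) S4) (e : Fin m → ℕ) (e' : Fin n → ℕ) (N : ℕ)
    (hM : ∀ i j, HomogZ (M i j) ((e' j : ℤ) - (e i : ℤ))) (hN : ∀ j, e' j ≤ N) :
    ∑ j, (N - e' j + 3).choose 3 =
      Module.finrank ℂ (GP e' N ⊓ (LinearMap.ker M.mulVecLin).restrictScalars ℂ : Submodule ℂ _)
      + Module.finrank ℂ
        (GP e N ⊓ (LinearMap.range M.mulVecLin).restrictScalars ℂ : Submodule ℂ _) := by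
  rw [← finrank_GP]
  refine abs_rank (M.mulVecLin.restrictScalars ℂ) (GP e' N) (GP e N) (PP e' N) (PP e N)
    (PP_mem _ _) (PP_self _ _) (PP_mem _ _) (PP_self _ _) ?_
  intro v
  funext i
  simp only [PP, LinearMap.coe_restrictScalars, Matrix.mulVecLin_apply, Matrix.mulVec, dotProduct,
    map_sum]
  exact Finset.sum_congr rfl fun j _ => hc_mulZ (hM i j) (hN j) _

lemma jac_rank (f : S4) (d : ℕ) (hd : 1 ≤ d) (hhom : f.IsHomogeneous d) (s : ℕ) :
    ∑ _j : Fin 4, (s - 0 + 3).choose 3 =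
      Module.finrank ℂ (GP (fun _ : Fin 4 => 0) s ⊓
        (LinearMap.ker (jacMap f)).restrictScalars ℂ : Submodule ℂ _)
      + Module.finrank ℂ (homogeneousSubmodule (Fin 4) ℂ (s + d - 1) ⊓
        (LinearMap.range (jacMap f)).restrictScalars ℂ : Submodule ℂ _) := by
  rw [← finrank_GP (fun _ : Fin 4 => 0) s]
  refine abs_rank ((jacMap f).restrictScalars ℂ) (GP (fun _ : Fin 4 => 0) s)
    (homogeneousSubmodule (Fin 4) ℂ (s + d - 1)) (PP _ s) (homogeneousComponent (s + d - 1))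
    (PP_mem _ _) (PP_self _ _) (homogeneousComponent_mem _)
    (fun w hw => homogeneousComponent_eq_self hw) ?_
  intro v
  simp only [PP, LinearMap.coe_restrictScalars, jacMap, LinearMap.coe_mk, AddHom.coe_mk, map_sum]
  refine Finset.sum_congr rfl fun j _ => ?_
  have : s + d - 1 = (d - 1) + (s - 0) := by omega
  rw [mul_comm, this, hc_mul hhom.pderiv, mul_comm]

lemma range_jac (f : S4) : LinearMap.range (jacMap f) = jacIdeal f := by
  ext x
  rw [jacIdeal, Ideal.mem_span_range_iff_exists_fun]
  rfl

lemma hilb_rank (f : S4) (n : ℕ) : (n + 3).choose 3 = hilb f n +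
    Module.finrank ℂ (homogeneousSubmodule (Fin 4) ℂ n ⊓
        (LinearMap.range (jacMap f)).restrictScalars ℂ : Submodule ℂ _) := by
  rw [range_jac, hilb, ← finrank_hom, ← Submodule.map_comap_subtype,
    Submodule.finrank_map_subtype_eq, Submodule.finrank_quotient_add_finrank]

lemma six_choose (n : ℕ) : 6 * (((n + 3).choose 3 : ℕ) : ℤ) = (n + 1) * (n + 2) * (n + 3) := by
  have h := Nat.descFactorial_eq_factorial_mul_choose (n + 3) 3
  simp only [Nat.descFactorial, Nat.factorial] at h
  have h2 : 6 * (n + 3).choose 3 = (n + 1) * (n + 2) * (n + 3) := by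
    rw [show n + 3 - 2 = n + 1 by omega, show n + 3 - 1 = n + 2 by omega] at h
    simp only [Nat.sub_zero, Nat.succ_eq_add_one] at h
    ring_nf at h ⊢
    omega
  exact_mod_cast h2

lemma six_sum {n : ℕ} (e : Fin n → ℕ) (s : ℕ) (h : ∀ i, e i ≤ s) :
    6 * ((∑ i, (s - e i + 3).choose 3 : ℕ) : ℤ) =
      (n : ℤ) * (s : ℤ) ^ 3 - 3 * (∑ i, ((e i : ℤ) - 2)) * (s : ℤ) ^ 2
      + (∑ i, (3 * (e i : ℤ) ^ 2 - 12 * (e i : ℤ) + 11)) * s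
      - ∑ i, ((e i : ℤ) ^ 3 - 6 * (e i : ℤ) ^ 2 + 11 * (e i : ℤ) - 6) := by
  have hn : (n : ℤ) = ∑ _i : Fin n, (1 : ℤ) := by simp
  rw [hn]
  push_cast
  simp only [Finset.mul_sum, Finset.sum_mul]
  rw [← Finset.sum_sub_distrib, ← Finset.sum_add_distrib, ← Finset.sum_sub_distrib]
  refine Finset.sum_congr rfl fun i _ => ?_
  rw [six_choose, Nat.cast_sub (h i)]
  ring

lemma split3 {p : ℕ} (hp : 3 ≤ p) (g : Fin p → ℤ) :
    ∑ i, g i = g ⟨0, by omega⟩ + g ⟨1, by omega⟩ + g ⟨2, by omega⟩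
      + ∑ i ∈ Finset.univ.filter (fun i : Fin p => 3 ≤ (i : ℕ)), g i := by
  obtain ⟨k, rfl⟩ : ∃ k, p = k + 3 := ⟨p - 3, by omega⟩
  rw [Finset.sum_filter]
  simp only [Fin.sum_univ_succ]
  simp [Fin.succ]
  ring

/-- Lemma lem2: for any large integer `s`, `6 dim M(f)_{s+d−1}` is given by
the explicit cubic polynomial in `s` with coefficients determined by the graded Betti numbers
of the resolution. -/
theorem stmt12 (f : S4) (d : ℕ) (hd : 3 ≤ d) (hhom : f.IsHomogeneous d) (hred : Squarefree f)
    (p q r : ℕ) (hp : 3 ≤ p)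
    (dd : Fin p → ℕ) (cc : Fin q → ℕ) (bb : Fin r → ℕ)
    (hddpos : ∀ i, 0 < dd i) (hccpos : ∀ j, 0 < cc j) (hbbpos : ∀ k, 0 < bb k)
    (hddmono : Monotone dd) (hccmono : Monotone cc) (hbbmono : Monotone bb)
    (R : JacRes f dd cc bb) :
    ∃ s0 : ℕ, ∀ s : ℕ, s0 ≤ s →
      6 * (hilb f (s + d - 1) : ℤ) =
        ((p : ℤ) - (q : ℤ) + (r : ℤ) - 3) * (s : ℤ) ^ 3
        + 3 * ((d : ℤ) - 1 - (dd ⟨0, by omega⟩ : ℤ) - (dd ⟨1, by omega⟩ : ℤ)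
            - (dd ⟨2, by omega⟩ : ℤ)
            - (∑ i ∈ Finset.univ.filter (fun i : Fin p => 3 ≤ (i : ℕ)), ((dd i : ℤ) - 2))
            + (∑ j, ((cc j : ℤ) - 2)) - (∑ k, ((bb k : ℤ) - 2))) * (s : ℤ) ^ 2
        + (3 * (d : ℤ) ^ 2 + 6 * (d : ℤ) + 2 - 44
            + (∑ i, (3 * (dd i : ℤ) ^ 2 - 12 * (dd i : ℤ) + 11))
            - (∑ j, (3 * (cc j : ℤ) ^ 2 - 12 * (cc j : ℤ) + 11))
            + (∑ k, (3 * (bb k : ℤ) ^ 2 - 12 * (bb k : ℤ) + 11))) * (s : ℤ)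
        + ((d : ℤ) ^ 3 + 3 * (d : ℤ) ^ 2 + 2 * (d : ℤ) - 24
            - (∑ i, ((dd i : ℤ) ^ 3 - 6 * (dd i : ℤ) ^ 2 + 11 * (dd i : ℤ) - 6))
            + (∑ j, ((cc j : ℤ) ^ 3 - 6 * (cc j : ℤ) ^ 2 + 11 * (cc j : ℤ) - 6))
            - (∑ k, ((bb k : ℤ) ^ 3 - 6 * (bb k : ℤ) ^ 2 + 11 * (bb k : ℤ) - 6))) := by
  have bnd : ∀ {n : ℕ} (e : Fin n → ℕ) (i : Fin n), e i ≤ ∑ j, e j := fun e i =>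
    Finset.single_le_sum (f := e) (fun _ _ => Nat.zero_le _) (Finset.mem_univ i)
  refine ⟨∑ i, dd i + ∑ i, cc i + ∑ i, bb i, fun s hs => ?_⟩
  have hD : ∀ i, dd i ≤ s := fun i => by have := bnd dd i; omega
  have hC : ∀ i, cc i ≤ s := fun i => by have := bnd cc i; omega
  have hB : ∀ i, bb i ≤ s := fun i => by have := bnd bb i; omega
  have r3 := mat_rank R.M3 cc bb s R.hM3 hB
  have r2 := mat_rank R.M2 dd cc s R.hM2 hC
  have r1 := mat_rank R.M1 (fun _ => 0) dd s
    (fun i j => Or.inr ⟨by simp, by simpa using R.hM1 i j⟩) hD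
  have r0 := jac_rank f d (by omega) hhom s
  have rh := hilb_rank f (s + d - 1)
  have hk : LinearMap.ker R.M3.mulVecLin = ⊥ := LinearMap.ker_eq_bot.2 R.inj
  have hz : Module.finrank ℂ (GP bb s ⊓
      (LinearMap.ker R.M3.mulVecLin).restrictScalars ℂ : Submodule ℂ _) = 0 := by
    rw [hk, Submodule.restrictScalars_bot, inf_bot_eq, finrank_bot]
  rw [hz, R.ex2] at r3
  rw [R.ex1] at r2
  rw [R.ex0] at r1
  have sd := six_sum dd s hD
  have sc := six_sum cc s hC
  have sb := six_sum bb s hB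
  have s4 := six_sum (fun _ : Fin 4 => 0) s (by simp)
  have sh := six_choose (s + d - 1)
  rw [r3] at sb
  rw [r2] at sc
  rw [r1] at sd
  rw [r0] at s4
  rw [rh] at sh
  rw [split3 hp (fun i => (dd i : ℤ) - 2)] at sd
  have hcast : ((s + d - 1 : ℕ) : ℤ) = s + d - 1 := by
    rw [Nat.cast_sub (by omega)]; push_cast; ring
  rw [hcast] at sh
  simp only [Fin.sum_univ_four] at s4
  push_cast at sd sc sb s4 sh
  linear_combination sh - s4 + sd - sc + sb
end
end
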